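/- arXiv:1208.3501 — 2 statements merged into one kernel-verified Lean document; each statement's English description precedes it below -/
import Mathlib

section
/- Let X be a subshift on a finite alphabet. If for every ε > 0 there exists a subshift X' ⊆ X that satisfies almost weak specification and has topological entropy h_top(X') > h_top(X) − ε, then X is universal. -/
open MeasureTheory Filter Set
open scoped ENNReal

/-- Shannon entropy of the finite-valued observable `P` with respect to `μ`. -/
noncomputable def infoEntropy {X : Type*} [MeasurableSpace X] (μ : Measure X)
    {α : Type*} [Fintype α] (P : X → α) : ℝ :=
  ∑ a : α, Real.negMulLog (μ (P ⁻¹' {a})).toReal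

/-- Entropy of the transformation `T` with respect to the observable (finite partition) `P`. -/
noncomputable def entropyWrt {X : Type*} [MeasurableSpace X] (μ : Measure X) (T : X → X)
    {α : Type*} [Fintype α] (P : X → α) : ℝ :=
  Filter.atTop.liminf fun n : ℕ =>
    infoEntropy μ (fun x => fun i : Fin n => P (T^[(i : ℕ)] x)) / n

/-- Kolmogorov–Sinai (measure-theoretic) entropy of `T` with respect to `μ`. -/
noncomputable def ksEntropy {X : Type*} [MeasurableSpace X] (μ : Measure X) (T : X → X) : ℝ≥0∞ :=
  ⨆ (k : ℕ) (P : X → Fin k) (_ : Measurable P), ENNReal.ofReal (entropyWrt μ T P)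

/-- Topological entropy (Bowen–Dinaburg, via dynamical covers). -/
noncomputable def topEntropy {Y : Type*} [UniformSpace Y] (S : Y → Y) : EReal :=
  Dynamics.coverEntropy S Set.univ

/-- `Ψ` is an embedding of the measure-preserving system `(X, μ, T)` into `(Y, S)`. -/
def IsMeasEmbedding {X Y : Type*} [MeasurableSpace X] [MeasurableSpace Y]
    (μ : Measure X) (T : X → X) (S : Y → Y) (Ψ : X → Y) : Prop :=
  Measurable Ψ ∧ ∃ X' : Set X, MeasurableSet X' ∧ μ X'ᶜ = 0 ∧ Set.InjOn Ψ X' ∧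
    ∀ x ∈ X', Ψ (T x) = S (Ψ x)

/-- `(Y, S)` is universal. -/
def Universal {Y : Type*} [UniformSpace Y] [MeasurableSpace Y] (S : Y → Y) : Prop :=
  ∀ (X : Type) [MeasurableSpace X] (μ : Measure X) (T : X ≃ᵐ X),
    StandardBorelSpace X → IsProbabilityMeasure μ → NoAtoms μ → Ergodic (⇑T) μ →
    (ksEntropy μ (⇑T) : EReal) < topEntropy S →
    ∃ Ψ : X → Y, IsMeasEmbedding μ (⇑T) S Ψ

/-- `L` is a gap function for the invertible system `S` at scale `ε`. -/
def IsGapFunction {Y : Type*} [MetricSpace Y] (S : Y ≃ Y) (ε : ℝ) (L : ℕ → ℕ) : Prop :=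
  Monotone L ∧ (∀ m, 0 < L m) ∧
    ∀ (n : ℕ) (y : Fin n → Y) (a b : Fin n → ℤ),
      (∀ i, a i ≤ b i) →
      (∀ i j : Fin n, (i : ℕ) + 1 = (j : ℕ) → (L (b j - a j).toNat : ℤ) ≤ a j - b i) →
      ∃ z : Y, ∀ (i : Fin n) (k : ℤ), a i ≤ k → k ≤ b i →
        dist ((S ^ k) z) ((S ^ k) (y i)) ≤ ε

/-- Almost weak specification: for every `ε > 0` there is a sublinear gap function. -/
def AlmostWeakSpec {Y : Type*} [MetricSpace Y] (S : Y ≃ Y) : Prop :=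
  ∀ ε : ℝ, 0 < ε → ∃ L : ℕ → ℕ, IsGapFunction S ε L ∧
    Filter.Tendsto (fun m : ℕ => (L m : ℝ) / m) Filter.atTop (nhds 0)

/-- The shift map on bi-infinite sequences. -/
def fullShift {A : Type*} : (ℤ → A) → (ℤ → A) := fun x n => x (n + 1)

noncomputable instance (k : ℕ) : MetricSpace (Fin k) :=
  MetricSpace.induced (fun i : Fin k => (i : ℝ))
    (fun a b h => Fin.val_injective (Nat.cast_injective h)) inferInstance

/-- The standard metric on the full shift over a finite alphabet. -/
noncomputable instance (k : ℕ) : MetricSpace (ℤ → Fin k) := PiCountable.metricSpace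

instance (k : ℕ) : MeasurableSpace (ℤ → Fin k) := borel _
instance (k : ℕ) : BorelSpace (ℤ → Fin k) := ⟨rfl⟩

section Words

variable {A : Type*}

/-- Restriction of a bi-infinite sequence to `[0, n)`. -/
def firstLetters (n : ℕ) (y : ℤ → A) : Fin n → A := fun i => y (i : ℕ)

/-- Number of words of length `n` occurring in `Y`. -/
noncomputable def wordCount (Y : Set (ℤ → A)) (n : ℕ) : ℕ := (firstLetters n '' Y).ncard

/-- The combinatorial properties of a subshift used in the coding construction: it is closed,
shift-invariant, has a sublinear gap function `g`, and its words grow at exponential rate `h`. -/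
structure SpecSubshift (Y : Set (ℤ → A)) (g : ℕ → ℕ) (h : ℝ) : Prop where
  shift : ∀ y ∈ Y, ∀ j : ℤ, (fun i => y (i + j)) ∈ Y
  closed : ∀ z : ℤ → A, (∀ r : ℕ, ∃ y ∈ Y, ∀ i : ℤ, |i| ≤ r → y i = z i) → z ∈ Y
  spec : ∀ (s : Finset ℤ) (l : ℤ → ℕ) (y : ℤ → ℤ → A), (∀ i ∈ s, 0 < l i) → (∀ i ∈ s, y i ∈ Y) →
    (∀ i ∈ s, ∀ j ∈ s, i < j → i + l i + g (l j) ≤ j) →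
    ∃ z ∈ Y, ∀ i ∈ s, ∀ t : ℕ, t < l i → z (i + t) = y i t
  gap_sublinear : Tendsto (fun n : ℕ => (g n : ℝ) / n) atTop (nhds 0)
  rate_pos : 0 < h
  le_wordCount : ∀ n : ℕ, Real.exp (n * h) ≤ wordCount Y n
  wordCount_le : ∀ η : ℝ, 0 < η → ∃ C : ℝ, 1 ≤ C ∧ ∀ n : ℕ, wordCount Y n ≤ C * Real.exp (n * (h + η))

lemma eventually_mul_lt_exp (C a : ℝ) (ha : 0 < a) :
    ∀ᶠ n : ℕ in atTop, C * (n + 1) < Real.exp (a * n) := by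
  have h1 : Tendsto (fun x : ℝ => Real.exp (a * x) / x ^ (1 : ℕ)) atTop atTop := by
    simpa using tendsto_exp_mul_div_rpow_atTop 1 a ha
  have h2 := (h1.comp tendsto_natCast_atTop_atTop).eventually_gt_atTop (2 * |C|)
  filter_upwards [h2, eventually_ge_atTop 1] with n hn hn1
  have hn' : (1 : ℝ) ≤ n := by exact_mod_cast hn1
  simp only [Function.comp, pow_one] at hn
  rw [lt_div_iff₀ (by linarith)] at hn
  have : C ≤ |C| := le_abs_self C
  nlinarith [abs_nonneg C]

variable [Finite A] {Y : Set (ℤ → A)} {g : ℕ → ℕ} {h : ℝ}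

lemma wordCount_mul_le {S : Set (ℤ → A)} {k m n : ℕ} (hS : S ⊆ Y)
    (hY : ∀ y ∈ Y, ∀ j : ℤ, (fun i => y (i + j)) ∈ Y) (a b : ℕ)
    (hdet : ∀ y ∈ S, ∀ z ∈ S, (∀ i < m, y (a + i : ℕ) = z (a + i : ℕ)) →
      (∀ i < n, y (b + i : ℕ) = z (b + i : ℕ)) → ∀ i < k, y (i : ℕ) = z (i : ℕ)) :
    (firstLetters k '' S).ncard ≤ wordCount Y m * wordCount Y n := by
  classical
  rw [wordCount, wordCount, ← Set.ncard_prod]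
  let F : (ℤ → A) → (Fin m → A) × (Fin n → A) :=
    fun y => (firstLetters m (fun i => y (i + a)), firstLetters n (fun i => y (i + b)))
  rcases S.eq_empty_or_nonempty with rfl | ⟨y₀, -⟩
  · simp
  have : Nonempty (ℤ → A) := ⟨y₀⟩
  have hex : ∀ w : Fin k → A, ∃ y, w ∈ firstLetters k '' S → y ∈ S ∧ firstLetters k y = w := by
    intro w
    by_cases hw : w ∈ firstLetters k '' S
    · obtain ⟨y, hy⟩ := hw; exact ⟨y, fun _ => hy⟩
    · exact ⟨y₀, fun h => absurd h hw⟩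
  choose c hc' using hex
  have hcS := fun w hw => (hc' w hw).1
  have hc := fun w hw => (hc' w hw).2
  refine Set.ncard_le_ncard_of_injOn (fun w => F (c w)) ?_ ?_ (Set.toFinite _)
  · intro w hw
    exact ⟨⟨_, hY _ (hS (hcS w hw)) a, rfl⟩, ⟨_, hY _ (hS (hcS w hw)) b, rfl⟩⟩
  · intro w hw v hv hwv
    rw [← hc w hw, ← hc v hv]
    simp only [F, Prod.mk.injEq] at hwv
    have := hdet _ (hcS w hw) _ (hcS v hv) (fun i hi => ?_) (fun i hi => ?_)
    · funext i; exact this i i.2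
    · have := congrFun hwv.1 ⟨i, hi⟩
      simpa [firstLetters, add_comm] using this
    · have := congrFun hwv.2 ⟨i, hi⟩
      simpa [firstLetters, add_comm] using this

lemma ncard_biUnion_range_le {β : Type*} [Finite β] (n : ℕ) (s : ℕ → Set β) (c : ℝ)
    (hs : ∀ i < n, ((s i).ncard : ℝ) ≤ c) :
    (((⋃ i ∈ Finset.range n, s i) : Set β).ncard : ℝ) ≤ n * c := by
  induction n with
  | zero => simp
  | succ n ih =>
    have : (⋃ i ∈ Finset.range (n + 1), s i) = s n ∪ ⋃ i ∈ Finset.range n, s i := by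
      simp [Finset.range_add_one]
    rw [this]
    have h1 : ((s n ∪ ⋃ i ∈ Finset.range n, s i).ncard : ℝ) ≤
        (s n).ncard + (⋃ i ∈ Finset.range n, s i).ncard := by
      exact_mod_cast Set.ncard_union_le _ _
    have := ih fun i hi => hs i (by omega)
    have := hs n (by omega)
    push_cast
    linarith

/-- A long word avoiding a given word of comparable length. -/
lemma SpecSubshift.exists_avoiding (hY : SpecSubshift Y g h) {β : ℝ} (hβ : 0 < β) :
    ∀ᶠ L : ℕ in atTop, ∀ m : ℕ, β * L ≤ m → ∀ u : ℕ → A,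
      ∃ e ∈ Y, ∀ j : ℕ, j + m ≤ L → ∃ i < m, e (j + i : ℕ) ≠ u i := by
  obtain ⟨C, hC1, hC⟩ := hY.wordCount_le (β * h / 2) (by have := hY.rate_pos; positivity)
  have h0 := hY.rate_pos
  filter_upwards [eventually_mul_lt_exp (C ^ 2) (β * h / 2) (by positivity)] with L hL m hm u
  by_contra! hcon
  have hcov : firstLetters L '' Y ⊆ ⋃ j ∈ Finset.range (L + 1),
      firstLetters L '' {y ∈ Y | j + m ≤ L ∧ ∀ i < m, y (j + i : ℕ) = u i} := by
    rintro _ ⟨y, hy, rfl⟩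
    obtain ⟨j, hj, hju⟩ := hcon y hy
    simp only [Set.mem_iUnion, Finset.mem_range]
    exact ⟨j, by omega, y, ⟨hy, hj, hju⟩, rfl⟩
  have hb : ∀ j < L + 1, ((firstLetters L ''
      {y ∈ Y | j + m ≤ L ∧ ∀ i < m, y (j + i : ℕ) = u i}).ncard : ℝ) ≤
      C ^ 2 * Real.exp (((L : ℝ) - m) * (h + β * h / 2)) := by
    intro j _
    by_cases hj : j + m ≤ L
    · obtain ⟨r, rfl⟩ := Nat.exists_eq_add_of_le hj
      have h1 := wordCount_mul_le (k := j + m + r) (m := j) (n := r) (Y := Y)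
        (S := {y ∈ Y | j + m ≤ j + m + r ∧ ∀ i < m, y (j + i : ℕ) = u i}) (fun y hy => hy.1)
        hY.shift 0 (j + m) (by
          intro y hy z hz h1 h2 i hi
          by_cases hij : i < j
          · simpa using h1 i hij
          · by_cases hij' : i < j + m
            · have e1 := hy.2.2 (i - j) (by omega)
              have e2 := hz.2.2 (i - j) (by omega)
              rw [show j + (i - j) = i by omega] at e1 e2
              rw [e1, e2]
            · have := h2 (i - (j + m)) (by omega)
              rwa [show j + m + (i - (j + m)) = i by omega] at this)
      have h2 := hC j
      have h3 := hC r
      calc _ ≤ ((wordCount Y j * wordCount Y r : ℕ) : ℝ) := by exact_mod_cast h1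
        _ ≤ (C * Real.exp (j * (h + β * h / 2))) * (C * Real.exp (r * (h + β * h / 2))) := by
          push_cast; gcongr
        _ = _ := by
          rw [show (((j + m + r : ℕ) : ℝ) - m) * (h + β * h / 2) =
            j * (h + β * h / 2) + r * (h + β * h / 2) by push_cast; ring, Real.exp_add]
          ring
    · rw [show {y ∈ Y | j + m ≤ L ∧ ∀ i < m, y (j + i : ℕ) = u i} = ∅ by
        ext y; simp [hj]]
      simp; positivity
  have h1 := ncard_biUnion_range_le (L + 1) _ _ hb
  have h2 : ((firstLetters L '' Y).ncard : ℝ) ≤ (⋃ j ∈ Finset.range (L + 1),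
      firstLetters L '' {y ∈ Y | j + m ≤ L ∧ ∀ i < m, y (j + i : ℕ) = u i}).ncard := by
    exact_mod_cast Set.ncard_le_ncard hcov (Set.toFinite _)
  have h3 := hY.le_wordCount L
  rw [wordCount] at h3
  have h4 : Real.exp (((L : ℝ) - m) * (h + β * h / 2)) ≤
      Real.exp (L * h) * Real.exp (-(β * h / 2 * L)) := by
    rw [← Real.exp_add, Real.exp_le_exp]
    nlinarith [mul_le_mul_of_nonneg_right hm (by positivity : 0 ≤ h + β * h / 2),
      mul_nonneg (mul_nonneg hβ.le (Nat.cast_nonneg (α := ℝ) L)) (mul_pos hβ h0).le]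
  have h5 : Real.exp (L * h) ≤ Real.exp (L * h) *
      (C ^ 2 * (L + 1) * Real.exp (-(β * h / 2 * L))) := by
    calc Real.exp (L * h) ≤ ((L + 1 : ℕ) : ℝ) *
          (C ^ 2 * Real.exp (((L : ℝ) - m) * (h + β * h / 2))) := h3.trans (h2.trans h1)
      _ ≤ ((L + 1 : ℕ) : ℝ) * (C ^ 2 * (Real.exp (L * h) * Real.exp (-(β * h / 2 * L)))) := by
        gcongr
      _ = _ := by push_cast; ring
  have h6 : C ^ 2 * (L + 1) * Real.exp (-(β * h / 2 * L)) < 1 := by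
    rw [Real.exp_neg, ← div_eq_mul_inv, div_lt_one (Real.exp_pos _)]
    exact hL
  nlinarith [Real.exp_pos (L * h)]

/-- Large families of words of length `k` sharing an initial word that does not recur. -/
lemma SpecSubshift.exists_headers (hY : SpecSubshift Y g h) {δ : ℝ} (hδ : 0 < δ) :
    ∃ α : ℝ, 0 < α ∧ ∀ᶠ k : ℕ in atTop, ∃ m : ℕ, α * k ≤ m ∧ 2 * m ≤ k ∧ ∃ u : ℕ → A,
      ∀ M : ℕ, (M : ℝ) ≤ Real.exp (k * (h - δ)) → ∃ c : Fin M → ℤ → A, (∀ a, c a ∈ Y) ∧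
        (∀ a b, (∀ i < k, c a (i : ℕ) = c b (i : ℕ)) → a = b) ∧
        (∀ a, ∀ i < m, c a (i : ℕ) = u i) ∧
        (∀ a, ∀ s, 0 < s → s + m ≤ k → ∃ i < m, c a (s + i : ℕ) ≠ u i) := by
  classical
  have h0 := hY.rate_pos
  set α : ℝ := min (1 / 8) (δ / (8 * h)) with hα
  have hα0 : 0 < α := lt_min (by norm_num) (by positivity)
  have hα1 : α ≤ 1 / 8 := min_le_left _ _
  have hα2 : α * h ≤ δ / 8 := by
    have : α ≤ δ / (8 * h) := min_le_right _ _
    calc α * h ≤ δ / (8 * h) * h := by gcongr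
      _ = δ / 8 := by field_simp
  obtain ⟨C, hC1, hC⟩ := hY.wordCount_le (α * h / 2) (by positivity)
  refine ⟨α, hα0, ?_⟩
  filter_upwards [eventually_mul_lt_exp (2 * C) (α * h / 2) (by positivity),
    eventually_mul_lt_exp (2 * C) (δ / 2) (by positivity),
    eventually_ge_atTop ⌈1 / α⌉₊] with k hk1 hk2 hk3
  have hk : 1 ≤ α * k := by
    have : 1 / α ≤ k := (Nat.le_ceil _).trans (by exact_mod_cast hk3)
    rwa [div_le_iff₀ hα0, mul_comm] at this
  set m := ⌈α * k⌉₊ with hm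
  have hm1 : α * k ≤ m := Nat.le_ceil _
  have hm2 : (m : ℝ) ≤ 2 * (α * k) := by
    have := (Nat.ceil_lt_add_one (by positivity : 0 ≤ α * k)).le
    linarith
  have hmk : 2 * m ≤ k := by
    have : (2 : ℝ) * m ≤ k := by nlinarith [(Nat.cast_nonneg k : (0 : ℝ) ≤ k)]
    exact_mod_cast this
  set S : Set (ℤ → A) := {y ∈ Y | ∀ s, 0 < s → s + m ≤ k → ∃ i < m, y (s + i : ℕ) ≠ y (i : ℕ)}
    with hS
  set R : ℕ → Set (ℤ → A) := fun s =>
    {y ∈ Y | 0 < s ∧ s + m ≤ k ∧ ∀ i < m, y (s + i : ℕ) = y (i : ℕ)} with hR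
  have hcov : firstLetters k '' Y ⊆ firstLetters k '' S ∪
      ⋃ s ∈ Finset.range (k + 1), firstLetters k '' R s := by
    rintro _ ⟨y, hy, rfl⟩
    by_cases hyS : y ∈ S
    · exact Or.inl ⟨y, hyS, rfl⟩
    · right
      simp only [hS, Set.mem_ofPred_eq, not_and, not_forall] at hyS
      obtain ⟨s, hs0, hs, hs'⟩ := hyS hy
      push Not at hs'
      simp only [Set.mem_iUnion, Finset.mem_range]
      exact ⟨s, by omega, y, ⟨hy, hs0, hs, hs'⟩, rfl⟩
  have hRb : ∀ s < k + 1, ((firstLetters k '' R s).ncard : ℝ) ≤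
      C * Real.exp (((k : ℝ) - m) * (h + α * h / 2)) := by
    intro s _
    have h1 := wordCount_mul_le (k := k) (m := 0) (n := k - m) (Y := Y) (S := R s)
      (fun y hy => hy.1) hY.shift 0 m (by
        intro y hy z hz _ h2 i hi
        have key : ∀ r i : ℕ, k - i ≤ r → i < k → y (i : ℕ) = z (i : ℕ) := by
          intro r
          induction r with
          | zero => intro i hi; omega
          | succ r ih =>
            intro i hir hik
            by_cases him : i < m
            · rw [← hy.2.2.2 i him, ← hz.2.2.2 i him]
              have := hy.2.1
              have := hy.2.2.1
              exact ih _ (by omega) (by omega)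
            · have := h2 (i - m) (by omega)
              rwa [show m + (i - m) = i by omega] at this
        exact key _ i le_rfl hi)
    have hz : wordCount Y 0 ≤ 1 := by
      have : (firstLetters 0 '' Y).Subsingleton := by
        intro a _ b _; exact Subsingleton.elim _ _
      exact Set.ncard_le_one_iff_subsingleton.2 this
    calc _ ≤ ((wordCount Y 0 * wordCount Y (k - m) : ℕ) : ℝ) := by exact_mod_cast h1
      _ ≤ ((1 * wordCount Y (k - m) : ℕ) : ℝ) := by gcongr
      _ ≤ _ := by
        have := hC (k - m)
        rw [Nat.cast_sub (by omega)] at this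
        rwa [one_mul]
  have h1 := ncard_biUnion_range_le (k + 1) _ _ hRb
  have h2 : ((firstLetters k '' Y).ncard : ℝ) ≤ (firstLetters k '' S).ncard +
      (⋃ s ∈ Finset.range (k + 1), firstLetters k '' R s).ncard := by
    exact_mod_cast (Set.ncard_le_ncard hcov (Set.toFinite _)).trans (Set.ncard_union_le _ _)
  have h3 := hY.le_wordCount k
  rw [wordCount] at h3
  have h4 : Real.exp (((k : ℝ) - m) * (h + α * h / 2)) ≤
      Real.exp (k * h) * Real.exp (-(α * h / 2 * k)) := by
    rw [← Real.exp_add, Real.exp_le_exp]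
    nlinarith [mul_le_mul_of_nonneg_right hm1 (by positivity : 0 ≤ h + α * h / 2),
      mul_nonneg (mul_nonneg hα0.le (Nat.cast_nonneg (α := ℝ) k)) (mul_pos hα0 h0).le]
  have h5 : ((k + 1 : ℕ) : ℝ) * (C * Real.exp (((k : ℝ) - m) * (h + α * h / 2))) ≤
      Real.exp (k * h) / 2 := by
    have h6 : 2 * C * (k + 1) * Real.exp (-(α * h / 2 * k)) ≤ 1 := by
      rw [Real.exp_neg, ← div_eq_mul_inv, div_le_one (Real.exp_pos _)]
      exact hk1.le
    calc _ ≤ ((k + 1 : ℕ) : ℝ) * (C * (Real.exp (k * h) * Real.exp (-(α * h / 2 * k)))) := by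
          gcongr
      _ = Real.exp (k * h) / 2 * (2 * C * (k + 1) * Real.exp (-(α * h / 2 * k))) := by
          push_cast; ring
      _ ≤ Real.exp (k * h) / 2 * 1 := by gcongr
      _ = _ := by ring
  have h6 : Real.exp (k * h) / 2 ≤ (firstLetters k '' S).ncard := by linarith
  have hYne : Y.Nonempty := by
    have h7 := hY.le_wordCount 0
    by_contra hne
    rw [Set.not_nonempty_iff_eq_empty] at hne
    simp only [hne, wordCount, Set.image_empty, Set.ncard_empty] at h7
    exact absurd h7 (by simp)
  have hpig := Finset.exists_le_card_fiber_of_nsmul_le_card_of_maps_to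
    (s := (Set.toFinite (firstLetters k '' S)).toFinset)
    (t := (Set.toFinite (firstLetters m '' Y)).toFinset)
    (f := fun w i => w ⟨i, by omega⟩) (b := Real.exp (k * (h - δ)))
    (by
      intro w hw
      simp only [Set.Finite.mem_toFinset] at hw ⊢
      obtain ⟨y, hy, rfl⟩ := hw
      exact ⟨y, hy.1, rfl⟩)
    (by simpa using hYne)
    (by
      rw [← Set.ncard_eq_toFinset_card _, ← Set.ncard_eq_toFinset_card _, nsmul_eq_mul]
      refine le_trans ?_ h6
      have h7 := hC m
      rw [wordCount] at h7
      have h8 : Real.exp (m * (h + α * h / 2)) ≤ Real.exp (δ / 2 * k) := by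
        rw [Real.exp_le_exp]
        have hk0 : (0 : ℝ) ≤ k := Nat.cast_nonneg k
        calc (m : ℝ) * (h + α * h / 2) ≤ (2 * (α * k)) * (h + α * h / 2) := by gcongr
          _ ≤ (2 * (α * k)) * (2 * h) := by gcongr; nlinarith
          _ = (α * h) * (4 * k) := by ring
          _ ≤ δ / 8 * (4 * k) := by gcongr
          _ = _ := by ring
      have h9 : 2 * C ≤ Real.exp (δ / 2 * k) := by
        have : (0 : ℝ) ≤ k := Nat.cast_nonneg k
        nlinarith
      calc ((firstLetters m '' Y).ncard : ℝ) * Real.exp (k * (h - δ))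
          ≤ (C * Real.exp (δ / 2 * k)) * Real.exp (k * (h - δ)) := by
            gcongr; exact h7.trans (by gcongr)
        _ ≤ (Real.exp (δ / 2 * k) / 2 * Real.exp (δ / 2 * k)) * Real.exp (k * (h - δ)) := by
            gcongr; linarith
        _ = Real.exp (δ / 2 * k + δ / 2 * k + k * (h - δ)) / 2 := by
            rw [Real.exp_add, Real.exp_add]; ring
        _ = Real.exp (k * h) / 2 := by ring_nf)
  obtain ⟨v, hv, hcard⟩ := hpig
  rw [Set.Finite.mem_toFinset] at hv
  obtain ⟨y₀, -, rfl⟩ := hv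
  refine ⟨m, hm1, hmk, fun i => y₀ i, fun M hM => ?_⟩
  set fib := (Set.toFinite (firstLetters k '' S)).toFinset.filter
    (fun w => (fun i : Fin m => w ⟨i, by omega⟩) = firstLetters m y₀) with hfib
  have hMf : M ≤ fib.card := by exact_mod_cast hM.trans hcard
  have hex : ∀ a : Fin M, ∃ y ∈ S,
      firstLetters k y = (fib.equivFin.symm (Fin.castLE hMf a) : Fin k → A) ∧
      ∀ i < m, y (i : ℕ) = y₀ (i : ℕ) := by
    intro a
    obtain ⟨hmem, hw⟩ := Finset.mem_filter.1 (fib.equivFin.symm (Fin.castLE hMf a)).2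
    obtain ⟨y, hy, hyw⟩ := (Set.Finite.mem_toFinset _).1 hmem
    refine ⟨y, hy, hyw, fun i hi => ?_⟩
    rw [← hyw] at hw
    exact congrFun hw ⟨i, hi⟩
  choose c hcS hcw hcu using hex
  refine ⟨c, fun a => (hcS a).1, fun a b hab => ?_, hcu, fun a s hs hsm => ?_⟩
  · have : firstLetters k (c a) = firstLetters k (c b) := by
      funext i; exact hab i i.2
    rw [hcw, hcw] at this
    have := fib.equivFin.symm.injective (Subtype.ext this)
    exact Fin.castLE_injective hMf this
  · obtain ⟨i, hi, hne⟩ := (hcS a).2 s hs hsm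
    refine ⟨i, hi, ?_⟩
    show c a (s + i : ℕ) ≠ y₀ (i : ℕ)
    rwa [← hcu a i hi]

end Words

section Ergodic

variable {X : Type*} [MeasurableSpace X] {μ : Measure X}

/-- Time averages of a square-integrable function converge in measure to its mean. -/
lemma Ergodic.eventually_measureReal_birkhoffSum_le [IsProbabilityMeasure μ] {T : X → X}
    (hT : Ergodic T μ) {F : X → ℝ} (hF : MemLp F 2 μ) {ε : ℝ} (hε : 0 < ε) :
    ∀ᶠ n : ℕ in atTop, μ.real {x | ε * n < |∑ i ∈ Finset.range n, F (T^[i] x) - n * ∫ y, F y ∂μ|}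
      ≤ ε := by
  have hmp := hT.toMeasurePreserving
  let U : Lp ℝ 2 μ →L[ℝ] Lp ℝ 2 μ :=
    (Lp.compMeasurePreservingₗᵢ ℝ T hmp).toContinuousLinearMap
  have hU : ‖U‖ ≤ 1 := LinearIsometry.norm_toContinuousLinearMap_le _
  have hUi : ∀ (i : ℕ) (f : Lp ℝ 2 μ), (U^[i] f : X → ℝ) =ᵐ[μ] f ∘ T^[i] := by
    intro i f
    have : U^[i] f = Lp.compMeasurePreserving T^[i] (hmp.iterate i) f := by
      rw [← Lp.compMeasurePreserving_iterate]; rfl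
    rw [this]
    exact Lp.coeFn_compMeasurePreserving _ _
  set f := hF.toLp F with hf
  have hlim := U.tendsto_birkhoffAverage_orthogonalProjection hU f
  set P := (U.eqLocus (1 : Lp ℝ 2 μ →L[ℝ] Lp ℝ 2 μ)).orthogonalProjectionOnto f with hP
  have hPfix : U P.1 = P.1 := P.2
  obtain ⟨c, hc⟩ := hT.eq_const_of_compMeasurePreserving_eq (g := (P.1).1)
    (congrArg Subtype.val hPfix)
  have hcP : (P.1 : X → ℝ) =ᵐ[μ] fun _ => c := by
    have : ((P.1).1 : X → ℝ) =ᵐ[μ] fun _ => c := by rw [hc]; exact AEEqFun.coeFn_const _ _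
    exact this
  set one : Lp ℝ 2 μ := (memLp_const (1 : ℝ)).toLp (fun _ => (1 : ℝ)) with hone
  have hone1 : (one : X → ℝ) =ᵐ[μ] fun _ => 1 := MemLp.coeFn_toLp _
  have hmem : one ∈ U.eqLocus (1 : Lp ℝ 2 μ →L[ℝ] Lp ℝ 2 μ) := by
    show U one = one
    apply Lp.ext
    refine (hUi 1 one).trans ?_
    refine ((hmp.quasiMeasurePreserving.ae_eq_comp hone1)).trans ?_
    exact hone1.symm
  have horth : inner ℝ one (f - P.1) = 0 := by
    have := Submodule.sub_starProjection_mem_orthogonal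
      (K := U.eqLocus (1 : Lp ℝ 2 μ →L[ℝ] Lp ℝ 2 μ)) f
    exact this one hmem
  have hcint : c = ∫ y, F y ∂μ := by
    rw [L2.inner_def] at horth
    have h1 : (fun a => inner ℝ (one a) ((f - P.1 : Lp ℝ 2 μ) a)) =ᵐ[μ] fun a => F a - c := by
      filter_upwards [hone1, Lp.coeFn_sub f P.1, hF.coeFn_toLp, hcP] with a h1 h2 h3 h4
      rw [h1, h2]
      simp [h3, h4, hf]
    rw [integral_congr_ae h1, integral_sub (hF.integrable (by norm_num)) (integrable_const _)]
      at horth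
    simp at horth
    linarith
  have hmeas := tendstoInMeasure_of_tendsto_Lp hlim
  have hmeas' := hmeas (ENNReal.ofReal ε) (by simpa using hε)
  have hev := hmeas'.eventually_lt_const (u := ENNReal.ofReal ε) (by simpa using hε)
  filter_upwards [hev, eventually_gt_atTop 0] with n hn hn0
  have hn0' : (0 : ℝ) < n := by exact_mod_cast hn0
  refine ENNReal.toReal_le_of_le_ofReal hε.le ((measure_mono_ae ?_).trans hn.le)
  have hall : ∀ᵐ x ∂μ, ∀ i : ℕ, (U^[i] f) x = F (T^[i] x) := by
    rw [ae_all_iff]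
    intro i
    have h1 := (hmp.iterate i).quasiMeasurePreserving.ae_eq_comp hF.coeFn_toLp
    exact (hUi i f).trans h1
  have hsum : ((birkhoffAverage ℝ U id n f : Lp ℝ 2 μ) : X → ℝ) =ᵐ[μ]
      fun x => (n : ℝ)⁻¹ * ∑ i ∈ Finset.range n, (U^[i] f) x := by
    rw [birkhoffAverage, birkhoffSum]
    have h1 := Lp.coeFn_smul ((n : ℝ)⁻¹) (∑ i ∈ Finset.range n, id (U^[i] f))
    have h2 : ∀ m : ℕ, ((∑ i ∈ Finset.range m, id (U^[i] f) : Lp ℝ 2 μ) : X → ℝ) =ᵐ[μ]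
        fun x => ∑ i ∈ Finset.range m, (U^[i] f) x := by
      intro m
      induction m with
      | zero => exact Lp.coeFn_zero ℝ 2 μ
      | succ m ih =>
        rw [Finset.sum_range_succ]
        filter_upwards [Lp.coeFn_add (∑ i ∈ Finset.range m, id (U^[i] f)) (U^[m] f), ih]
          with x h1 h2
        rw [Finset.sum_range_succ, ← h2]
        exact h1
    filter_upwards [h1, h2 n] with x h1 h2
    rw [h1, Pi.smul_apply, smul_eq_mul, h2]
  filter_upwards [hall, hsum, hcP] with x h1 h2 h3 h4
  have h4' : ε * n < |∑ i ∈ Finset.range n, F (T^[i] x) - n * ∫ y, F y ∂μ| := h4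
  show ENNReal.ofReal ε ≤ edist _ _
  rw [h2, h3, edist_dist, Real.dist_eq]
  apply ENNReal.ofReal_le_ofReal
  simp only [h1, hcint]
  have : (n : ℝ)⁻¹ * ∑ i ∈ Finset.range n, F (T^[i] x) - ∫ y, F y ∂μ =
      (∑ i ∈ Finset.range n, F (T^[i] x) - n * ∫ y, F y ∂μ) / n := by field_simp
  rw [this, abs_div, abs_of_pos hn0', le_div_iff₀ hn0']
  exact h4'.le

end Ergodic

section Names

variable {X : Type*}

/-- The itinerary of length `n` of `x` with respect to the observable `P`. -/
def itinerary {ρ : Type*} (T : X → X) (P : X → ρ) (n : ℕ) (x : X) : Fin n → ρ :=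
  fun i => P (T^[i] x)

/-- All preimages of sets under `P` are measurable. -/
def MeasObs [MeasurableSpace X] {ρ : Type*} (P : X → ρ) : Prop :=
  ∀ s : Set ρ, MeasurableSet (P ⁻¹' s)

variable [MeasurableSpace X] {μ : Measure X} {ρ : Type*}

lemma MeasObs.comp {π : Type*} {P : X → ρ} (hP : MeasObs P) (f : ρ → π) :
    MeasObs fun x => f (P x) := fun s => hP (f ⁻¹' s)

lemma MeasObs.measurableSet {P : X → ρ} (hP : MeasObs P) (p : ρ → Prop) :
    MeasurableSet {x | p (P x)} := hP {r | p r}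

lemma MeasObs.comp_measurable {P : X → ρ} (hP : MeasObs P) {T : X → X} (hT : Measurable T) :
    MeasObs fun x => P (T x) := fun s => hT (hP s)

lemma MeasObs.pi {ι : Type*} [Finite ι] {ρ : ι → Type*} [∀ i, Finite (ρ i)]
    {P : ∀ i, X → ρ i} (hP : ∀ i, MeasObs (P i)) : MeasObs fun x i => P i x := by
  intro s
  have : (fun x i => P i x) ⁻¹' s = ⋃ v ∈ s, ⋂ i, P i ⁻¹' {v i} := by
    ext x
    simp only [Set.mem_preimage, Set.mem_iUnion, Set.mem_iInter, Set.mem_singleton_iff]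
    constructor
    · intro hx; exact ⟨_, hx, fun i => rfl⟩
    · rintro ⟨v, hv, hx⟩
      rwa [show (fun i => P i x) = v from funext hx]
  rw [this]
  exact (Set.toFinite s).measurableSet_biUnion fun v _ =>
    MeasurableSet.iInter fun i => hP i _

lemma MeasObs.prodMk {π : Type*} [Finite ρ] [Finite π] {P : X → ρ} {Q : X → π}
    (hP : MeasObs P) (hQ : MeasObs Q) : MeasObs fun x => (P x, Q x) := by
  intro s
  have : (fun x => (P x, Q x)) ⁻¹' s = ⋃ v ∈ s, P ⁻¹' {v.1} ∩ Q ⁻¹' {v.2} := by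
    ext x
    simp only [Set.mem_preimage, Set.mem_iUnion, Set.mem_inter_iff, Set.mem_singleton_iff]
    constructor
    · intro hx; exact ⟨_, hx, rfl, rfl⟩
    · rintro ⟨⟨a, b⟩, hv, rfl, rfl⟩
      exact hv
  rw [this]
  exact (Set.toFinite s).measurableSet_biUnion fun v _ => (hP _).inter (hQ _)

lemma measObs_mem {s : Set X} (hs : MeasurableSet s) : MeasObs fun x => x ∈ s := by
  intro t
  by_cases h1 : True ∈ t <;> by_cases h2 : False ∈ t
  · convert MeasurableSet.univ using 1
    ext x; by_cases hx : x ∈ s <;> simp [hx, h1, h2]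
  · convert hs using 1
    ext x; by_cases hx : x ∈ s <;> simp [hx, h1, h2]
  · convert hs.compl using 1
    ext x; by_cases hx : x ∈ s <;> simp [hx, h1, h2]
  · convert MeasurableSet.empty using 1
    ext x; by_cases hx : x ∈ s <;> simp [hx, h1, h2]

lemma MeasObs.itinerary [Finite ρ] {P : X → ρ} (hP : MeasObs P) {T : X → X} (hT : Measurable T)
    (n : ℕ) : MeasObs (itinerary T P n) :=
  MeasObs.pi fun i => hP.comp_measurable (hT.iterate i)

lemma MeasObs.sum_measureReal [Fintype ρ] [IsFiniteMeasure μ] {P : X → ρ} (hP : MeasObs P)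
    (s : Set ρ) [DecidablePred (· ∈ s)] :
    ∑ a with a ∈ s, μ.real (P ⁻¹' {a}) = μ.real (P ⁻¹' s) := by
  rw [← measureReal_biUnion_finset]
  · congr 1; ext x; simp
  · intro a _ b _ hab
    exact Disjoint.preimage _ (by simpa using hab)
  · intro a _; exact hP _

lemma MeasObs.integral_comp [Fintype ρ] [IsFiniteMeasure μ] {P : X → ρ} (hP : MeasObs P)
    (J : ρ → ℝ) : ∫ x, J (P x) ∂μ = ∑ a, μ.real (P ⁻¹' {a}) * J a := by
  classical
  have h1 : (fun x => J (P x)) = fun x => ∑ a, (P ⁻¹' {a}).indicator (fun _ => J a) x := by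
    funext x
    rw [Finset.sum_eq_single (P x)]
    · simp
    · intro b _ hb; simp [Ne.symm hb]
    · simp
  rw [h1, integral_finsetSum]
  · refine Finset.sum_congr rfl fun a _ => ?_
    rw [integral_indicator_const _ (hP _), smul_eq_mul]
  · intro a _
    exact (integrable_const _).indicator (hP _)

lemma MeasObs.memLp [Finite ρ] [IsFiniteMeasure μ] {P : X → ρ} (hP : MeasObs P)
    (J : ρ → ℝ) (p : ℝ≥0∞) : MemLp (fun x => J (P x)) p μ := by
  obtain ⟨C, hC⟩ := (Set.finite_range fun a => ‖J a‖).bddAbove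
  refine MemLp.of_bound ?_ C (ae_of_all _ fun x => hC ⟨P x, rfl⟩)
  exact (show Measurable fun x => J (P x) from fun s _ => hP (J ⁻¹' s)).aestronglyMeasurable

end Names

section Counting

lemma card_le_of_weights {W κ β C : Type*} [Fintype W] [DecidableEq κ] [Fintype C] (t : ℕ) (q : W → ℝ)
    (hq : ∀ w, 0 ≤ q w) (f : W → κ) (hsum : ∀ p, ∑ w with f w = p, q w ≤ 1)
    (V : Finset β) (enc : β → Fin t → W) (edge : β → C)
    (hinj : ∀ v ∈ V, ∀ v' ∈ V, enc v = enc v' → edge v = edge v' → v = v')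
    (p : Fin t → κ) (hp : ∀ v ∈ V, ∀ s, f (enc v s) = p s) (a : ℝ)
    (ha : ∀ v ∈ V, Real.exp (-a) ≤ ∏ s, q (enc v s)) :
    (V.card : ℝ) ≤ Fintype.card C * Real.exp a := by
  classical
  have h1 : ∑ v ∈ V, ∏ s, q (enc v s) ≤ Fintype.card C := by
    calc ∑ v ∈ V, ∏ s, q (enc v s)
        = ∑ z ∈ V.image (fun v => (edge v, enc v)), ∏ s, q (z.2 s) := by
          rw [Finset.sum_image]
          intro v hv v' hv' h
          simp only [Prod.mk.injEq] at h
          exact hinj v hv v' hv' h.2 h.1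
      _ ≤ ∑ z ∈ (Finset.univ : Finset C) ×ˢ
            Fintype.piFinset (fun s => Finset.univ.filter fun w => f w = p s),
            ∏ s, q (z.2 s) := by
          refine Finset.sum_le_sum_of_subset_of_nonneg ?_ fun z _ _ =>
            Finset.prod_nonneg fun s _ => hq _
          intro z hz
          obtain ⟨v, hv, rfl⟩ := Finset.mem_image.1 hz
          simp only [Finset.mem_product, Finset.mem_univ, true_and, Fintype.mem_piFinset,
            Finset.mem_filter]
          exact hp v hv
      _ = ∑ _c : C, ∏ s, ∑ w with f w = p s, q w := by
          rw [Finset.sum_product]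
          refine Finset.sum_congr rfl fun c _ => ?_
          rw [Finset.prod_univ_sum]
      _ ≤ ∑ _c : C, (1 : ℝ) := by
          refine Finset.sum_le_sum fun c _ => ?_
          exact Finset.prod_le_one (fun s _ => Finset.sum_nonneg fun w _ => hq w)
            fun s _ => hsum _
      _ = _ := by simp
  have h2 : (V.card : ℝ) * Real.exp (-a) ≤ Fintype.card C := by
    refine le_trans ?_ h1
    rw [← nsmul_eq_mul]
    exact Finset.card_nsmul_le_sum _ _ _ ha
  rw [Real.exp_neg, ← div_eq_mul_inv, div_le_iff₀ (Real.exp_pos _)] at h2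
  exact h2

lemma exists_residue_sum_le {m n : ℕ} (hm : 0 < m) (a : ℕ → ℝ) (ha : ∀ i, 0 ≤ a i) (c : ℝ)
    (hsum : ∑ i ∈ Finset.range n, a i ≤ m * c) :
    ∃ j < m, ∑ s ∈ Finset.range ((n - j) / m), a (j + s * m) ≤ c := by
  have h1 : ∑ j ∈ Finset.range m, ∑ s ∈ Finset.range ((n - j) / m), a (j + s * m) ≤
      ∑ i ∈ Finset.range n, a i := by
    rw [Finset.sum_sigma', ← Finset.sum_image (f := a) (g := fun z : (_ : ℕ) × ℕ => z.1 + z.2 * m)]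
    · refine Finset.sum_le_sum_of_subset_of_nonneg ?_ fun i _ _ => ha i
      intro i hi
      obtain ⟨⟨j, s⟩, hjs, rfl⟩ := Finset.mem_image.1 hi
      simp only [Finset.mem_sigma, Finset.mem_range] at hjs ⊢
      have h2 : (s + 1) * m ≤ n - j := (Nat.le_div_iff_mul_le hm).1 hjs.2
      have : (s + 1) * m = s * m + m := by ring
      omega
    · rintro ⟨j, s⟩ hjs ⟨j', s'⟩ hjs' h
      simp only [Finset.coe_sigma, Set.mem_sigma_iff, Finset.coe_range, Set.mem_Iio] at hjs hjs' h
      have h3 : j = j' := by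
        have := congrArg (· % m) h
        simpa [Nat.add_mul_mod_self_right, Nat.mod_eq_of_lt hjs.1, Nat.mod_eq_of_lt hjs'.1] using this
      subst h3
      have : s = s' := by
        have : s * m = s' * m := by omega
        exact Nat.eq_of_mul_eq_mul_right hm this
      rw [this]
  have h2 : ∑ j ∈ Finset.range m, ∑ s ∈ Finset.range ((n - j) / m), a (j + s * m) ≤
      ∑ _j ∈ Finset.range m, c := by simpa using h1.trans hsum
  obtain ⟨j, hj, hle⟩ := Finset.exists_le_of_sum_le (by simpa using hm.ne') h2
  exact ⟨j, Finset.mem_range.1 hj, hle⟩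

end Counting

section AEP

variable {X : Type*} [MeasurableSpace X] {μ : Measure X} {ρ : Type*} [Fintype ρ]

lemma infoEntropy_sub_eq_sum [IsProbabilityMeasure μ] {W κ : Type*} [Fintype W] [Fintype κ]
    {P : X → W} (hP : MeasObs P) (f : W → κ) :
    infoEntropy μ P - infoEntropy μ (fun x => f (P x)) =
      ∑ w, μ.real (P ⁻¹' {w}) * (Real.log (μ.real ((fun x => f (P x)) ⁻¹' {f w})) -
        Real.log (μ.real (P ⁻¹' {w}))) := by
  classical
  simp only [mul_sub, Finset.sum_sub_distrib, infoEntropy, Real.negMulLog]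
  have : ∑ w, μ.real (P ⁻¹' {w}) * Real.log (μ.real ((fun x => f (P x)) ⁻¹' {f w})) =
      ∑ p, μ.real ((fun x => f (P x)) ⁻¹' {p}) * Real.log (μ.real ((fun x => f (P x)) ⁻¹' {p})) := by
    rw [← Finset.sum_fiberwise_of_maps_to (t := Finset.univ) (g := f) (by simp)]
    refine Finset.sum_congr rfl fun p _ => ?_
    have h1 := hP.sum_measureReal (μ := μ) {w | f w = p}
    have h2 : P ⁻¹' {w | f w = p} = (fun x => f (P x)) ⁻¹' {p} := rfl
    rw [h2] at h1
    rw [← h1, Finset.sum_mul, h1]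
    refine Finset.sum_congr rfl fun w hw => ?_
    have : f w = p := by simpa using hw
    rw [this]
  rw [this]
  simp only [Measure.real, neg_mul, Finset.sum_neg_distrib]
  ring

/-- Conditional asymptotic equipartition: most itineraries lie in a set whose fibres over the
itineraries of a factor observable grow at most at the conditional entropy rate. -/
lemma eventually_exists_typical [IsProbabilityMeasure μ] {T : X → X} (hT : Ergodic T μ)
    {κ : Type*} [Fintype κ] {R : X → ρ} (hR : MeasObs R) (f : ρ → κ) {m : ℕ} (hm : 0 < m) {c : ℝ}
    (hc : infoEntropy μ (itinerary T R m) - infoEntropy μ (itinerary T (fun x => f (R x)) m) <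
      m * c) {ε : ℝ} (hε : 0 < ε) :
    ∀ᶠ n : ℕ in atTop, ∃ G : Set (Fin n → ρ), μ.real {x | itinerary T R n x ∉ G} ≤ ε ∧
      ∀ p : Fin n → κ, ({v ∈ G | ∀ i, f (v i) = p i}.ncard : ℝ) ≤ Real.exp (c * n) := by
  classical
  have hTm := hT.toMeasurePreserving.measurable
  have hm' : (0 : ℝ) < m := by exact_mod_cast hm
  set N := itinerary T R m with hN
  have hNo : MeasObs N := hR.itinerary hTm m
  set F : (Fin m → ρ) → (Fin m → κ) := fun w i => f (w i) with hF
  set A : (Fin m → κ) → ℝ := fun p => μ.real ((fun x => F (N x)) ⁻¹' {p}) with hA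
  set B : (Fin m → ρ) → ℝ := fun w => μ.real (N ⁻¹' {w}) with hB
  set J : (Fin m → ρ) → ℝ := fun w =>
    if B w = 0 then 0 else Real.log (A (F w)) - Real.log (B w) with hJ
  have hB0 : ∀ w, 0 ≤ B w := fun w => measureReal_nonneg
  have hA0 : ∀ w, 0 ≤ A w := fun w => measureReal_nonneg
  have hBA : ∀ w, B w ≤ A (F w) := fun w => measureReal_mono (by
    rintro x hx; rw [Set.mem_preimage, Set.mem_singleton_iff] at hx ⊢; rw [hx])
  have hJ0 : ∀ w, 0 ≤ J w := by
    intro w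
    simp only [hJ]
    split_ifs with h
    · exact le_rfl
    · exact sub_nonneg.2 (Real.log_le_log ((hB0 w).lt_of_ne' h) (hBA w))
  set I : ℝ := ∫ x, J (N x) ∂μ with hI
  have hIc : I < m * c := by
    refine lt_of_eq_of_lt ?_ hc
    rw [hI, hNo.integral_comp]
    refine Eq.trans ?_ (infoEntropy_sub_eq_sum hNo F).symm
    refine Finset.sum_congr rfl fun w _ => ?_
    by_cases h : B w = 0
    · have h' : μ.real (N ⁻¹' {w}) = 0 := h
      simp [h']
    · simp only [hJ, if_neg h]
      rfl
  obtain ⟨b, hb1, hb2⟩ := exists_between hIc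
  set q : (Fin m → ρ) → ℝ := fun w => B w / A (F w) with hq
  have hqsum : ∀ p, ∑ w with F w = p, q w ≤ 1 := by
    intro p
    have h1 := hNo.sum_measureReal (μ := μ) {w | F w = p}
    have h2 : μ.real (N ⁻¹' {w | F w = p}) = A p := rfl
    have h3 : ∑ w with F w = p, q w = (∑ w with w ∈ {w | F w = p}, B w) / A p := by
      rw [Finset.sum_div]
      refine Finset.sum_congr rfl fun w hw => ?_
      have : F w = p := by simpa using hw
      simp only [hq, this]
    rw [h3, h1, h2]
    exact div_self_le_one _
  have hqJ : ∀ w, B w ≠ 0 → q w = Real.exp (-J w) := by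
    intro w hw
    have h1 : 0 < B w := (hB0 w).lt_of_ne' hw
    have h2 : 0 < A (F w) := h1.trans_le (hBA w)
    simp only [hJ, hw, if_false, hq]
    rw [neg_sub, Real.exp_sub, Real.exp_log h1, Real.exp_log h2]
  have hpos : ∀ᵐ x ∂μ, ∀ i : ℕ, B (N (T^[i] x)) ≠ 0 := by
    rw [ae_all_iff]
    intro i
    have h1 : ∀ᵐ x ∂μ, B (N x) ≠ 0 := by
      have h2 : ∀ᵐ x ∂μ, ∀ w, B w = 0 → N x ≠ w := by
        rw [ae_all_iff]
        intro w
        by_cases hw : B w = 0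
        · have : μ (N ⁻¹' {w}) = 0 := (measureReal_eq_zero_iff).1 hw
          filter_upwards [measure_eq_zero_iff_ae_notMem.1 this] with x hx _ h
          exact hx h
        · simp [hw]
      filter_upwards [h2] with x hx h
      exact hx _ h rfl
    exact (hT.toMeasurePreserving.iterate i).quasiMeasurePreserving.ae h1
  have hmean := hT.eventually_measureReal_birkhoffSum_le (hNo.memLp J 2)
    (ε := min ε (b - I)) (lt_min hε (by linarith))
  have hbig : ∀ᶠ n : ℕ in atTop, (m : ℝ) * Fintype.card ((Fin m → ρ) × (Fin m → ρ)) * (n + 1) <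
      Real.exp ((c - b / m) * n) := by
    apply eventually_mul_lt_exp
    have : b / m < c := by rw [div_lt_iff₀ hm']; linarith
    linarith
  filter_upwards [hmean, hbig, eventually_ge_atTop m] with n hn hn2 hnm
  set good : Set X := {x | ∑ i ∈ Finset.range n, J (N (T^[i] x)) ≤ n * b ∧
    ∀ i : ℕ, B (N (T^[i] x)) ≠ 0} with hgood
  refine ⟨itinerary T R n '' good, ?_, fun p => ?_⟩
  · refine le_trans ?_ (hn.trans (min_le_left _ _))
    refine ENNReal.toReal_mono (measure_ne_top _ _) (measure_mono_ae ?_)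
    filter_upwards [hpos] with x hx hxG
    have hxG' : x ∉ good := fun h => hxG ⟨x, h, rfl⟩
    simp only [hgood, Set.mem_ofPred_eq, not_and'] at hxG'
    have := hxG' hx
    push Not at this
    show min ε (b - I) * n < |_ - _|
    refine lt_of_lt_of_le ?_ (le_abs_self _)
    have h3 : min ε (b - I) * n ≤ (b - I) * n := by gcongr; exact min_le_right _ _
    linarith
  · set V := {v ∈ itinerary T R n '' good | ∀ i, f (v i) = p i} with hV
    have hex : ∀ v : Fin n → ρ, ∃ x, v ∈ V → x ∈ good ∧ itinerary T R n x = v := by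
      intro v
      by_cases hv : v ∈ V
      · obtain ⟨x, hx⟩ := hv.1; exact ⟨x, fun _ => hx⟩
      · have : Nonempty X := by
          by_contra h
          have := not_nonempty_iff.1 h
          exact absurd (measure_univ (μ := μ)) (by simp [Set.eq_empty_of_isEmpty])
        exact ⟨Classical.arbitrary X, fun h => absurd h hv⟩
    choose xx hxx using hex
    have hlet : ∀ v (i : Fin n), v ∈ V → R (T^[(i : ℕ)] (xx v)) = v i := fun v i hv =>
      congrFun (hxx v hv).2 i
    have hres : ∀ v, ∃ j < m, v ∈ V →
        ∑ s ∈ Finset.range ((n - j) / m), J (N (T^[j + s * m] (xx v))) ≤ n * (b / m) := by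
      intro v
      by_cases hv : v ∈ V
      · obtain ⟨j, hj, h⟩ := exists_residue_sum_le hm (fun i => J (N (T^[i] (xx v))))
          (fun i => hJ0 _) (n * (b / m)) (n := n) ((hxx v hv).1.1.trans_eq (by field_simp))
        exact ⟨j, hj, fun _ => h⟩
      · exact ⟨0, hm, fun h => absurd h hv⟩
    choose res hres1 hres2 using hres
    have hcount : ∀ j < m, ((Finset.univ.filter fun v => v ∈ V ∧ res v = j).card : ℝ) ≤
        Fintype.card ((Fin m → ρ) × (Fin m → ρ)) * Real.exp (n * (b / m)) := by
      intro j hj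
      have hdiv : (n - j) / m * m ≤ n - j := Nat.div_mul_le_self _ _
      have hdiv2 : n - j < (n - j) / m * m + m := by
        have := Nat.lt_div_mul_add (a := n - j) hm; omega
      have hidx : ∀ (s : Fin ((n - j) / m)) (r : Fin m), j + s * m + r < n := by
        intro s r
        have h1 : ((s : ℕ) + 1) * m ≤ (n - j) / m * m := by gcongr; omega
        have h2 : ((s : ℕ) + 1) * m = s * m + m := by ring
        omega
      refine card_le_of_weights ((n - j) / m) q
        (fun w => div_nonneg (hB0 _) (hA0 _)) F hqsum _
        (fun v s => N (T^[j + s * m] (xx v)))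
        (fun v => ((fun r : Fin m => v ⟨r, by omega⟩), (fun r : Fin m => v ⟨n - m + r, by omega⟩)))
        ?_ (fun s r => p ⟨j + s * m + r, hidx s r⟩) ?_ _ ?_
      · intro v hv v' hv' henc hedge
        simp only [Finset.mem_filter, Finset.mem_univ, true_and] at hv hv'
        simp only [Prod.mk.injEq] at hedge
        funext ⟨i, hi⟩
        by_cases hij : i < j
        · exact congrFun hedge.1 ⟨i, by omega⟩
        · by_cases hi2 : n - m ≤ i
          · have := congrFun hedge.2 ⟨i - (n - m), by omega⟩
            simpa [show n - m + (i - (n - m)) = i by omega] using this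
          · have hs : (i - j) / m < (n - j) / m := by
              rw [Nat.lt_iff_add_one_le, Nat.le_div_iff_mul_le hm]
              have h3 : (i - j) / m * m ≤ i - j := Nat.div_mul_le_self _ _
              have : ((i - j) / m + 1) * m = (i - j) / m * m + m := by ring
              omega
            have h4 := congrFun (congrFun henc ⟨(i - j) / m, hs⟩) ⟨(i - j) % m, Nat.mod_lt _ hm⟩
            simp only [hN, itinerary, ← Function.iterate_add_apply] at h4
            have h5 : (i - j) % m + (j + (i - j) / m * m) = i := by
              have := Nat.mod_add_div' (i - j) m
              omega
            rw [h5] at h4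
            rwa [hlet v ⟨i, hi⟩ hv.1, hlet v' ⟨i, hi⟩ hv'.1] at h4
      · intro v hv s
        simp only [Finset.mem_filter, Finset.mem_univ, true_and] at hv
        funext r
        simp only [hF, hN, itinerary, ← Function.iterate_add_apply]
        rw [add_comm, hlet v ⟨_, hidx s r⟩ hv.1]
        exact hv.1.2 _
      · intro v hv
        simp only [Finset.mem_filter, Finset.mem_univ, true_and] at hv
        rw [Finset.prod_congr rfl fun s _ => hqJ _ ((hxx v hv.1).1.2 _), ← Real.exp_sum,
          Real.exp_le_exp, Finset.sum_neg_distrib, neg_le_neg_iff]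
        have := hres2 v hv.1
        rw [hv.2] at this
        rwa [Finset.sum_range] at this
    have hVcard : (V.ncard : ℝ) ≤ ∑ j ∈ Finset.range m,
        ((Finset.univ.filter fun v => v ∈ V ∧ res v = j).card : ℝ) := by
      rw [Set.ncard_eq_toFinset_card' V,
        Finset.card_eq_sum_card_fiberwise (t := Finset.range m) (f := res)
          (fun v _ => by simpa using hres1 v)]
      push_cast
      refine le_of_eq (Finset.sum_congr rfl fun j _ => ?_)
      congr 2
      ext v; simp
    calc (V.ncard : ℝ) ≤ _ := hVcard
      _ ≤ ∑ j ∈ Finset.range m, (Fintype.card ((Fin m → ρ) × (Fin m → ρ)) *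
            Real.exp (n * (b / m)) : ℝ) :=
          Finset.sum_le_sum fun j hj => hcount j (Finset.mem_range.1 hj)
      _ = (m * Fintype.card ((Fin m → ρ) × (Fin m → ρ))) * Real.exp (n * (b / m)) := by
          simp; ring
      _ ≤ (m : ℝ) * Fintype.card ((Fin m → ρ) × (Fin m → ρ)) * (n + 1) *
            Real.exp (n * (b / m)) := by
          refine mul_le_mul_of_nonneg_right ?_ (Real.exp_nonneg _)
          exact le_mul_of_one_le_right (by positivity) (by linarith [(Nat.cast_nonneg n : (0 : ℝ) ≤ n)])
      _ ≤ Real.exp ((c - b / m) * n) * Real.exp (n * (b / m)) := by gcongr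
      _ = Real.exp (c * n) := by rw [← Real.exp_add]; ring_nf

end AEP

section Action

variable {X : Type*} [MeasurableSpace X] {μ : Measure X} {T : X ≃ᵐ X}

/-- The action of `ℤ` generated by `T`. -/
def act (T : X ≃ᵐ X) (i : ℤ) (x : X) : X := ((T.toEquiv : Equiv.Perm X) ^ i) x

@[simp] lemma act_zero (x : X) : act T 0 x = x := by simp [act]

lemma act_add (i j : ℤ) (x : X) : act T (i + j) x = act T i (act T j x) := by
  simp [act, zpow_add]

lemma act_natCast (n : ℕ) (x : X) : act T n x = T^[n] x := by
  simp only [act, zpow_natCast, Equiv.Perm.coe_pow]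
  rfl

lemma act_one (x : X) : act T 1 x = T x := by simp [act]

lemma act_act_neg (i : ℤ) (x : X) : act T i (act T (-i) x) = x := by simp [← act_add]

lemma measurePreserving_act (hT : MeasurePreserving T μ μ) (i : ℤ) :
    MeasurePreserving (act T i) μ μ := by
  have hnat : ∀ n : ℕ, MeasurePreserving (act T n) μ μ := fun n => by
    simpa only [funext (act_natCast (T := T) n)] using hT.iterate n
  have hsymm : ∀ n : ℕ, act T (-(n : ℤ)) = T.symm^[n] := by
    intro n
    funext x
    simp only [act, zpow_neg, zpow_natCast, ← inv_pow, Equiv.Perm.coe_pow]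
    rfl
  obtain ⟨n, rfl | rfl⟩ := i.eq_nat_or_neg
  · exact hnat n
  · rw [hsymm]
    exact (MeasurePreserving.symm T hT).iterate n

lemma measureReal_preimage_act (hT : MeasurePreserving T μ μ) (i : ℤ) {s : Set X}
    (hs : MeasurableSet s) : μ.real (act T i ⁻¹' s) = μ.real s := by
  rw [Measure.real, (measurePreserving_act hT i).measure_preimage hs.nullMeasurableSet]; rfl

/-- The union of the images of `s` under `act T a`, `a ∈ I`. -/
def sweep (T : X ≃ᵐ X) (s : Set X) (I : Finset ℕ) : Set X := {x | ∃ a ∈ I, act T (-(a : ℤ)) x ∈ s}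

lemma sweep_eq (s : Set X) (I : Finset ℕ) :
    sweep T s I = ⋃ a ∈ I, act T (-(a : ℤ)) ⁻¹' s := by
  ext x; simp [sweep]

lemma measurableSet_sweep (hT : MeasurePreserving T μ μ) {s : Set X} (hs : MeasurableSet s)
    (I : Finset ℕ) : MeasurableSet (sweep T s I) := by
  rw [sweep_eq]
  exact I.measurableSet_biUnion fun a _ => (measurePreserving_act hT _).measurable hs

lemma eq_of_separated {s : Set X} {H : ℕ} (hsep : ∀ x ∈ s, ∀ i : ℕ, 0 < i → i < H → act T i x ∉ s)
    {x : X} {a b : ℕ} (ha : a < H) (hb : b < H) (hxa : act T (-(a : ℤ)) x ∈ s)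
    (hxb : act T (-(b : ℤ)) x ∈ s) : a = b := by
  wlog hab : a < b generalizing a b
  · rcases lt_trichotomy a b with h | h | h
    · exact absurd h hab
    · exact h
    · exact (this hb ha hxb hxa h).symm
  refine absurd hxa ?_
  have := hsep _ hxb (b - a) (by omega) (by omega)
  rwa [← act_add, show ((b - a : ℕ) : ℤ) + -(b : ℤ) = -(a : ℤ) by omega] at this

lemma measureReal_sweep (hT : MeasurePreserving T μ μ) [IsFiniteMeasure μ] {s : Set X}
    (hs : MeasurableSet s) {H : ℕ} (hsep : ∀ x ∈ s, ∀ i : ℕ, 0 < i → i < H → act T i x ∉ s)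
    {I : Finset ℕ} (hI : ∀ a ∈ I, a < H) : μ.real (sweep T s I) = I.card * μ.real s := by
  rw [sweep_eq, measureReal_biUnion_finset]
  · rw [Finset.sum_congr rfl fun a _ => measureReal_preimage_act hT _ hs]
    simp
  · intro a ha b hb hab
    rw [Function.onFun, Set.disjoint_left]
    intro x hxa hxb
    exact hab (eq_of_separated hsep (hI a ha) (hI b hb) hxa hxb)
  · intro a _
    exact (measurePreserving_act hT _).measurable hs

lemma exists_small_measure [StandardBorelSpace X] [IsProbabilityMeasure μ] [NullSingletonClass μ]
    {ε : ℝ≥0∞} (hε : 0 < ε) : ∃ E, MeasurableSet E ∧ 0 < μ E ∧ μ E < ε := by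
  have hemb := measurableEmbedding_embeddingReal X
  set φ := embeddingReal X
  set ν := μ.map φ with hν
  have hν0 : ν Set.univ ≠ 0 := by
    rw [hν, Measure.map_apply hemb.measurable MeasurableSet.univ]; simp
  obtain ⟨r, -, hr⟩ := exists_mem_forall_mem_nhdsWithin_pos_measure (μ := ν) hν0
  rw [nhdsWithin_univ] at hr
  have hr0 : ν {r} = 0 := by
    rw [hν, Measure.map_apply hemb.measurable (measurableSet_singleton r)]
    exact (Set.subsingleton_singleton.preimage hemb.injective).measure_zero μ
  have : IsFiniteMeasure ν := by
    constructor
    rw [hν, Measure.map_apply hemb.measurable MeasurableSet.univ]; simp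
  obtain ⟨U, hU, hUo, hUε⟩ := Set.exists_isOpen_lt_of_lt {r} ε (hr0.trans_lt hε)
  refine ⟨φ ⁻¹' U, hemb.measurable hUo.measurableSet, ?_, ?_⟩
  · rw [← Measure.map_apply hemb.measurable hUo.measurableSet]
    exact hr U (hUo.mem_nhds (hU rfl))
  · rwa [← Measure.map_apply hemb.measurable hUo.measurableSet]

end Action

section Tower

variable {X : Type*} [MeasurableSpace X] {μ : Measure X} {T : X ≃ᵐ X}

lemma exists_separated [StandardBorelSpace X] [IsProbabilityMeasure μ] [NullSingletonClass μ]
    (hT : Ergodic T μ) (H : ℕ) {ε : ℝ} (hε : 0 < ε) :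
    ∃ E, MeasurableSet E ∧ 0 < μ E ∧ μ.real E ≤ ε ∧ ∀ x ∈ E, ∀ i : ℕ, 0 < i → i < H → act T i x ∉ E := by
  have hmp := hT.toMeasurePreserving
  obtain ⟨E, hEm, hE0, hE⟩ := exists_small_measure (μ := μ)
    (ε := ENNReal.ofReal (min ε (1 / (H + 1)))) (by simp; exact ⟨hε, by positivity⟩)
  have hEr : μ.real E < min ε (1 / (H + 1)) := by
    rw [Measure.real]
    exact (ENNReal.lt_ofReal_iff_toReal_lt (measure_ne_top _ _)).1 hE
  set R : Set X := {x | ∃ i : ℕ, 0 < i ∧ i < H ∧ act T i x ∈ E} with hR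
  have hRm : MeasurableSet R := by
    have : R = ⋃ i : ℕ, ⋃ _ : 0 < i, ⋃ _ : i < H, act T i ⁻¹' E := by
      ext x
      simp only [hR, Set.mem_ofPred_eq, Set.mem_iUnion, Set.mem_preimage, exists_prop]
    rw [this]
    exact MeasurableSet.iUnion fun i => MeasurableSet.iUnion fun _ => MeasurableSet.iUnion fun _ =>
      (measurePreserving_act hmp i).measurable hEm
  refine ⟨E \ R, hEm.diff hRm, ?_, ?_, ?_⟩
  · rw [pos_iff_ne_zero]
    intro h0
    set U : Set X := ⋃ i ∈ Finset.range (H + 1), act T (i : ℕ) ⁻¹' E with hU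
    have hUm : MeasurableSet U := Finset.measurableSet_biUnion _ fun i _ =>
      (measurePreserving_act hmp i).measurable hEm
    have hU1 : U ≤ᵐ[μ] T ⁻¹' U := by
      filter_upwards [measure_eq_zero_iff_ae_notMem.1 h0] with x hx hxU
      have hxU' : x ∈ U := hxU
      show T x ∈ U
      simp only [hU, Set.mem_iUnion, Finset.mem_range, Set.mem_preimage] at hxU' ⊢
      have hstep : ∀ i : ℕ, 0 < i → i < H + 1 → act T i x ∈ E →
          ∃ i, ∃ (_ : i < H + 1), act T (i : ℕ) (T x) ∈ E := by
        intro i hi0 hi hiE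
        refine ⟨i - 1, by omega, ?_⟩
        rw [← act_one (T := T), ← act_add]
        convert hiE using 2
        omega
      obtain ⟨i, hi, hiE⟩ := hxU'
      rcases Nat.eq_zero_or_pos i with rfl | hi0
      · have hxR : x ∈ R := by
          by_contra hxR
          exact hx ⟨by simpa using hiE, hxR⟩
        obtain ⟨i, hi0, hi, hiE⟩ := hxR
        exact hstep i hi0 (by omega) hiE
      · exact hstep i hi0 hi hiE
    have hUle : μ.real U ≤ (H + 1) * μ.real E := by
      refine (measureReal_biUnion_finset_le _ _).trans ?_
      rw [Finset.sum_congr rfl fun a _ => measureReal_preimage_act hmp _ hEm]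
      simp
    have hUlt : μ.real U < 1 := by
      refine hUle.trans_lt ?_
      have : μ.real E < 1 / (H + 1) := hEr.trans_le (min_le_right _ _)
      rwa [lt_div_iff₀ (by positivity), mul_comm] at this
    have hEU : E ⊆ U := by
      intro x hx
      simp only [hU, Set.mem_iUnion, Finset.mem_range, Set.mem_preimage]
      exact ⟨0, by omega, by simpa using hx⟩
    rcases hT.ae_empty_or_univ_of_ae_le_preimage hUm.nullMeasurableSet hU1 with h | h
    · have : μ U = 0 := by rw [measure_congr h, measure_empty]
      exact hE0.ne' (measure_mono_null hEU this)
    · have : μ.real U = 1 := by rw [measureReal_congr h]; simp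
      linarith
  · exact (measureReal_mono Set.sdiff_subset).trans (hEr.le.trans (min_le_left _ _))
  · rintro x ⟨hx, hxR⟩ i hi0 hi ⟨h1, -⟩
    exact hxR ⟨i, hi0, hi, h1⟩

lemma ae_exists_act_neg_mem [IsProbabilityMeasure μ] (hT : Ergodic T μ) {E : Set X}
    (hEm : MeasurableSet E) (hE : μ E ≠ 0) : ∀ᵐ x ∂μ, ∃ i : ℕ, act T (-(i : ℤ)) x ∈ E := by
  have hmp := hT.toMeasurePreserving
  set U : Set X := {x | ∃ i : ℕ, act T (-(i : ℤ)) x ∈ E} with hU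
  have hUeq : U = ⋃ i : ℕ, act T (-(i : ℤ)) ⁻¹' E := by ext x; simp [hU]
  have hUm : MeasurableSet U := by
    rw [hUeq]
    exact MeasurableSet.iUnion fun i => (measurePreserving_act hmp _).measurable hEm
  have hU1 : U ≤ᵐ[μ] T ⁻¹' U := by
    refine Eventually.of_forall fun x hx => ?_
    obtain ⟨i, hi⟩ := hx
    refine ⟨i + 1, ?_⟩
    rw [← act_one (T := T), ← act_add]
    convert hi using 2
    push_cast; ring
  rcases hT.ae_empty_or_univ_of_ae_le_preimage hUm.nullMeasurableSet hU1 with h | h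
  · refine absurd (measure_mono_null (fun x hx => ?_) (by rw [measure_congr h, measure_empty])) hE
    exact ⟨0, by simpa using hx⟩
  · exact eventuallyEq_univ.1 h

/-- A Rokhlin tower with return times at most `2 * H`, covering most of the space. -/
lemma exists_tower_base [StandardBorelSpace X] [IsProbabilityMeasure μ] [NullSingletonClass μ]
    (hT : Ergodic T μ) {H : ℕ} (hH : 0 < H) {ε : ℝ} (hε : 0 < ε) :
    ∃ F, MeasurableSet F ∧ (∀ x ∈ F, ∀ i : ℕ, 0 < i → i < H → act T i x ∉ F) ∧
      (∀ᵐ x ∂μ, ∃ i < 2 * H, act T (i : ℕ) x ∈ F) ∧ 1 - ε ≤ H * μ.real F := by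
  have hmp := hT.toMeasurePreserving
  have hH' : (0 : ℝ) < H := by exact_mod_cast hH
  obtain ⟨E, hEm, hE0, hEε, hEs⟩ := exists_separated hT H (div_pos hε hH')
  set F : Set X := {x | (∃ j : ℕ, act T (-((j * H : ℕ) : ℤ)) x ∈ E ∧
      ∀ i : ℕ, i < j * H → act T (-(i : ℤ)) x ∉ E) ∧
      ∀ i : ℕ, 0 < i → i < H → act T i x ∉ E} with hF
  have hFm : MeasurableSet F := by
    have : F = (⋃ j : ℕ, (act T (-((j * H : ℕ) : ℤ)) ⁻¹' E ∩
        ⋂ i : ℕ, ⋂ _ : i < j * H, (act T (-(i : ℤ)) ⁻¹' E)ᶜ)) ∩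
        ⋂ i : ℕ, ⋂ _ : 0 < i, ⋂ _ : i < H, (act T i ⁻¹' E)ᶜ := by
      ext x; simp [hF]
    rw [this]
    have hact : ∀ i : ℤ, MeasurableSet (act T i ⁻¹' E) := fun i =>
      (measurePreserving_act hmp i).measurable hEm
    exact (MeasurableSet.iUnion fun j => (hact _).inter
      (MeasurableSet.iInter fun i => MeasurableSet.iInter fun _ => (hact _).compl)).inter
      (MeasurableSet.iInter fun i => MeasurableSet.iInter fun _ => MeasurableSet.iInter fun _ =>
        (hact _).compl)
  have hFsep : ∀ x ∈ F, ∀ i : ℕ, 0 < i → i < H → act T i x ∉ F := by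
    rintro x ⟨⟨j, hj, hj'⟩, hx⟩ i hi0 hi ⟨⟨j₁, hj₁, hj₁'⟩, -⟩
    rw [← act_add] at hj₁
    have h1 : j₁ * H = i + j * H := by
      rcases lt_trichotomy (j₁ * H) (i + j * H) with h | h | h
      · exfalso
        rcases le_or_gt i (j₁ * H) with h2 | h2
        · refine hj' (j₁ * H - i) (by omega) ?_
          convert hj₁ using 2
          push_cast [h2]; ring
        · refine hx (i - j₁ * H) (by omega) (by omega) ?_
          convert hj₁ using 2
          push_cast [h2.le]; ring
      · exact h
      · exfalso
        refine hj₁' (i + j * H) h ?_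
        rw [← act_add]
        convert hj using 2
        push_cast; ring
    have h2 : i = (j₁ - j) * H := by rw [Nat.sub_mul]; omega
    rcases Nat.eq_zero_or_pos (j₁ - j) with h3 | h3
    · rw [h3] at h2; omega
    · have : 1 * H ≤ (j₁ - j) * H := Nat.mul_le_mul_right _ h3
      omega
  have hlast : ∀ᵐ x ∂μ, ∃ t : ℕ, act T (-(t : ℤ)) x ∈ E ∧ ∀ i < t, act T (-(i : ℤ)) x ∉ E := by
    classical
    filter_upwards [ae_exists_act_neg_mem hT hEm hE0.ne'] with x hx
    exact ⟨Nat.find hx, Nat.find_spec hx, fun i hi => Nat.find_min hx hi⟩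
  refine ⟨F, hFm, hFsep, ?_, ?_⟩
  · filter_upwards [hlast] with x hx
    obtain ⟨t, ht, ht'⟩ := hx
    by_cases hv : ∃ v : ℕ, 0 < v ∧ v < 2 * H ∧ act T v x ∈ E
    · obtain ⟨v, hv0, hv, hvE⟩ := hv
      refine ⟨v, hv, ⟨0, by simpa using hvE, by simp⟩, fun i hi0 hi => hEs _ hvE i hi0 hi⟩
    · push Not at hv
      set j := (t + (H - 1)) / H with hj
      have h1 : t ≤ j * H ∧ j * H < t + H := by
        have h2 := Nat.div_mul_le_self (t + (H - 1)) H
        have h3 := Nat.lt_div_mul_add (a := t + (H - 1)) hH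
        rw [← hj] at h2 h3
        omega
      refine ⟨j * H - t, by omega, ⟨j, ?_, ?_⟩, ?_⟩
      · rw [← act_add]
        convert ht using 2
        push_cast [h1.1]; ring
      · intro i hi
        rw [← act_add]
        rcases lt_or_ge i (j * H - t) with h | h
        · have := hv (j * H - t - i) (by omega) (by omega)
          convert this using 3
          push_cast [h1.1, h.le]; ring
        · have := ht' (i - (j * H - t)) (by omega)
          convert this using 3
          push_cast [h1.1, h]; ring
      · intro i hi0 hi
        rw [← act_add]
        have := hv (i + (j * H - t)) (by omega) (by omega)
        convert this using 3
        exact (Nat.cast_add _ _).symm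
  · set V : Set X := ⋃ i ∈ Finset.range H, act T (i : ℕ) ⁻¹' E with hV
    have hVle : μ.real V ≤ ε := by
      refine (measureReal_biUnion_finset_le _ _).trans ?_
      rw [Finset.sum_congr rfl fun a _ => measureReal_preimage_act hmp _ hEm]
      simp only [Finset.sum_const, Finset.card_range, nsmul_eq_mul]
      rw [le_div_iff₀ hH'] at hEε
      linarith
    have hcov : ∀ᵐ x ∂μ, x ∈ sweep T F (Finset.range H) ∪ V := by
      filter_upwards [hlast] with x hx
      obtain ⟨t, ht, ht'⟩ := hx
      by_cases hv : ∃ v : ℕ, v < H ∧ act T v x ∈ E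
      · obtain ⟨v, hv, hvE⟩ := hv
        right
        simp only [hV, Set.mem_iUnion, Finset.mem_range]
        exact ⟨v, hv, hvE⟩
      · left
        push Not at hv
        have h1 : t / H * H + t % H = t := Nat.div_add_mod' t H
        have h2 : t % H < H := Nat.mod_lt _ hH
        refine ⟨t % H, by simpa using h2, ⟨t / H, ?_, ?_⟩, ?_⟩
        · rw [← act_add]
          convert ht using 2
          have h3 : ((t / H * H : ℕ) : ℤ) + ((t % H : ℕ) : ℤ) = t := by exact_mod_cast h1
          linarith
        · intro i hi
          rw [← act_add]
          have := ht' (i + t % H) (by omega)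
          convert this using 3
          push_cast; ring
        · intro i hi0 hi
          rw [← act_add]
          rcases le_or_gt (t % H) i with h | h
          · have := hv (i - t % H) (by omega)
            convert this using 3
            omega
          · have := ht' (t % H - i) (by omega)
            convert this using 3
            omega
    have hcov1 : 1 ≤ μ.real (sweep T F (Finset.range H) ∪ V) := by
      have h0 : (sweep T F (Finset.range H) ∪ V : Set X) =ᵐ[μ] Set.univ :=
        eventuallyEq_univ.2 hcov
      rw [measureReal_congr h0]
      simp
    have h1 := measureReal_union_le (μ := μ) (sweep T F (Finset.range H)) V
    rw [measureReal_sweep hmp hFm hFsep (by simp)] at h1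
    simp only [Finset.card_range] at h1
    linarith

/-- The base of a tower can be moved so as to mostly avoid a prescribed set. -/
lemma exists_tower [StandardBorelSpace X] [IsProbabilityMeasure μ] [NullSingletonClass μ]
    (hT : Ergodic T μ) {H : ℕ} (hH : 0 < H) {ε : ℝ} (hε : 0 < ε) {B : Set X}
    (hB : MeasurableSet B) :
    ∃ F, MeasurableSet F ∧ (∀ x ∈ F, ∀ i : ℕ, 0 < i → i < H → act T i x ∉ F) ∧
      (∀ᵐ x ∂μ, ∃ i < 2 * H, act T (i : ℕ) x ∈ F) ∧ 1 - ε - μ.real B ≤ H * μ.real (F \ B) := by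
  have hmp := hT.toMeasurePreserving
  have hH' : (0 : ℝ) < H := by exact_mod_cast hH
  obtain ⟨F, hFm, hFs, hFr, hFε⟩ := exists_tower_base hT hH hε
  have hsum : ∑ i ∈ Finset.range H, μ.real (act T (-(i : ℤ)) ⁻¹' F ∩ B) ≤
      ∑ _i ∈ Finset.range H, μ.real B / H := by
    rw [← measureReal_biUnion_finset]
    · simp only [Finset.sum_const, Finset.card_range, nsmul_eq_mul]
      rw [mul_div_cancel₀ _ hH'.ne']
      refine measureReal_mono ?_
      exact Set.iUnion₂_subset fun i _ => Set.inter_subset_right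
    · intro a ha b hb hab
      rw [Function.onFun, Set.disjoint_left]
      rintro x ⟨hxa, -⟩ ⟨hxb, -⟩
      exact hab (eq_of_separated hFs (by simpa using ha) (by simpa using hb) hxa hxb)
    · intro i _
      exact ((measurePreserving_act hmp _).measurable hFm).inter hB
  obtain ⟨s, -, hs⟩ := Finset.exists_le_of_sum_le (by simpa using hH.ne') hsum
  have hcomm : ∀ (i j : ℤ) (x : X), act T i (act T j x) = act T j (act T i x) := by
    intro i j x; rw [← act_add, add_comm, act_add]
  refine ⟨act T (-(s : ℤ)) ⁻¹' F, (measurePreserving_act hmp _).measurable hFm, ?_, ?_, ?_⟩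
  · intro x hx i hi0 hi h
    rw [Set.mem_preimage, hcomm] at h
    exact hFs _ hx i hi0 hi h
  · filter_upwards [(measurePreserving_act hmp (-(s : ℤ))).quasiMeasurePreserving.ae hFr] with x hx
    obtain ⟨i, hi, h⟩ := hx
    exact ⟨i, hi, by rw [Set.mem_preimage, hcomm]; exact h⟩
  · have h1 := measureReal_sdiff_add_inter (μ := μ) (s := act T (-(s : ℤ)) ⁻¹' F) hB
    rw [measureReal_preimage_act hmp _ hFm] at h1
    rw [le_div_iff₀ hH'] at hs
    nlinarith

end Tower

lemma exists_injOn_fin {α : Type*} [Finite α] {V : Set α} {M : ℕ} (hV : V.ncard ≤ M) (hM : 0 < M) :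
    ∃ ι : α → Fin M, Set.InjOn ι V := by
  classical
  have : Fintype V := Fintype.ofFinite V
  have hcard : Fintype.card V ≤ Fintype.card (Fin M) := by
    rwa [Fintype.card_fin, ← Nat.card_eq_fintype_card]
  obtain ⟨f⟩ := Function.Embedding.nonempty_of_card_le hcard
  refine ⟨fun a => if h : a ∈ V then f ⟨a, h⟩ else ⟨0, hM⟩, fun a ha b hb hab => ?_⟩
  simp only [dif_pos ha, dif_pos hb] at hab
  exact congrArg Subtype.val (f.injective hab)

/-- A choice of labels in `Fin B` that separates the points of `G` lying in one fibre of `F`. -/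
lemma exists_fibre_index {α β : Type*} [Finite α] (F : α → β) {G : Set α} {B : ℕ} (hB : 0 < B)
    (hG : ∀ b, {a ∈ G | F a = b}.ncard ≤ B) :
    ∃ ι : α → Fin B, ∀ a ∈ G, ∀ a' ∈ G, F a = F a' → ι a = ι a' → a = a' := by
  choose ι hι using fun b => exists_injOn_fin (hG b) hB
  refine ⟨fun a => ι (F a) a, fun a ha a' ha' hF h => ?_⟩
  simp only [← hF] at h
  exact hι (F a) ⟨ha, rfl⟩ ⟨ha', hF.symm⟩ h

section

variable {A : Type*} {Y : Set (ℤ → A)} {g : ℕ → ℕ} {h : ℝ}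

/-- Specification applied to a header `c`, a spacer `e` and a sequence of blocks `w j`. -/
lemma SpecSubshift.exists_concat (hY : SpecSubshift Y g h) {k N H : ℕ} (hk : 0 < k) (hN : 0 < N)
    (hNH : N + g N ≤ H) {c e : ℤ → A} (hc : c ∈ Y) (he : e ∈ Y) (J : Finset ℕ) (w : ℕ → ℤ → A)
    (hw : ∀ j ∈ J, w j ∈ Y) (hJ : ∀ j ∈ J, k + g (4 * H) + 4 * H + g N ≤ j)
    (hsep : ∀ i ∈ J, ∀ j ∈ J, i < j → i + H ≤ j) :
    ∃ z ∈ Y, (∀ t : ℕ, t < k → z t = c t) ∧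
      (∀ t : ℕ, t < 4 * H → z ((k + g (4 * H) + t : ℕ) : ℤ) = e t) ∧
      ∀ j ∈ J, ∀ t : ℕ, t < N → z ((j + t : ℕ) : ℤ) = w j t := by
  classical
  set o := k + g (4 * H) with ho
  have hJo : ∀ j ∈ J, j ≠ 0 ∧ j ≠ o := fun j hj => by have := hJ j hj; omega
  let l : ℤ → ℕ := fun i => if i = 0 then k else if i = o then 4 * H else N
  let y : ℤ → ℤ → A := fun i => if i = 0 then c else if i = o then e else w i.toNat
  have hl0 : l 0 = k := by simp [l]
  have ho0 : (o : ℤ) ≠ 0 := by omega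
  have hlo : l (o : ℕ) = 4 * H := by simp only [l, if_neg ho0, if_true]
  have hlj : ∀ j ∈ J, l (j : ℕ) = N := fun j hj => by
    have := hJo j hj
    simp only [l]
    rw [if_neg (by omega), if_neg (by omega)]
  have hy0 : y 0 = c := by simp [y]
  have hyo : y (o : ℕ) = e := by simp only [y, if_neg ho0, if_true]
  have hyj : ∀ j ∈ J, y (j : ℕ) = w j := fun j hj => by
    have := hJo j hj
    simp only [y]
    rw [if_neg (by omega), if_neg (by omega), Int.toNat_natCast]
  have ⟨z, hz, hzs⟩ := hY.spec (((insert 0 (insert o J) : Finset ℕ)).image Nat.cast) l y ?_ ?_ ?_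
  · refine ⟨z, hz, fun t ht => ?_, fun t ht => ?_, fun j hj t ht => ?_⟩
    · simpa [hy0] using hzs 0 (by simp) t (by rwa [hl0])
    · rw [← hyo, ← hzs o (by simp) t (by rwa [hlo])]; push_cast; rfl
    · rw [← hyj j hj, ← hzs j (by simp [hj]) t (by rwa [hlj j hj])]; push_cast; rfl
  · intro i hi
    obtain ⟨j, hj, rfl⟩ := Finset.mem_image.1 hi
    rcases Finset.mem_insert.1 hj with rfl | hj
    · simpa [hl0] using hk
    rcases Finset.mem_insert.1 hj with rfl | hj
    · rw [hlo]; omega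
    · rwa [hlj j hj]
  · intro i hi
    obtain ⟨j, hj, rfl⟩ := Finset.mem_image.1 hi
    rcases Finset.mem_insert.1 hj with rfl | hj
    · simpa [hy0] using hc
    rcases Finset.mem_insert.1 hj with rfl | hj
    · rwa [hyo]
    · rw [hyj j hj]; exact hw j hj
  · intro i hi j hj hij
    obtain ⟨i, hi', rfl⟩ := Finset.mem_image.1 hi
    obtain ⟨j, hj', rfl⟩ := Finset.mem_image.1 hj
    clear hi hj
    have hij' : i < j := by exact_mod_cast hij
    rename' hj' => hj
    rcases Finset.mem_insert.1 hi' with rfl | hi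
    · rw [Nat.cast_zero, hl0]
      rcases Finset.mem_insert.1 hj with rfl | hj
      · omega
      rcases Finset.mem_insert.1 hj with rfl | hj
      · rw [hlo]; omega
      · have := hJ j hj
        rw [hlj j hj]; omega
    rcases Finset.mem_insert.1 hi with rfl | hi
    · rw [hlo]
      rcases Finset.mem_insert.1 hj with rfl | hj
      · omega
      rcases Finset.mem_insert.1 hj with rfl | hj
      · omega
      · have := hJ j hj
        rw [hlj j hj]; omega
    · have := hJ i hi
      rcases Finset.mem_insert.1 hj with rfl | hj
      · omega
      rcases Finset.mem_insert.1 hj with rfl | hj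
      · omega
      · rw [hlj i hi, hlj j hj]
        have := hsep i hi j hj hij'
        omega

end

section

variable {X : Type} [MeasurableSpace X] {μ : Measure X} {T : X ≃ᵐ X} {A : Type}
  {Y : Set (ℤ → A)} {g : ℕ → ℕ} {h : ℝ}

variable (μ T Y g) in
/-- A block code over a tower of height `H`: the word attached to a base point occupies `N`
coordinates, determines the `P`-name of good base points, and cannot be recognised at wrong
places, except possibly in its last `K` coordinates. -/
structure BlockCode {ρ : Type} (P : X → ρ) where
  (N H K m : ℕ)
  (base good : Set X)
  code : X → ℤ → A
  marker : ℕ → A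
  spacer : ℤ → A
  measurableSet_base : MeasurableSet base
  measurableSet_good : MeasurableSet good
  good_subset : good ⊆ base
  separated : ∀ x ∈ base, ∀ i : ℕ, 0 < i → i < H → act T i x ∉ base
  syndetic : ∀ᵐ x ∂μ, ∃ i < 2 * H, act T (i : ℕ) x ∈ base
  N_pos : 0 < N
  m_le : m ≤ N
  N_add_gap_le : N + g N ≤ H
  measObs_code : MeasObs code
  finite_range : (Set.range code).Finite
  code_mem : ∀ x, code x ∈ Y
  code_eq_marker : ∀ x, ∀ i < m, code x (i : ℕ) = marker i
  spacer_mem : spacer ∈ Y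
  spacer_avoids : ∀ j, j + m ≤ 4 * H → ∃ i < m, spacer ((j + i : ℕ) : ℤ) ≠ marker i
  decode : ∀ x ∈ good, ∀ x' ∈ good, (∀ i < N, code x (i : ℕ) = code x' (i : ℕ)) →
    ∀ i < N, P (act T (i : ℕ) x) = P (act T (i : ℕ) x')
  comma : ∀ x x', ∀ j, 0 < j → j + K ≤ N → ∃ i, i + j < N ∧
    code x ((j + i : ℕ) : ℤ) ≠ code x' (i : ℕ)

open Classical in
/-- The observable recording the good base points and the letters of `P` that the block code does
not determine. -/
noncomputable def BlockCode.rest {ρ : Type} {P : X → ρ} (s : BlockCode μ T Y g P) (x : X) :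
    Prop × Option ρ :=
  (x ∈ s.good, if x ∈ sweep T s.good (Finset.range s.N) then none else some (P x))

lemma BlockCode.measObs_rest {ρ : Type} [Finite ρ] {P : X → ρ} (hP : MeasObs P)
    (hT : MeasurePreserving T μ μ) (s : BlockCode μ T Y g P) : MeasObs s.rest := by
  classical
  refine (measObs_mem s.measurableSet_good).prodMk ?_
  exact ((measObs_mem (measurableSet_sweep hT s.measurableSet_good (Finset.range s.N))).prodMk
    hP).comp fun q : Prop × ρ => if q.1 then none else some q.2

lemma itinerary_apply {ρ : Type*} (P : X → ρ) (n : ℕ) (x : X) (i : Fin n) :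
    itinerary T P n x i = P (act T (i : ℕ) x) := by
  rw [act_natCast]; rfl

lemma BlockCode.exists_next_of_params (hT : MeasurePreserving T μ μ) (hY : SpecSubshift Y g h)
    {ρ κ : Type} [Fintype ρ] [Fintype κ] {P : X → ρ} {R : X → κ} (hR : MeasObs R) {f : κ → ρ} (hf : ∀ x, P x = f (R x))
    (s : BlockCode μ T Y g P) {k N' m' M B₀ : ℕ} (hk10 : 10 * s.H ≤ k)
    (hkN : k ≤ N') (hm2 : 2 * m' ≤ k) {u' : ℕ → A} {c : Fin M → ℤ → A} (hcY : ∀ a, c a ∈ Y)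
    (hcinj : ∀ a b, (∀ i < k, c a (i : ℕ) = c b (i : ℕ)) → a = b)
    (hcu : ∀ a, ∀ i < m', c a (i : ℕ) = u' i)
    (hcn : ∀ a, ∀ j, 0 < j → j + m' ≤ k → ∃ i < m', c a ((j + i : ℕ) : ℤ) ≠ u' i)
    {e' : ℤ → A} (he' : e' ∈ Y)
    (he'u : ∀ j, j + m' ≤ 4 * (N' + g N') → ∃ i < m', e' ((j + i : ℕ) : ℤ) ≠ u' i)
    {GZ : Set (Fin N' → Prop × Option ρ)} {GP : Set (Fin k → ρ)} {GR : Set (Fin N' → κ)}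
    (hB : 0 < B₀) (hM0 : 0 < M)
    (hM : GZ.ncard * (GP.ncard * (Fintype.card ρ ^ (g (4 * s.H) + 4 * s.H + g s.N + 5 * s.H + s.N)
      * B₀)) ≤ M)
    (hGR : ∀ p : Fin N' → ρ, {v ∈ GR | ∀ i, f (v i) = p i}.ncard ≤ B₀)
    {F C : Set X} (hF : MeasurableSet F) (hC : MeasurableSet C)
    (hFsep : ∀ x ∈ F, ∀ i : ℕ, 0 < i → i < N' + g N' → act T i x ∉ F)
    (hFsyn : ∀ᵐ x ∂μ, ∃ i < 2 * (N' + g N'), act T (i : ℕ) x ∈ F)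
    (hne : (F ∩ C).Nonempty)
    (hCZ : ∀ x ∈ C, itinerary T s.rest N' x ∈ GZ)
    (hCP : ∀ x ∈ C, itinerary T P k x ∈ GP)
    (hCR : ∀ x ∈ C, itinerary T R N' x ∈ GR)
    (hCs : ∀ x ∈ C, ∀ j : ℕ, ∃ i < 2 * s.H, act T ((j + i : ℕ) : ℤ) x ∈ s.base) :
    ∃ s' : BlockCode μ T Y g R, s'.N = N' ∧ s'.H = N' + g N' ∧
      s'.K = k + (g (4 * s.H) + 4 * s.H + g s.N + 5 * s.H) ∧ s'.good = F ∩ C ∧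
      ∀ x ∈ s'.good, ∀ j : ℕ, s'.K ≤ j + s.N → j + s.N ≤ N' → act T (j : ℕ) x ∈ s.base →
        ∀ i < s.N, s'.code x ((j + i : ℕ) : ℤ) = s.code (act T (j : ℕ) x) (i : ℕ) := by
  classical
  have hP : MeasObs P := by
    rw [show P = fun x => f (R x) from funext hf]
    exact hR.comp f
  have hsN := s.N_pos
  have hsNH := s.N_add_gap_le
  have hTm : Measurable T := hT.measurable
  have hact : ∀ i : ℤ, Measurable (act T i) := fun i => (measurePreserving_act hT i).measurable
  set D := g (4 * s.H) + 4 * s.H + g s.N + 5 * s.H with hD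
  set k1 := k + g (4 * s.H) + 4 * s.H + g s.N with hk1
  have := s.finite_range.to_subtype
  -- the message
  obtain ⟨idx, hidx⟩ := exists_fibre_index (fun (v : Fin N' → κ) i => f (v i)) (G := GR) hB
    (fun p => by simpa only [funext_iff] using hGR p)
  let Msg := (Fin N' → Prop × Option ρ) × (Fin k → ρ) × (Fin (D + s.N) → ρ) × Fin B₀
  obtain ⟨ι, hι⟩ := exists_injOn_fin (α := Msg) (V := GZ ×ˢ GP ×ˢ Set.univ ×ˢ Set.univ) (M := M)
    (by
      rw [Set.ncard_prod, Set.ncard_prod, Set.ncard_prod, Set.ncard_univ, Set.ncard_univ]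
      simpa using hM) hM0
  let pos : ℕ → ℕ := fun t => if t < D then k + t else N' - s.N + (t - D)
  let msg : X → Msg := fun x => (itinerary T s.rest N' x, itinerary T P k x,
    (fun t => P (act T (pos t : ℕ) x)), idx (itinerary T R N' x))
  have hmsg : MeasObs msg := by
    refine ((s.measObs_rest hP hT).itinerary hTm _).prodMk ((hP.itinerary hTm _).prodMk
      (MeasObs.prodMk ?_ ((hR.itinerary hTm _).comp idx)))
    exact MeasObs.pi fun t => hP.comp_measurable (hact _)
  let blk : X → Fin N' → Option (Set.range s.code) := fun x j =>
    if act T (j : ℕ) x ∈ s.base then some ⟨s.code (act T (j : ℕ) x), Set.mem_range_self _⟩ else none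
  have hblk : MeasObs blk := by
    refine MeasObs.pi fun j => ?_
    have h1 : MeasObs fun x => (⟨s.code x, Set.mem_range_self _⟩ : Set.range s.code) := by
      intro S
      have := s.measObs_code (Subtype.val '' S)
      convert this using 1
      ext x; simp
    exact (((measObs_mem s.measurableSet_base).prodMk h1).comp
      fun q : Prop × Set.range s.code => if q.1 then some q.2 else none).comp_measurable (hact j)
  -- the words
  let Rel : Msg × (Fin N' → Option (Set.range s.code)) → (ℤ → A) → Prop := fun d w =>
    w ∈ Y ∧ (∀ t : ℕ, t < k → w t = c (ι d.1) t) ∧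
    (∀ t : ℕ, t < 4 * s.H → w ((k + g (4 * s.H) + t : ℕ) : ℤ) = s.spacer t) ∧
    ∀ j : Fin N', k1 ≤ j → j + s.N ≤ N' → ∀ b, d.2 j = some b → ∀ t : ℕ, t < s.N →
      w ((j + t : ℕ) : ℤ) = b.1 t
  have hex : ∀ x, ∃ w, Rel (msg x, blk x) w := by
    intro x
    have ⟨z, hz, h1, h2, h3⟩ := hY.exists_concat (k := k) (N := s.N) (H := s.H) (by omega) hsN
      hsNH (hcY (ι (msg x))) s.spacer_mem
      ((Finset.range N').filter fun j => k1 ≤ j ∧ act T (j : ℕ) x ∈ s.base)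
      (fun j => s.code (act T (j : ℕ) x)) (fun j _ => s.code_mem _)
      (fun j hj => (Finset.mem_filter.1 hj).2.1) ?_
    · refine ⟨z, hz, h1, h2, fun j hj hjN b hb t ht => ?_⟩
      by_cases hjb : act T (j : ℕ) x ∈ s.base
      · have hb' : (⟨s.code (act T (j : ℕ) x), Set.mem_range_self _⟩ : Set.range s.code) = b := by
          simpa [blk, hjb] using hb
        rw [← hb']
        exact h3 j (by simp [hj, hjb]) t ht
      · simp [blk, hjb] at hb
    · intro i hi j hj hij
      by_contra hlt
      refine s.separated _ (Finset.mem_filter.1 hi).2.2 (j - i) (by omega) (by omega) ?_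
      rw [← act_add]
      convert (Finset.mem_filter.1 hj).2.2 using 2
      push_cast [hij.le]; ring
  obtain ⟨x₀, hx₀⟩ := hne
  let wd : Msg × (Fin N' → Option (Set.range s.code)) → ℤ → A := fun d =>
    if hd : ∃ w, Rel d w then hd.choose else s.spacer
  have hwd : ∀ x, Rel (msg x, blk x) (wd (msg x, blk x)) := by
    intro x
    simp only [wd, dif_pos (hex x)]
    exact (hex x).choose_spec
  let rep : X → X := fun x => if x ∈ F ∩ C then x else x₀
  have hrep : ∀ x, rep x ∈ F ∩ C := fun x => by
    by_cases hx : x ∈ F ∩ C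
    · simpa only [rep, if_pos hx] using hx
    · simpa only [rep, if_neg hx] using hx₀
  have hrep' : ∀ x ∈ F ∩ C, rep x = x := fun x hx => by simp only [rep, if_pos hx]
  let code' : X → ℤ → A := fun x => wd (msg (rep x), blk (rep x))
  have hcode : ∀ x, Rel (msg (rep x), blk (rep x)) (code' x) := fun x => hwd _
  have hblock : ∀ x, ∀ j : ℕ, k1 ≤ j → j + s.N ≤ N' → act T (j : ℕ) (rep x) ∈ s.base →
      ∀ i < s.N, code' x ((j + i : ℕ) : ℤ) = s.code (act T (j : ℕ) (rep x)) (i : ℕ) := by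
    intro x j hj hjN hjb i hi
    exact (hcode x).2.2.2 ⟨j, by omega⟩ hj hjN
      ⟨s.code (act T (j : ℕ) (rep x)), Set.mem_range_self _⟩ (by simp [blk, hjb]) i hi
  have hlab : MeasObs fun x => (msg (rep x), blk (rep x)) := by
    have h1 := ((measObs_mem (hF.inter hC)).prodMk (hmsg.prodMk hblk)).comp
      (fun q : Prop × (Msg × (Fin N' → Option (Set.range s.code))) =>
        if q.1 then q.2 else (msg x₀, blk x₀))
    convert h1 using 2 with x
    by_cases hx : x ∈ F ∩ C
    · simp only [rep, if_pos hx]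
    · simp only [rep, if_neg hx]
  refine ⟨{ N := N', H := N' + g N', K := k + D, m := m', base := F, good := F ∩ C, code := code'
            marker := u', spacer := e', measurableSet_base := hF
            measurableSet_good := hF.inter hC
            good_subset := Set.inter_subset_left
            separated := hFsep, syndetic := hFsyn, N_pos := by omega, m_le := by omega
            N_add_gap_le := le_rfl
            measObs_code := hlab.comp wd
            finite_range := ?_
            code_mem := fun x => (hcode x).1
            code_eq_marker := fun x i hi => ?_
            spacer_mem := he', spacer_avoids := he'u
            decode := ?_, comma := ?_ }, rfl, rfl, rfl, rfl, ?_⟩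
  · refine (Set.finite_range wd).subset ?_
    rintro _ ⟨x, rfl⟩
    exact ⟨_, rfl⟩
  · rw [(hcode x).2.1 i (by omega), hcu _ i hi]
  · intro x hx x' hx' heq
    have hmeq : msg x = msg x' := by
      have h1 : ι (msg (rep x)) = ι (msg (rep x')) := by
        refine hcinj _ _ fun i hi => ?_
        rw [← (hcode x).2.1 i hi, ← (hcode x').2.1 i hi]
        exact heq i (by omega)
      rw [hrep' x hx, hrep' x' hx'] at h1
      exact hι ⟨hCZ x hx.2, hCP x hx.2, mem_univ _, mem_univ _⟩
        ⟨hCZ x' hx'.2, hCP x' hx'.2, mem_univ _, mem_univ _⟩ h1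
    obtain ⟨hmZ, hmP, hmL, hmI⟩ : itinerary T s.rest N' x = itinerary T s.rest N' x' ∧
        itinerary T P k x = itinerary T P k x' ∧
        (∀ t : Fin (D + s.N), P (act T (pos t : ℕ) x) = P (act T (pos t : ℕ) x')) ∧
        idx (itinerary T R N' x) = idx (itinerary T R N' x') :=
      ⟨congrArg Prod.fst hmeq, congrArg (fun q : Msg => q.2.1) hmeq,
        congrFun (congrArg (fun q : Msg => q.2.2.1) hmeq), congrArg (fun q : Msg => q.2.2.2) hmeq⟩
    have hZ : ∀ i < N', s.rest (act T (i : ℕ) x) = s.rest (act T (i : ℕ) x') := fun i hi => by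
      simpa only [itinerary_apply] using congrFun hmZ ⟨i, hi⟩
    have hPeq : ∀ i < N', P (act T (i : ℕ) x) = P (act T (i : ℕ) x') := by
      intro i hi
      rcases lt_or_ge i k with h1 | h1
      · simpa only [itinerary_apply] using congrFun hmP ⟨i, h1⟩
      rcases lt_or_ge i (k + D) with h2 | h2
      · have := hmL ⟨i - k, by omega⟩
        have hp : pos (i - k) = i := by simp only [pos]; rw [if_pos (by omega)]; omega
        simpa only [hp] using this
      rcases lt_or_ge i (N' - s.N) with h3 | h3
      swap
      · have := hmL ⟨D + (i - (N' - s.N)), by omega⟩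
        have hp : pos (D + (i - (N' - s.N))) = i := by
          simp only [pos]; rw [if_neg (by omega)]; omega
        simpa only [hp] using this
      have hZi := congrArg Prod.snd (hZ i hi)
      simp only [BlockCode.rest] at hZi
      by_cases hsw : act T (i : ℕ) x ∈ sweep T s.good (Finset.range s.N)
      · obtain ⟨a, ha, hag⟩ := hsw
        have ha' : a < s.N := Finset.mem_range.1 ha
        have hia : (-(a : ℤ) + (i : ℕ) : ℤ) = ((i - a : ℕ) : ℤ) := by omega
        rw [← act_add, hia] at hag
        have hag' : act T ((i - a : ℕ) : ℤ) x' ∈ s.good := by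
          have := congrArg Prod.fst (hZ (i - a) (by omega))
          simp only [BlockCode.rest] at this
          exact this.mp hag
        have hd := s.decode _ hag _ hag' (fun t ht => ?_) a ha'
        · rw [← act_add, ← act_add] at hd
          have : ((a : ℕ) + ((i - a : ℕ) : ℤ) : ℤ) = (i : ℕ) := by omega
          rwa [this] at hd
        · have e1 := hblock x (i - a) (by omega) (by omega)
            (by rw [hrep' x hx]; exact s.good_subset hag) t ht
          have e2 := hblock x' (i - a) (by omega) (by omega)
            (by rw [hrep' x' hx']; exact s.good_subset hag') t ht
          rw [hrep' x hx] at e1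
          rw [hrep' x' hx'] at e2
          rw [← e1, ← e2]
          exact heq _ (by omega)
      · rw [if_neg hsw] at hZi
        split_ifs at hZi with h4
        exact Option.some.inj hZi
    have hReq := hidx _ (hCR x hx.2) _ (hCR x' hx'.2) (by
      funext i
      simpa only [itinerary_apply, hf] using hPeq i i.2) hmI
    intro i hi
    simpa only [itinerary_apply] using congrFun hReq ⟨i, hi⟩
  · intro x x' j hj0 hjK
    by_contra! hcon
    rcases lt_or_ge j (4 * s.H + g s.N) with h1 | h1
    · obtain ⟨i, hi, hne⟩ := hcn (ι (msg (rep x))) j hj0 (by omega)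
      refine hne ?_
      rw [← (hcode x).2.1 (j + i) (by omega), hcon i (by omega), (hcode x').2.1 i (by omega),
        hcu _ i hi]
    · obtain ⟨i₀, hi₀, hb⟩ := hCs (rep x) (hrep x).2 (j + (k + g (4 * s.H)))
      obtain ⟨i, hi, hne⟩ := s.spacer_avoids i₀ (by have := s.m_le; omega)
      have hm := s.m_le
      refine hne ?_
      have e1 := hblock x (j + (k + g (4 * s.H)) + i₀) (by omega) (by omega) hb i (by omega)
      rw [s.code_eq_marker _ i hi] at e1
      rw [← e1, ← (hcode x').2.2.1 (i₀ + i) (by omega), ← hcon _ (by omega)]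
      congr 2
      omega
  · intro x hx j hjK hjN hjb i hi
    have := hblock x j (by change k + D ≤ j + s.N at hjK; omega) hjN
      (by rw [hrep' x hx]; exact hjb) i hi
    rwa [hrep' x hx] at this

end

section

variable {X : Type*} [MeasurableSpace X] {μ : Measure X}

lemma infoEntropy_nonneg [IsProbabilityMeasure μ] {ρ : Type*} [Fintype ρ] (P : X → ρ) :
    0 ≤ infoEntropy μ P :=
  Finset.sum_nonneg fun _ _ => Real.negMulLog_nonneg measureReal_nonneg measureReal_le_one

lemma infoEntropy_comp_equiv {ρ κ : Type*} [Fintype ρ] [Fintype κ] (e : ρ ≃ κ) (P : X → ρ) :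
    infoEntropy μ (fun x => e (P x)) = infoEntropy μ P := by
  simp only [infoEntropy]
  rw [← e.sum_comp]
  refine Finset.sum_congr rfl fun a _ => ?_
  congr 3
  ext x; simp

lemma infoEntropy_itinerary_one {ρ : Type*} [Fintype ρ] (T : X → X) (P : X → ρ) :
    infoEntropy μ (itinerary T P 1) = infoEntropy μ P := by
  rw [← infoEntropy_comp_equiv (Equiv.funUnique (Fin 1) ρ)]
  rfl

lemma eventually_exists_typical_ncard [IsProbabilityMeasure μ] {T : X → X} (hT : Ergodic T μ)
    {ρ : Type*} [Fintype ρ] {P : X → ρ} (hP : MeasObs P) {m : ℕ} (hm : 0 < m) {c : ℝ}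
    (hc : infoEntropy μ (itinerary T P m) < m * c) {ε : ℝ} (hε : 0 < ε) :
    ∀ᶠ n : ℕ in atTop, ∃ G : Set (Fin n → ρ), μ.real {x | itinerary T P n x ∉ G} ≤ ε ∧
      (G.ncard : ℝ) ≤ Real.exp (c * n) := by
  filter_upwards [eventually_exists_typical hT hP (fun _ => ()) hm (c := c)
    (by have := infoEntropy_nonneg (μ := μ) (itinerary T (fun _ : X => ()) m); linarith) hε]
    with n hn
  obtain ⟨G, hG, hG'⟩ := hn
  exact ⟨G, hG, by simpa using hG' fun _ => ()⟩

end

section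

variable {X : Type} [MeasurableSpace X] {μ : Measure X} {T : X ≃ᵐ X} {A : Type} [Finite A]
  {Y : Set (ℤ → A)} {g : ℕ → ℕ} {h : ℝ}

set_option maxHeartbeats 1000000 in
lemma BlockCode.exists_next [StandardBorelSpace X] [IsProbabilityMeasure μ]
    [NullSingletonClass μ] (hT : Ergodic T μ) (hY : SpecSubshift Y g h)
    {ρ κ : Type} [Fintype ρ] [Fintype κ] {P : X → ρ} {R : X → κ} (hR : MeasObs R) {f : κ → ρ}
    (hf : ∀ x, P x = f (R x)) (s : BlockCode μ T Y g P) {hP r c θ ε : ℝ} (hP0 : 0 ≤ hP)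
    (hPent : ∃ m : ℕ, 0 < m ∧ infoEntropy μ (itinerary T P m) < m * hP)
    (hRent : ∃ m : ℕ, 0 < m ∧
      infoEntropy μ (itinerary T R m) - infoEntropy μ (itinerary T P m) < m * r)
    (hrest : infoEntropy μ s.rest < c) (hr : 0 < r) (hθ0 : 0 < θ) (hθ1 : θ < 1)
    (hroom : θ * hP + r + c < θ * h) (hε0 : 0 < ε) (hε1 : ε < 1) (b : ℕ) :
    ∃ s' : BlockCode μ T Y g R, b ≤ s'.N ∧ s.N < s'.K ∧ (s'.K : ℝ) ≤ (θ + ε) * s'.N ∧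
      1 - ε ≤ s'.N * μ.real s'.good ∧
      ∀ x ∈ s'.good, ∀ j : ℕ, s'.K ≤ j + s.N → j + s.N ≤ s'.N → act T (j : ℕ) x ∈ s.base →
        ∀ i < s.N, s'.code x ((j + i : ℕ) : ℤ) = s.code (act T (j : ℕ) x) (i : ℕ) := by
  have hmp := hT.toMeasurePreserving
  have hTm : Measurable T := hmp.measurable
  have hPm : MeasObs P := by
    rw [show P = fun x => f (R x) from funext hf]
    exact hR.comp f
  have hc : 0 < c := (infoEntropy_nonneg _).trans_lt hrest
  obtain ⟨δ, hδ, hδ'⟩ : ∃ δ > 0, θ * hP + r + c < θ * (h - δ) := by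
    refine ⟨(θ * h - (θ * hP + r + c)) / (2 * θ), div_pos (by linarith) (by linarith), ?_⟩
    have : θ * ((θ * h - (θ * hP + r + c)) / (2 * θ)) = (θ * h - (θ * hP + r + c)) / 2 := by
      field_simp
    rw [mul_sub, this]; linarith
  have hgap : 0 < h - δ - hP := by
    by_contra! hcon
    have := mul_nonpos_of_nonneg_of_nonpos hθ0.le hcon
    nlinarith
  set a : ℝ := θ * (h - δ) - (θ * hP + r + c) with ha
  have ha0 : 0 < a := by linarith
  set D : ℕ := g (4 * s.H) + 4 * s.H + g s.N + 5 * s.H with hD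
  set Q : ℝ := (Fintype.card ρ : ℝ) ^ (D + s.N) with hQ
  set η : ℝ := ε / 5 with hη
  have hη0 : 0 < η := by positivity
  obtain ⟨mP, hmP, hmP'⟩ := hPent
  obtain ⟨mR, hmR, hmR'⟩ := hRent
  rw [show P = fun x => f (R x) from funext hf] at hmR'
  obtain ⟨α, hα, hhead⟩ := hY.exists_headers hδ
  obtain ⟨k, hkdef, hk⟩ : ∃ k : ℕ → ℕ, (∀ n : ℕ, k n = ⌊θ * n⌋₊) ∧ Tendsto k atTop atTop :=
    ⟨_, fun _ => rfl,
      tendsto_nat_floor_atTop.comp (tendsto_natCast_atTop_atTop.const_mul_atTop hθ0)⟩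
  have hH : Tendsto (fun n : ℕ => 4 * (n + g n)) atTop atTop :=
    tendsto_atTop_mono (fun n => by show n ≤ _; omega) tendsto_id
  have hbig : ∀ C : ℝ, ∀ᶠ n : ℕ in atTop, C ≤ n := fun C =>
    tendsto_natCast_atTop_atTop.eventually_ge_atTop C
  have hg : ∀ᶠ n : ℕ in atTop, (g n : ℝ) / n < η :=
    hY.gap_sublinear.eventually (gt_mem_nhds hη0)
  obtain ⟨n, ⟨⟨GZ, hGZ, hGZ'⟩, ⟨GP, hGP, hGP'⟩, ⟨m, hm, hm2, u, hu⟩, ⟨GR, hGR, hGR'⟩⟩,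
    ⟨hav, hk10, hkN⟩, ⟨hgn, hn1, hnD, hna⟩, hnb⟩ :=
    (((eventually_exists_typical_ncard hT (s.measObs_rest hPm hmp) one_pos (c := c)
      (by rw [infoEntropy_itinerary_one]; simpa using hrest) hη0).and
      ((hk.eventually (eventually_exists_typical_ncard hT hPm hmP hmP' hη0)).and
      ((hk.eventually hhead).and (eventually_exists_typical hT hR f hmR hmR' hη0)))).and
      (((hH.eventually (hY.exists_avoiding (β := α * θ / 16) (by positivity))).and
      ((hk.eventually_ge_atTop (10 * s.H)).and (hk.eventually_gt_atTop s.N))).and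
      ((hg.and ((hbig 1).and ((hbig (D / ε)).and (hbig ((Q + (h - δ - hP)) / a))))).and
      (eventually_ge_atTop b)))).exists
  have hn0 : (0 : ℝ) < n := by linarith
  rw [div_lt_iff₀ hn0] at hgn
  rw [div_le_iff₀ hε0] at hnD
  rw [div_le_iff₀ ha0] at hna
  have hk_le : (k n : ℝ) ≤ θ * n := hkdef n ▸ Nat.floor_le (by positivity)
  have hk_gt : θ * n - 1 < k n := by
    rw [hkdef]; have := Nat.lt_floor_add_one (θ * n); linarith
  have hkn : k n ≤ n := by
    have : (k n : ℝ) ≤ n := hk_le.trans (by nlinarith)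
    exact_mod_cast this
  have hHpos : 1 ≤ s.H := by have := s.N_pos; have := s.N_add_gap_le; omega
  have hk10' : (10 : ℝ) ≤ k n := by
    have : 10 ≤ k n := by omega
    exact_mod_cast this
  -- the alphabet of headers
  set M : ℕ := ⌊Real.exp (k n * (h - δ))⌋₊ with hM
  obtain ⟨cw, hcY, hcinj, hcu, hcn⟩ := hu M (Nat.floor_le (Real.exp_pos _).le)
  obtain ⟨e, heY, heu⟩ := hav m (by
    push_cast
    have h1 : α * k n ≤ m := hm
    have h2 : (n : ℝ) + g n ≤ 2 * n := by nlinarith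
    have h3 : θ * n / 2 ≤ k n := by linarith
    have h4 : α * θ / 16 * (4 * ((n : ℝ) + g n)) ≤ α * θ / 16 * (4 * (2 * n)) := by gcongr
    have h5 : α * (θ * n / 2) ≤ α * k n := by gcongr
    linarith) u
  set B₀ : ℕ := ⌊Real.exp (r * n)⌋₊ with hB₀
  have hB₀pos : 0 < B₀ := Nat.floor_pos.2 (Real.one_le_exp (by positivity))
  have hMpos : 0 < M := Nat.floor_pos.2 (Real.one_le_exp
    (mul_nonneg (Nat.cast_nonneg _) (by linarith)))
  have hcount : GZ.ncard * (GP.ncard * (Fintype.card ρ ^ (D + s.N) * B₀)) ≤ M := by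
    refine Nat.le_floor ?_
    push_cast
    have h1 : (B₀ : ℝ) ≤ Real.exp (r * n) := Nat.floor_le (Real.exp_pos _).le
    have h2 : Q ≤ Real.exp Q := by linarith [Real.add_one_le_exp Q]
    have h3 : 0 ≤ Q := by positivity
    have h4 : (GP.ncard : ℝ) ≤ Real.exp (hP * k n) := hGP'
    calc (GZ.ncard : ℝ) * (GP.ncard * (Q * B₀))
        ≤ Real.exp (c * n) * (Real.exp (hP * k n) * (Real.exp Q * Real.exp (r * n))) := by
          gcongr
      _ = Real.exp (c * n + (hP * k n + (Q + r * n))) := by simp only [Real.exp_add]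
      _ ≤ Real.exp (k n * (h - δ)) := by
          refine Real.exp_le_exp.2 ?_
          have := mul_le_mul_of_nonneg_right hk_gt.le hgap.le
          rw [ha] at hna
          linarith
  -- the typical points
  set C : Set X := ({x | itinerary T s.rest n x ∈ GZ} ∩ ({x | itinerary T P (k n) x ∈ GP} ∩
    {x | itinerary T R n x ∈ GR})) ∩ {x | ∀ j : ℕ, ∃ i < 2 * s.H,
      act T ((j + i : ℕ) : ℤ) x ∈ s.base} with hC
  have hC₁ : MeasurableSet {x | itinerary T s.rest n x ∈ GZ} :=
    (s.measObs_rest hPm hmp).itinerary hTm n GZ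
  have hC₂ : MeasurableSet {x | itinerary T P (k n) x ∈ GP} := hPm.itinerary hTm (k n) GP
  have hC₃ : MeasurableSet {x | itinerary T R n x ∈ GR} := hR.itinerary hTm n GR
  have hC₄ : MeasurableSet {x | ∀ j : ℕ, ∃ i < 2 * s.H, act T ((j + i : ℕ) : ℤ) x ∈ s.base} := by
    have : {x | ∀ j : ℕ, ∃ i < 2 * s.H, act T ((j + i : ℕ) : ℤ) x ∈ s.base} =
        ⋂ j : ℕ, ⋃ i : ℕ, ⋃ _ : i < 2 * s.H, act T ((j + i : ℕ) : ℤ) ⁻¹' s.base := by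
      ext x
      simp only [Set.mem_ofPred_eq, Set.mem_iInter, Set.mem_iUnion, Set.mem_preimage, exists_prop]
    rw [this]
    exact MeasurableSet.iInter fun j => MeasurableSet.iUnion fun i => MeasurableSet.iUnion fun _ =>
      (measurePreserving_act hmp _).measurable s.measurableSet_base
  have hCm : MeasurableSet C := (hC₁.inter (hC₂.inter hC₃)).inter hC₄
  have hC₄' : μ.real {x | ∀ j : ℕ, ∃ i < 2 * s.H, act T ((j + i : ℕ) : ℤ) x ∈ s.base}ᶜ = 0 := by
    have : ∀ᵐ x ∂μ, ∀ j : ℕ, ∃ i < 2 * s.H, act T ((j + i : ℕ) : ℤ) x ∈ s.base := by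
      rw [ae_all_iff]
      intro j
      filter_upwards [(measurePreserving_act hmp j).quasiMeasurePreserving.ae s.syndetic] with x hx
      obtain ⟨i, hi, hx⟩ := hx
      refine ⟨i, hi, ?_⟩
      rw [← act_add] at hx
      convert hx using 2
      push_cast; ring
    rw [Measure.real, show μ _ = 0 from this]; rfl
  have hCμ : μ.real Cᶜ ≤ 3 * η := by
    rw [hC, Set.compl_inter, Set.compl_inter, Set.compl_inter]
    refine (measureReal_union_le _ _).trans ?_
    rw [hC₄', add_zero]
    refine (measureReal_union_le _ _).trans ?_
    have h1 : μ.real {x | itinerary T s.rest n x ∈ GZ}ᶜ ≤ η := hGZ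
    have h2 : μ.real {x | itinerary T P (k n) x ∈ GP}ᶜ ≤ η := hGP
    have h3 : μ.real {x | itinerary T R n x ∈ GR}ᶜ ≤ η := hGR
    have h4 := measureReal_union_le (μ := μ) {x | itinerary T P (k n) x ∈ GP}ᶜ
      {x | itinerary T R n x ∈ GR}ᶜ
    linarith
  obtain ⟨F, hFm, hFsep, hFsyn, hFμ⟩ := exists_tower hT (H := n + g n)
    (by have : 0 < n := by exact_mod_cast hn0
        omega) hη0 hCm.compl
  rw [Set.sdiff_compl] at hFμ
  push_cast at hFμ
  have hgood : 1 - ε ≤ n * μ.real (F ∩ C) := by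
    have h1 : ((n : ℝ) + g n) * μ.real (F ∩ C) ≤ (1 + η) * (n * μ.real (F ∩ C)) := by
      have : (n : ℝ) + g n ≤ (1 + η) * n := by linarith
      have := mul_le_mul_of_nonneg_right this (measureReal_nonneg (μ := μ) (s := F ∩ C))
      linarith
    by_contra! hcon
    have h2 : (1 + η) * (n * μ.real (F ∩ C)) < (1 + η) * (1 - ε) := by gcongr
    have h3 : 0 ≤ η * ε := by positivity
    have h4 : ε = 5 * η := by rw [hη]; ring
    nlinarith
  have hne : (F ∩ C).Nonempty := by
    by_contra hcon
    rw [Set.not_nonempty_iff_eq_empty] at hcon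
    rw [hcon, measureReal_empty] at hgood
    linarith
  obtain ⟨s', hN, -, hK, hg', htr⟩ := s.exists_next_of_params hmp hY hR hf (N' := n) (m' := m)
    (k := k n) hk10 hkn hm2 hcY hcinj hcu hcn heY heu hB₀pos hMpos hcount
    (fun p => Nat.le_floor (hGR' p)) hFm hCm hFsep hFsyn hne (fun x hx => hx.1.1)
    (fun x hx => hx.1.2.1) (fun x hx => hx.1.2.2) (fun x hx => hx.2)
  refine ⟨s', by omega, by omega, ?_, ?_, ?_⟩
  · rw [hK, hN, ← hD]
    push_cast
    linarith
  · rwa [hN, hg']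
  · rw [hN]
    exact htr

end

lemma exists_infoEntropy_lt {X : Type*} [MeasurableSpace X] (μ : Measure X) [IsProbabilityMeasure μ]
    (W : Type*) [Fintype W] {c : ℝ} (hc : 0 < c) :
    ∃ η > 0, ∀ Z : X → W, MeasObs Z → ∀ w₀, 1 - η ≤ μ.real (Z ⁻¹' {w₀}) → infoEntropy μ Z < c := by
  classical
  set d : ℝ := c / (Fintype.card W + 1) with hd
  have hd0 : 0 < d := by positivity
  have h0 : ∀ᶠ t in nhds (0 : ℝ), Real.negMulLog t < d :=
    Real.continuous_negMulLog.continuousAt.eventually (gt_mem_nhds (by simpa using hd0))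
  have h1 : ∀ᶠ t in nhds (1 : ℝ), Real.negMulLog t < d :=
    Real.continuous_negMulLog.continuousAt.eventually (gt_mem_nhds (by simpa using hd0))
  obtain ⟨η₀, hη₀, H₀⟩ := Metric.eventually_nhds_iff.1 h0
  obtain ⟨η₁, hη₁, H₁⟩ := Metric.eventually_nhds_iff.1 h1
  refine ⟨min η₀ η₁ / 2, by positivity, fun Z hZ w₀ hw₀ => ?_⟩
  have hmin0 := min_le_left η₀ η₁
  have hmin1 := min_le_right η₀ η₁
  have hpos : 0 < min η₀ η₁ := by positivity
  have hlt : ∀ w, Real.negMulLog (μ.real (Z ⁻¹' {w})) < d := by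
    intro w
    have hle := measureReal_le_one (μ := μ) (s := Z ⁻¹' {w})
    have hge := measureReal_nonneg (μ := μ) (s := Z ⁻¹' {w})
    by_cases hw : w = w₀
    · subst hw
      refine H₁ ?_
      rw [Real.dist_eq, abs_lt]
      constructor <;> linarith
    · refine H₀ ?_
      have hsub : Z ⁻¹' {w} ⊆ (Z ⁻¹' {w₀})ᶜ := by
        intro x hx hx'
        exact hw (hx.symm.trans hx')
      have := (measureReal_mono hsub).trans_eq (probReal_compl_eq_one_sub (μ := μ) (hZ {w₀}))
      rw [Real.dist_eq, abs_lt]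
      constructor <;> linarith
  calc infoEntropy μ Z ≤ ∑ _w : W, d := Finset.sum_le_sum fun w _ => (hlt w).le
    _ = Fintype.card W * d := by simp
    _ < (Fintype.card W + 1) * d := by linarith
    _ = c := by rw [hd]; field_simp

lemma exists_dependent_sequence {α : ℕ → Type*} {Q : ∀ n, α n → Prop}
    {R : ∀ n, α n → α (n + 1) → Prop} (h0 : ∃ a, Q 0 a)
    (hs : ∀ n a, Q n a → ∃ b, Q (n + 1) b ∧ R n a b) :
    ∃ s : ∀ n, α n, ∀ n, R n (s n) (s (n + 1)) := by
  choose next hQ hR using hs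
  obtain ⟨a, ha⟩ := h0
  let s : ∀ n, {a : α n // Q n a} := fun n =>
    Nat.rec ⟨a, ha⟩ (fun n b => ⟨next n b.1 b.2, hQ n b.1 b.2⟩) n
  exact ⟨fun n => (s n).1, fun n => hR n (s n).1 (s n).2⟩

section

variable {X : Type} [MeasurableSpace X] {μ : Measure X} {T : X ≃ᵐ X} {A : Type}
  {Y : Set (ℤ → A)} {g : ℕ → ℕ} {h : ℝ}

lemma BlockCode.N_le_H {ρ : Type} {P : X → ρ} (s : BlockCode μ T Y g P) : s.N ≤ s.H := by
  have := s.N_add_gap_le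
  omega

lemma BlockCode.separated_good {ρ : Type} {P : X → ρ} (s : BlockCode μ T Y g P) :
    ∀ x ∈ s.good, ∀ i : ℕ, 0 < i → i < s.H → act T i x ∉ s.good := fun x hx i hi0 hi hg =>
  s.separated x (s.good_subset hx) i hi0 hi (s.good_subset hg)

lemma BlockCode.measureReal_sweep_good [IsProbabilityMeasure μ] (hT : MeasurePreserving T μ μ)
    {ρ : Type} {P : X → ρ} (s : BlockCode μ T Y g P) {I : Finset ℕ} (hI : ∀ a ∈ I, a < s.N) :
    μ.real (sweep T s.good I) = I.card * μ.real s.good :=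
  measureReal_sweep hT s.measurableSet_good s.separated_good
    fun a ha => (hI a ha).trans_le s.N_le_H

lemma BlockCode.measureReal_good_le [IsProbabilityMeasure μ] (hT : MeasurePreserving T μ μ)
    {ρ : Type} {P : X → ρ} (s : BlockCode μ T Y g P) : s.N * μ.real s.good ≤ 1 := by
  have := s.measureReal_sweep_good hT (I := Finset.range s.N) (by simp)
  rw [Finset.card_range] at this
  rw [← this]
  exact measureReal_le_one

lemma exists_infoEntropy_rest_lt [IsProbabilityMeasure μ] (hT : MeasurePreserving T μ μ)
    {ρ : Type} [Fintype ρ] {P : X → ρ} (hP : MeasObs P) {c : ℝ} (hc : 0 < c) :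
    ∃ ε > 0, ∃ b : ℕ, ∀ s : BlockCode μ T Y g P, b ≤ s.N → 1 - ε ≤ s.N * μ.real s.good →
      infoEntropy μ s.rest < c := by
  classical
  obtain ⟨η, hη, H⟩ := exists_infoEntropy_lt μ (Prop × Option ρ) hc
  refine ⟨η / 2, by positivity, ⌈2 / η⌉₊, fun s hb hs => H _ (s.measObs_rest hP hT) (False, none) ?_⟩
  have hsub : sweep T s.good (Finset.range s.N) \ s.good ⊆ s.rest ⁻¹' {(False, none)} := by
    rintro x ⟨hx, hxg⟩
    simp [BlockCode.rest, hx, hxg]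
  refine le_trans ?_ (measureReal_mono hsub)
  refine le_trans ?_ (le_measureReal_sdiff)
  rw [s.measureReal_sweep_good hT (by simp), Finset.card_range]
  have h1 := s.measureReal_good_le hT
  have h2 : 2 / η ≤ s.N := (Nat.le_ceil _).trans (by exact_mod_cast hb)
  rw [div_le_iff₀ hη] at h2
  have h3 := measureReal_nonneg (μ := μ) (s := s.good)
  nlinarith

lemma SpecSubshift.nonempty (hY : SpecSubshift Y g h) : Y.Nonempty := by
  by_contra hcon
  rw [Set.not_nonempty_iff_eq_empty] at hcon
  have := (Real.exp_pos _).trans_le (hY.le_wordCount 0)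
  simp [wordCount, hcon] at this

lemma BlockCode.exists_initial [Finite A] [StandardBorelSpace X] [IsProbabilityMeasure μ]
    [NullSingletonClass μ] (hT : Ergodic T μ) (hY : SpecSubshift Y g h) {ρ : Type} {P : X → ρ}
    (hP : ∀ x x', P x = P x') {ε : ℝ} (hε0 : 0 < ε) (b : ℕ) :
    ∃ s : BlockCode μ T Y g P, b ≤ s.N ∧ 1 - ε ≤ s.N * μ.real s.good := by
  have hmp := hT.toMeasurePreserving
  obtain ⟨y, hy⟩ := hY.nonempty
  set η : ℝ := min ε 1 / 2 with hη
  have hη0 : 0 < η := by positivity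
  have hηε : 2 * η ≤ ε := by rw [hη]; linarith [min_le_left ε 1]
  have hη1 : 2 * η ≤ 1 := by rw [hη]; linarith [min_le_right ε 1]
  have hg : ∀ᶠ n : ℕ in atTop, (g n : ℝ) / n < η :=
    hY.gap_sublinear.eventually (gt_mem_nhds hη0)
  have hH : Tendsto (fun n : ℕ => 4 * (n + g n)) atTop atTop :=
    tendsto_atTop_mono (fun n => by show n ≤ _; omega) tendsto_id
  obtain ⟨n, hgn, hn1, hnb, hav⟩ := (hg.and ((eventually_ge_atTop 1).and
    ((eventually_ge_atTop b).and (hH.eventually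
      (hY.exists_avoiding (β := 1 / 8) (by norm_num)))))).exists
  have hn0 : (0 : ℝ) < n := by exact_mod_cast hn1
  rw [div_lt_iff₀ hn0] at hgn
  obtain ⟨e, he, heu⟩ := hav n (by push_cast; nlinarith) fun i => y i
  obtain ⟨F, hFm, hFsep, hFsyn, hFμ⟩ := exists_tower hT (H := n + g n) (by omega) hη0
    MeasurableSet.empty
  refine ⟨{ N := n, H := n + g n, K := n, m := n, base := F, good := F, code := fun _ => y
            marker := fun i => y i, spacer := e, measurableSet_base := hFm
            measurableSet_good := hFm, good_subset := subset_rfl, separated := hFsep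
            syndetic := hFsyn, N_pos := hn1, m_le := le_rfl, N_add_gap_le := le_rfl
            measObs_code := fun s => MeasurableSet.const _
            finite_range := (Set.finite_singleton y).subset (by rintro _ ⟨x, rfl⟩; rfl)
            code_mem := fun _ => hy, code_eq_marker := fun _ _ _ => rfl, spacer_mem := he
            spacer_avoids := heu, decode := fun _ _ _ _ _ _ _ => hP _ _
            comma := fun _ _ j hj0 hj => by omega }, hnb, ?_⟩
  rw [Set.sdiff_empty, measureReal_empty, sub_zero] at hFμ
  push_cast at hFμ
  by_contra! hcon
  have h1 : ((n : ℝ) + g n) * μ.real F ≤ (1 + η) * (n * μ.real F) := by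
    have : (n : ℝ) + g n ≤ (1 + η) * n := by linarith
    have := mul_le_mul_of_nonneg_right this (measureReal_nonneg (μ := μ) (s := F))
    linarith
  have h2 : (1 + η) * (n * μ.real F) < (1 + η) * (1 - ε) := by gcongr
  nlinarith

/-- The sequence of block codes obtained by refining the observables step by step. -/
lemma exists_blockCode_sequence [Finite A] [StandardBorelSpace X] [IsProbabilityMeasure μ]
    [NullSingletonClass μ] (hT : Ergodic T μ) (hY : SpecSubshift Y g h) {ρ : ℕ → Type}
    [∀ n, Fintype (ρ n)] {P : ∀ n, X → ρ n} (hPm : ∀ n, MeasObs (P n))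
    (f : ∀ n, ρ (n + 1) → ρ n) (hf : ∀ n x, P n x = f n (P (n + 1) x))
    (hP0 : ∀ x x', P 0 x = P 0 x') {hP r c θ ε : ℕ → ℝ} (hhP : ∀ n, 0 ≤ hP n)
    (hPent : ∀ n, ∃ m : ℕ, 0 < m ∧ infoEntropy μ (itinerary T (P n) m) < m * hP n)
    (hRent : ∀ n, ∃ m : ℕ, 0 < m ∧
      infoEntropy μ (itinerary T (P (n + 1)) m) - infoEntropy μ (itinerary T (P n) m) < m * r n)
    (hr : ∀ n, 0 < r n) (hc : ∀ n, 0 < c n) (hθ0 : ∀ n, 0 < θ n) (hθ1 : ∀ n, θ n < 1)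
    (hroom : ∀ n, θ n * hP n + r n + c n < θ n * h) (hε : ∀ n, 0 < ε n) (hε1 : ∀ n, ε n < 1) :
    ∃ s : ∀ n, BlockCode μ T Y g (P n), ∀ n, n ≤ (s (n + 1)).N ∧ (s n).N < (s (n + 1)).K ∧
      ((s (n + 1)).K : ℝ) ≤ (θ n + ε n) * (s (n + 1)).N ∧
      1 - ε n ≤ (s (n + 1)).N * μ.real (s (n + 1)).good ∧
      ∀ x ∈ (s (n + 1)).good, ∀ j : ℕ, (s (n + 1)).K ≤ j + (s n).N →
        j + (s n).N ≤ (s (n + 1)).N → act T (j : ℕ) x ∈ (s n).base →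
        ∀ i < (s n).N, (s (n + 1)).code x ((j + i : ℕ) : ℤ) =
          (s n).code (act T (j : ℕ) x) (i : ℕ) := by
  have hmp := hT.toMeasurePreserving
  choose η hη b hb using fun n =>
    exists_infoEntropy_rest_lt (Y := Y) (g := g) hmp (hPm n) (hc n)
  refine exists_dependent_sequence (α := fun n => BlockCode μ T Y g (P n))
    (Q := fun n s => infoEntropy μ s.rest < c n)
    (R := fun n s s' => n ≤ s'.N ∧ s.N < s'.K ∧ (s'.K : ℝ) ≤ (θ n + ε n) * s'.N ∧
      1 - ε n ≤ s'.N * μ.real s'.good ∧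
      ∀ x ∈ s'.good, ∀ j : ℕ, s'.K ≤ j + s.N → j + s.N ≤ s'.N → act T (j : ℕ) x ∈ s.base →
        ∀ i < s.N, s'.code x ((j + i : ℕ) : ℤ) = s.code (act T (j : ℕ) x) (i : ℕ))
    ?_ fun n s hs => ?_
  · obtain ⟨s, h1, h2⟩ := BlockCode.exists_initial hT hY hP0 (hη 0) (b 0)
    exact ⟨s, hb 0 s h1 h2⟩
  · have hmin1 := min_le_left (ε n) (η (n + 1))
    have hmin2 := min_le_right (ε n) (η (n + 1))
    obtain ⟨s', h1, h2, h3, h4, h5⟩ := s.exists_next hT hY (hPm (n + 1)) (hf n) (hhP n) (hPent n)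
      (hRent n) hs (hr n) (hθ0 n) (hθ1 n) (hroom n) (lt_min (hε n) (hη (n + 1)))
      (hmin1.trans_lt (hε1 n)) (max n (b (n + 1)))
    refine ⟨s', hb _ s' ((le_max_right _ _).trans h1) (by linarith), (le_max_left _ _).trans h1,
      h2, h3.trans ?_, by linarith, h5⟩
    gcongr

end

section

variable {X : Type} [MeasurableSpace X] {μ : Measure X} {T : X ≃ᵐ X} {A : Type}
  {Y : Set (ℤ → A)} {g : ℕ → ℕ} {h : ℝ}

/-- `b` is the position of `x` in a good block of `s`, away from the ends of that block. -/
def BlockCode.IsOffset {ρ : Type} {P : X → ρ} (s : BlockCode μ T Y g P) (b : ℕ) (x : X) : Prop :=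
  act T (-(b : ℤ)) x ∈ s.good ∧ s.K ≤ b ∧ b + s.K < s.N

/-- The points having an offset. -/
def BlockCode.deep {ρ : Type} {P : X → ρ} (s : BlockCode μ T Y g P) : Set X :=
  sweep T s.good (Finset.Ico s.K (s.N - s.K))

lemma BlockCode.mem_deep {ρ : Type} {P : X → ρ} {s : BlockCode μ T Y g P} {x : X} :
    x ∈ s.deep ↔ ∃ b, s.IsOffset b x := by
  simp only [BlockCode.deep, sweep, Finset.mem_Ico, BlockCode.IsOffset, Set.mem_ofPred_eq]
  constructor
  · rintro ⟨b, ⟨h1, h2⟩, h3⟩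
    exact ⟨b, h3, h1, by omega⟩
  · rintro ⟨b, h3, h1, h2⟩
    exact ⟨b, ⟨h1, by omega⟩, h3⟩

lemma BlockCode.IsOffset.eq {ρ : Type} {P : X → ρ} {s : BlockCode μ T Y g P} {b b' : ℕ} {x : X}
    (hb : s.IsOffset b x) (hb' : s.IsOffset b' x) : b = b' :=
  eq_of_separated s.separated_good (by have := hb.2.2; have := s.N_le_H; omega)
    (by have := hb'.2.2; have := s.N_le_H; omega) hb.1 hb'.1

lemma BlockCode.one_sub_le_measureReal_deep [IsProbabilityMeasure μ]
    (hT : MeasurePreserving T μ μ) {ρ : Type} {P : X → ρ} (s : BlockCode μ T Y g P) {η ε : ℝ}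
    (hη : 0 ≤ η) (hK : (s.K : ℝ) ≤ η * s.N) (hg : 1 - ε ≤ s.N * μ.real s.good) :
    1 - ε - 2 * η ≤ μ.real s.deep := by
  rw [BlockCode.deep, s.measureReal_sweep_good hT
    (fun a ha => by have := Finset.mem_Ico.1 ha; omega), Nat.card_Ico]
  have h1 : (s.N : ℝ) - 2 * s.K ≤ ((s.N - s.K - s.K : ℕ) : ℝ) := by
    have : s.N ≤ (s.N - s.K - s.K : ℕ) + 2 * s.K := by omega
    have : (s.N : ℝ) ≤ ((s.N - s.K - s.K : ℕ) : ℝ) + 2 * s.K := by exact_mod_cast this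
    linarith
  have h2 := s.measureReal_good_le hT
  have h3 := measureReal_nonneg (μ := μ) (s := s.good)
  have h4 := mul_le_mul_of_nonneg_right h1 h3
  have h5 := mul_le_mul_of_nonneg_right hK h3
  nlinarith

variable {ρ : ℕ → Type} {P : ∀ n, X → ρ n}

/-- The words of the blocks containing the orbit of `x` fit together to form the sequence `z`. -/
def Reads (s : ∀ n, BlockCode μ T Y g (P n)) (x : X) (z : ℤ → A) : Prop :=
  ∀ᶠ l in atTop, ∃ b, (s l).IsOffset b x ∧
    ∀ i < (s l).N, z ((i : ℤ) - b) = (s l).code (act T (-(b : ℤ)) x) (i : ℕ)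

variable {s : ∀ n, BlockCode μ T Y g (P n)}

lemma Reads.eventually_eq (hK : ∀ n, n ≤ (s n).K + 1) {x : X} {z : ℤ → A} (hz : Reads s x z)
    (t : ℤ) : ∀ᶠ l in atTop, ∃ b, (s l).IsOffset b x ∧ 0 ≤ t + b ∧ t + b < (s l).N ∧
      z t = (s l).code (act T (-(b : ℤ)) x) (t + b) := by
  filter_upwards [hz, eventually_ge_atTop (t.natAbs + 2)] with l hl hlt
  obtain ⟨b, hb, hbz⟩ := hl
  have h1 := hb.2.1
  have h2 := hb.2.2
  have h3 := hK l
  refine ⟨b, hb, by omega, by omega, ?_⟩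
  have h4 := hbz (t + b).toNat (by omega)
  rw [Int.toNat_of_nonneg (by omega)] at h4
  rw [← h4]
  congr 1
  omega

lemma reads_eq_iff (hK : ∀ n, n ≤ (s n).K + 1) {x : X} {z : ℤ → A} (hz : Reads s x z)
    (t : ℤ) (a : A) : z t = a ↔ ∀ᶠ l in atTop, ∃ b, (s l).IsOffset b x ∧ 0 ≤ t + b ∧
      t + b < (s l).N ∧ (s l).code (act T (-(b : ℤ)) x) (t + b) = a := by
  constructor
  · rintro rfl
    filter_upwards [hz.eventually_eq hK t] with l hl
    obtain ⟨b, h1, h2, h3, h4⟩ := hl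
    exact ⟨b, h1, h2, h3, h4.symm⟩
  · intro ha
    obtain ⟨l, ⟨b, hb, -, -, h1⟩, ⟨b', hb', -, -, h2⟩⟩ := ((hz.eventually_eq hK t).and ha).exists
    rw [h1, ← h2, hb.eq hb']

lemma Reads.unique (hK : ∀ n, n ≤ (s n).K + 1) {x : X} {z z' : ℤ → A} (hz : Reads s x z)
    (hz' : Reads s x z') : z = z' := by
  funext t
  rw [reads_eq_iff hK hz, ← reads_eq_iff hK hz']

lemma Reads.shift (hK : ∀ n, n ≤ (s n).K + 1) {x : X} {z z' : ℤ → A} (hz : Reads s x z)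
    (hz' : Reads s (T x) z') : z' = fun i => z (i + 1) := by
  refine hz'.unique hK ?_
  filter_upwards [hz, hz', eventually_ge_atTop 2] with l hl hl' hl2
  obtain ⟨b, hb, hbz⟩ := hl
  obtain ⟨b', hb', -⟩ := hl'
  have h1 := hb'.2.1
  have h2 := hK l
  have h3 : act T (-(b' : ℤ)) (T x) = act T (-((b' - 1 : ℕ) : ℤ)) x := by
    rw [← act_one (T := T), ← act_add]
    congr 1
    omega
  have h4 := (s l).N_le_H
  have h5 := hb'.1
  rw [h3] at h5
  have h6 : b = b' - 1 := eq_of_separated (s l).separated_good (by have := hb.2.2; omega)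
    (by have := hb'.2.2; omega) hb.1 h5
  refine ⟨b', hb', fun i hi => ?_⟩
  rw [h3, ← h6, ← hbz i hi]
  congr 1
  omega

lemma Reads.injective (hfac : ∀ n x x', P (n + 1) x = P (n + 1) x' → P n x = P n x')
    (hsep : ∀ x x', (∀ n, P n x = P n x') → x = x') {x x' : X} {z : ℤ → A} (hz : Reads s x z)
    (hz' : Reads s x' z) : x = x' := by
  have key : ∀ l b b' x x', (s l).IsOffset b x → (s l).IsOffset b' x' →
      (∀ i < (s l).N, z ((i : ℤ) - b) = (s l).code (act T (-(b : ℤ)) x) (i : ℕ)) →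
      (∀ i < (s l).N, z ((i : ℤ) - b') = (s l).code (act T (-(b' : ℤ)) x') (i : ℕ)) → ¬ b < b' := by
    intro l b b' x x' hb hb' hx hx' hlt
    have h1 := hb'.2.2
    obtain ⟨i, hi, hne⟩ := (s l).comma (act T (-(b' : ℤ)) x') (act T (-(b : ℤ)) x) (b' - b)
      (by omega) (by omega)
    refine hne ?_
    rw [← hx i (by omega), ← hx' (b' - b + i) (by omega)]
    congr 1
    omega
  have hev : ∀ᶠ l in atTop, P l x = P l x' := by
    filter_upwards [hz, hz'] with l hl hl'
    obtain ⟨b, hb, hbz⟩ := hl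
    obtain ⟨b', hb', hbz'⟩ := hl'
    obtain rfl : b = b' := by
      have h1 := key l b b' x x' hb hb' hbz hbz'
      have h2 := key l b' b x' x hb' hb hbz' hbz
      omega
    have := (s l).decode _ hb.1 _ hb'.1 (fun i hi => by rw [← hbz i hi, ← hbz' i hi]) b
      (by have := hb.2.2; omega)
    rwa [act_act_neg, act_act_neg] at this
  obtain ⟨L, hL⟩ := eventually_atTop.1 hev
  refine hsep x x' fun n => ?_
  have hdesc : ∀ d n, P (n + d) x = P (n + d) x' → P n x = P n x' := by
    intro d
    induction d with
    | zero => exact fun n h => h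
    | succ d ih => exact fun n h => ih n (hfac _ x x' h)
  exact hdesc L n (hL _ (by omega))

lemma exists_reads (hY : SpecSubshift Y g h) (hK : ∀ n, n ≤ (s n).K + 1)
    (hNK : ∀ n, (s n).N < (s (n + 1)).K)
    (htr : ∀ n, ∀ x ∈ (s (n + 1)).good, ∀ j : ℕ, (s (n + 1)).K ≤ j + (s n).N →
        j + (s n).N ≤ (s (n + 1)).N → act T (j : ℕ) x ∈ (s n).base →
        ∀ i < (s n).N, (s (n + 1)).code x ((j + i : ℕ) : ℤ) =
          (s n).code (act T (j : ℕ) x) (i : ℕ)) {x : X} (hx : ∀ᶠ l in atTop, x ∈ (s l).deep) :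
    ∃ z ∈ Y, Reads s x z := by
  obtain ⟨L, hL⟩ := eventually_atTop.1 hx
  choose! b hb using fun l hl => BlockCode.mem_deep.1 (hL l hl)
  let w : ℕ → ℤ → A := fun l t => (s l).code (act T (-(b l : ℤ)) x) (t + b l)
  have hstep : ∀ l ≥ L, ∀ t : ℤ, 0 ≤ t + b l → t + b l < (s l).N → w (l + 1) t = w l t := by
    intro l hl t ht0 ht
    obtain ⟨h1, h2, h3⟩ := hb l hl
    obtain ⟨h1', h2', h3'⟩ := hb (l + 1) (by omega)
    have h4 := hNK l
    have hj : act T ((b (l + 1) - b l : ℕ) : ℤ) (act T (-(b (l + 1) : ℤ)) x) =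
        act T (-(b l : ℤ)) x := by
      rw [← act_add]
      congr 1
      omega
    have := htr l _ h1' (b (l + 1) - b l) (by omega) (by omega)
      (by rw [hj]; exact (s l).good_subset h1) (t + b l).toNat (by omega)
    rw [hj, Int.toNat_of_nonneg ht0] at this
    simp only [w]
    rw [← this]
    congr 1
    omega
  have hrange : ∀ l ≥ L, ∀ d : ℕ, ∀ t : ℤ, 0 ≤ t + b l → t + b l < (s l).N →
      0 ≤ t + b (l + d) ∧ t + b (l + d) < (s (l + d)).N ∧ w (l + d) t = w l t := by
    intro l hl d t ht0 ht
    induction d with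
    | zero => exact ⟨ht0, ht, rfl⟩
    | succ d ih =>
      obtain ⟨i1, i2, i3⟩ := ih
      have h1 := hb (l + d) (by omega)
      have h2 := hb (l + d + 1) (by omega)
      have h3 := hNK (l + d)
      have h4 := h1.2
      have h5 := h2.2
      refine ⟨?_, ?_, (hstep (l + d) (by omega) t i1 i2).trans i3⟩
      · change 0 ≤ t + b (l + d + 1)
        omega
      · change t + b (l + d + 1) < (s (l + d + 1)).N
        omega
  have hcons : ∀ l ≥ L, ∀ l' ≥ L, ∀ t : ℤ, 0 ≤ t + b l → t + b l < (s l).N →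
      0 ≤ t + b l' → t + b l' < (s l').N → w l t = w l' t := by
    intro l hl l' hl' t h1 h2 h3 h4
    rcases le_total l l' with h | h
    · obtain ⟨d, rfl⟩ := Nat.exists_eq_add_of_le h
      exact (hrange l hl d t h1 h2).2.2.symm
    · obtain ⟨d, rfl⟩ := Nat.exists_eq_add_of_le h
      exact (hrange l' hl' d t h3 h4).2.2
  have hlarge : ∀ r : ℕ, ∀ t : ℤ, t.natAbs ≤ r →
      0 ≤ t + b (max L (r + 2)) ∧ t + b (max L (r + 2)) < (s (max L (r + 2))).N := by
    intro r t ht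
    have h1 := (hb (max L (r + 2)) (le_max_left _ _)).2
    have h2 := hK (max L (r + 2))
    have h3 := le_max_right L (r + 2)
    omega
  let z : ℤ → A := fun t => w (max L (t.natAbs + 2)) t
  have hz : ∀ l ≥ L, ∀ t : ℤ, 0 ≤ t + b l → t + b l < (s l).N → z t = w l t := by
    intro l hl t h1 h2
    obtain ⟨h3, h4⟩ := hlarge t.natAbs t le_rfl
    exact hcons _ (le_max_left _ _) l hl t h3 h4 h1 h2
  refine ⟨z, hY.closed z fun r => ⟨w (max L (r + 2)), hY.shift _ ((s _).code_mem _) _, ?_⟩,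
    eventually_atTop.2 ⟨L, fun l hl => ⟨b l, hb l hl, fun i hi => ?_⟩⟩⟩
  · intro t ht
    obtain ⟨h3, h4⟩ := hlarge r t (by have := abs_le.1 ht; omega)
    exact (hz _ (le_max_left _ _) t h3 h4).symm
  · rw [hz l hl _ (by omega) (by omega)]
    simp only [w, sub_add_cancel]

lemma measurableSet_deep (hT : MeasurePreserving T μ μ) {ρ : Type} {P : X → ρ}
    (s : BlockCode μ T Y g P) : MeasurableSet s.deep :=
  measurableSet_sweep hT s.measurableSet_good _

lemma measurableSet_setOf_eventually_mem {S : ℕ → Set X} (hS : ∀ n, MeasurableSet (S n)) :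
    MeasurableSet {x | ∀ᶠ n in atTop, x ∈ S n} := by
  have : {x | ∀ᶠ n in atTop, x ∈ S n} = ⋃ L : ℕ, ⋂ n : ℕ, ⋂ _ : L ≤ n, S n := by
    ext x
    simp only [eventually_atTop, Set.mem_ofPred_eq, Set.mem_iUnion, Set.mem_iInter]
  rw [this]
  exact MeasurableSet.iUnion fun L => MeasurableSet.iInter fun n => MeasurableSet.iInter fun _ =>
    hS n

lemma exists_embedding_of_blockCodes [Finite A] [IsProbabilityMeasure μ] (hT : MeasurePreserving T μ μ)
    (hY : SpecSubshift Y g h) (hK : ∀ n, n ≤ (s n).K + 1) (hNK : ∀ n, (s n).N < (s (n + 1)).K)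
    (htr : ∀ n, ∀ x ∈ (s (n + 1)).good, ∀ j : ℕ, (s (n + 1)).K ≤ j + (s n).N →
        j + (s n).N ≤ (s (n + 1)).N → act T (j : ℕ) x ∈ (s n).base →
        ∀ i < (s n).N, (s (n + 1)).code x ((j + i : ℕ) : ℤ) =
          (s n).code (act T (j : ℕ) x) (i : ℕ))
    (hfac : ∀ n x x', P (n + 1) x = P (n + 1) x' → P n x = P n x')
    (hsep : ∀ x x', (∀ n, P n x = P n x') → x = x')
    {η : ℕ → ℝ} (hη : Summable η) (hdeep : ∀ n, 1 - η n ≤ μ.real (s n).deep) :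
    ∃ Ψ : X → ℤ → A, (∀ i, MeasObs fun x => Ψ x i) ∧ (∀ x, Ψ x ∈ Y) ∧
      ∃ X' : Set X, MeasurableSet X' ∧ μ X'ᶜ = 0 ∧ Set.InjOn Ψ X' ∧
        ∀ x ∈ X', Ψ (T x) = fun i => Ψ x (i + 1) := by
  classical
  obtain ⟨y, hy⟩ := hY.nonempty
  set X₀ : Set X := {x | ∀ᶠ l in atTop, x ∈ (s l).deep} with hX₀
  have hX₀m : MeasurableSet X₀ := measurableSet_setOf_eventually_mem fun n =>
    measurableSet_deep hT (s n)
  have hX₀ae : ∀ᵐ x ∂μ, x ∈ X₀ := by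
    have hsum : ∑' n, μ (s n).deepᶜ ≠ ∞ := by
      refine ne_top_of_le_ne_top hη.tsum_ofReal_ne_top (ENNReal.tsum_le_tsum fun n => ?_)
      rw [← ofReal_measureReal, probReal_compl_eq_one_sub (measurableSet_deep hT (s n))]
      exact ENNReal.ofReal_le_ofReal (by linarith [hdeep n])
    filter_upwards [ae_eventually_notMem hsum] with x hx
    filter_upwards [hx] with l hl
    simpa using hl
  have hex : ∀ x, ∃ z ∈ Y, (x ∈ X₀ → Reads s x z) ∧ (x ∉ X₀ → z = y) := by
    intro x
    by_cases hx : x ∈ X₀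
    · obtain ⟨z, hz, hr⟩ := exists_reads hY hK hNK htr hx
      exact ⟨z, hz, fun _ => hr, fun h => absurd hx h⟩
    · exact ⟨y, hy, fun h => absurd h hx, fun _ => rfl⟩
  choose Ψ hΨY hΨr hΨy using hex
  refine ⟨Ψ, fun t => ?_, hΨY, X₀ ∩ T ⁻¹' X₀, hX₀m.inter (T.measurable hX₀m), ?_, ?_, ?_⟩
  · have hW : ∀ a, MeasurableSet {x | Ψ x t = a} := by
      intro a
      have hl : ∀ l, MeasurableSet {x | ∃ b, (s l).IsOffset b x ∧ 0 ≤ t + b ∧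
          t + b < (s l).N ∧ (s l).code (act T (-(b : ℤ)) x) (t + b) = a} := by
        intro l
        have : {x | ∃ b, (s l).IsOffset b x ∧ 0 ≤ t + b ∧ t + b < (s l).N ∧
            (s l).code (act T (-(b : ℤ)) x) (t + b) = a} =
            ⋃ b : ℕ, ⋃ _ : ((s l).K ≤ b ∧ b + (s l).K < (s l).N) ∧ 0 ≤ t + b ∧ t + b < (s l).N,
              act T (-(b : ℤ)) ⁻¹' ((s l).good ∩ {x | (s l).code x (t + b) = a}) := by
          ext x
          simp only [Set.mem_ofPred_eq, Set.mem_iUnion, Set.mem_preimage, Set.mem_inter_iff,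
            BlockCode.IsOffset]
          constructor
          · rintro ⟨b, ⟨h1, h2⟩, h3, h4, h5⟩
            exact ⟨b, ⟨h2, h3, h4⟩, h1, h5⟩
          · rintro ⟨b, ⟨h2, h3, h4⟩, h1, h5⟩
            exact ⟨b, ⟨h1, h2⟩, h3, h4, h5⟩
        rw [this]
        refine MeasurableSet.iUnion fun b => MeasurableSet.iUnion fun _ => ?_
        exact (measurePreserving_act hT _).measurable ((s l).measurableSet_good.inter
          ((s l).measObs_code.measurableSet fun w => w (t + b) = a))
      have : {x | Ψ x t = a} = (X₀ ∩ {x | ∀ᶠ l in atTop, x ∈ {x | ∃ b, (s l).IsOffset b x ∧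
          0 ≤ t + b ∧ t + b < (s l).N ∧ (s l).code (act T (-(b : ℤ)) x) (t + b) = a}}) ∪
          (X₀ᶜ ∩ {_x | y t = a}) := by
        ext x
        by_cases hx : x ∈ X₀
        · simp [hx, reads_eq_iff hK (hΨr x hx)]
        · simp [hx, hΨy x hx]
      rw [this]
      exact (hX₀m.inter (measurableSet_setOf_eventually_mem hl)).union
        (hX₀m.compl.inter (MeasurableSet.const _))
    intro S
    have : (fun x => Ψ x t) ⁻¹' S = ⋃ a ∈ S, {x | Ψ x t = a} := by
      ext x
      simp
    rw [this]
    exact (Set.toFinite S).measurableSet_biUnion fun a _ => hW a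
  · have h1 : ∀ᵐ x ∂μ, T x ∈ X₀ := hT.quasiMeasurePreserving.ae hX₀ae
    have h2 : ∀ᵐ x ∂μ, x ∈ X₀ ∩ T ⁻¹' X₀ := by
      filter_upwards [hX₀ae, h1] with x hx hx'
      exact ⟨hx, hx'⟩
    exact h2
  · intro x hx x' hx' hxx'
    have h1 := hΨr x hx.1
    rw [hxx'] at h1
    exact h1.injective hfac hsep (hΨr x' hx'.1)
  · intro x hx
    exact (hΨr x hx.1).shift hK (hΨr _ hx.2)

end

section

variable {X : Type*} [MeasurableSpace X] {μ : Measure X} [IsProbabilityMeasure μ]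

lemma infoEntropy_comp_le {ρ κ : Type*} [Fintype ρ] [Fintype κ] {P : X → ρ} (hP : MeasObs P)
    (f : ρ → κ) : infoEntropy μ (fun x => f (P x)) ≤ infoEntropy μ P := by
  rw [← sub_nonneg, infoEntropy_sub_eq_sum hP]
  refine Finset.sum_nonneg fun w _ => ?_
  rcases (measureReal_nonneg (μ := μ) (s := P ⁻¹' {w})).eq_or_lt with h0 | h0
  · rw [← h0, zero_mul]
  · refine mul_nonneg h0.le (sub_nonneg.2 (Real.log_le_log h0 (measureReal_mono ?_)))
    rintro x rfl
    rfl

lemma infoEntropy_le_log_card {ρ : Type*} [Fintype ρ] {P : X → ρ} (hP : MeasObs P) :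
    infoEntropy μ P ≤ Real.log (Fintype.card ρ) := by
  classical
  have : Nonempty X := nonempty_of_isProbabilityMeasure μ
  have : Nonempty ρ := this.map P
  have hcard : (0 : ℝ) < Fintype.card ρ := by exact_mod_cast Fintype.card_pos
  have hsum : ∑ w, μ.real (P ⁻¹' {w}) = 1 := by
    simpa using hP.sum_measureReal (μ := μ) Set.univ
  have := Real.concaveOn_negMulLog.le_map_sum (t := Finset.univ)
    (w := fun _ : ρ => (Fintype.card ρ : ℝ)⁻¹) (p := fun w => μ.real (P ⁻¹' {w}))
    (fun _ _ => by positivity) (by simp [hcard.ne']) (fun _ _ => measureReal_nonneg)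
  simp only [smul_eq_mul, ← Finset.mul_sum] at this
  rw [hsum, mul_one, Real.negMulLog, Real.log_inv, neg_mul_neg] at this
  exact le_of_mul_le_mul_left this (by positivity)

variable {T : X → X} (hT : Measurable T)
include hT

lemma infoEntropy_itinerary_le {ρ : Type*} [Fintype ρ] {P : X → ρ} (hP : MeasObs P) (n : ℕ) :
    infoEntropy μ (itinerary T P n) ≤ n * Real.log (Fintype.card ρ) := by
  refine (infoEntropy_le_log_card (hP.itinerary hT n)).trans_eq ?_
  simp

lemma isCoboundedUnder_infoEntropy {ρ : Type*} [Fintype ρ] {P : X → ρ} (hP : MeasObs P) :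
    IsCoboundedUnder (· ≥ ·) atTop fun n : ℕ => infoEntropy μ (itinerary T P n) / n := by
  refine IsBoundedUnder.isCoboundedUnder_ge (isBoundedUnder_of
    ⟨Real.log (Fintype.card ρ), fun n => ?_⟩)
  refine div_le_of_le_mul₀ (by positivity) (Real.log_natCast_nonneg _) ?_
  rw [mul_comm]
  exact infoEntropy_itinerary_le hT hP n

omit hT in
lemma isBoundedUnder_infoEntropy {ρ : Type*} [Fintype ρ] (T : X → X) (P : X → ρ) :
    IsBoundedUnder (· ≥ ·) atTop fun n : ℕ => infoEntropy μ (itinerary T P n) / n :=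
  isBoundedUnder_of ⟨0, fun _ => div_nonneg (infoEntropy_nonneg _) (Nat.cast_nonneg _)⟩

lemma entropyWrt_nonneg {ρ : Type*} [Fintype ρ] {P : X → ρ} (hP : MeasObs P) :
    0 ≤ entropyWrt μ T P :=
  le_liminf_of_le (isCoboundedUnder_infoEntropy hT hP) (Eventually.of_forall fun _ =>
    div_nonneg (infoEntropy_nonneg _) (Nat.cast_nonneg _))

lemma entropyWrt_comp_le {ρ κ : Type*} [Fintype ρ] [Fintype κ] {P : X → ρ} (hP : MeasObs P)
    (f : ρ → κ) : entropyWrt μ T (fun x => f (P x)) ≤ entropyWrt μ T P := by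
  refine liminf_le_liminf (Eventually.of_forall fun n => ?_)
    (isBoundedUnder_infoEntropy T fun x => f (P x))
    (isCoboundedUnder_infoEntropy hT hP)
  have h1 : infoEntropy μ (fun x (i : Fin n) => f (P (T^[i] x))) ≤
      infoEntropy μ (itinerary T P n) :=
    infoEntropy_comp_le (hP.itinerary hT n) fun v i => f (v i)
  exact div_le_div_of_nonneg_right h1 (Nat.cast_nonneg n)

omit hT in
lemma eventually_lt_infoEntropy {ρ : Type*} [Fintype ρ] {P : X → ρ} {a : ℝ}
    (ha : a < entropyWrt μ T P) : ∀ᶠ n : ℕ in atTop, n * a < infoEntropy μ (itinerary T P n) := by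
  filter_upwards [eventually_lt_of_lt_liminf ha (isBoundedUnder_infoEntropy T P),
    eventually_gt_atTop 0] with n hn hn0
  rwa [lt_div_iff₀ (by exact_mod_cast hn0), mul_comm] at hn

lemma frequently_infoEntropy_lt {ρ : Type*} [Fintype ρ] {P : X → ρ} (hP : MeasObs P) {a : ℝ}
    (ha : entropyWrt μ T P < a) : ∃ᶠ n : ℕ in atTop, infoEntropy μ (itinerary T P n) < n * a := by
  refine ((frequently_lt_of_liminf_lt (isCoboundedUnder_infoEntropy hT hP) ha).and_eventually
    (eventually_gt_atTop 0)).mono ?_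
  rintro n ⟨hn, hn0⟩
  have h1 : infoEntropy μ (itinerary T P n) / n < a := hn
  rwa [div_lt_iff₀ (by exact_mod_cast hn0), mul_comm] at h1

lemma ofReal_entropyWrt_le_ksEntropy {ρ : Type*} [Fintype ρ] {P : X → ρ} (hP : MeasObs P) :
    ENNReal.ofReal (entropyWrt μ T P) ≤ ksEntropy μ T := by
  have e := Fintype.equivFin ρ
  have h1 : entropyWrt μ T P ≤ entropyWrt μ T (fun x => e (P x)) := by
    simpa using entropyWrt_comp_le (μ := μ) hT (hP.comp e) e.symm
  exact (ENNReal.ofReal_le_ofReal h1).trans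
    (le_iSup_of_le _ (le_iSup₂_of_le (fun x => e (P x)) (fun s _ => hP.comp e s) le_rfl))

lemma exists_lt_entropyWrt {a : ℝ} (hfin : ksEntropy μ T ≠ ⊤) (ha : a < (ksEntropy μ T).toReal) :
    ∃ (k : ℕ) (P : X → Fin k), MeasObs P ∧ a < entropyWrt μ T P := by
  rcases lt_or_ge a 0 with h0 | h0
  · have hc : MeasObs fun _ : X => (0 : Fin 1) := fun s => MeasurableSet.const _
    exact ⟨1, _, hc, h0.trans_le (entropyWrt_nonneg hT hc)⟩
  · have h1 : ENNReal.ofReal a < ksEntropy μ T := (ENNReal.ofReal_lt_iff_lt_toReal h0 hfin).2 ha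
    simp only [ksEntropy, lt_iSup_iff] at h1
    obtain ⟨k, P, hP, h2⟩ := h1
    exact ⟨k, P, fun s => hP (Set.toFinite s).measurableSet, (ENNReal.ofReal_lt_ofReal_iff'.1 h2).1⟩

/-- A refining sequence of finite partitions which separates points and exhausts the entropy. -/
lemma exists_partitions [MeasurableSpace.CountablySeparated X] (hfin : ksEntropy μ T ≠ ⊤)
    {δ : ℕ → ℝ} (hδ : ∀ n, 0 < δ n) :
    ∃ (ρ : ℕ → Type) (_ : ∀ n, Fintype (ρ n)) (P : ∀ n, X → ρ n) (f : ∀ n, ρ (n + 1) → ρ n),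
      (∀ n, MeasObs (P n)) ∧ (∀ n x, P n x = f n (P (n + 1) x)) ∧ Fintype.card (ρ 0) = 1 ∧
      (∀ x x', (∀ n, P n x = P n x') → x = x') ∧
      (∀ n, entropyWrt μ T (P n) ≤ (ksEntropy μ T).toReal) ∧
      ∀ n, (ksEntropy μ T).toReal - δ n < entropyWrt μ T (P (n + 1)) := by
  choose k Q hQm hQ using fun n => exists_lt_entropyWrt hT hfin
    (sub_lt_self (ksEntropy μ T).toReal (hδ n))
  obtain ⟨B, hB, hBinj⟩ := MeasurableSpace.measurable_injection_nat_bool_of_countablySeparated X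
  have hPm : ∀ n, MeasObs fun x => fun i : Fin n => (Q i x, B x i) := fun n =>
    MeasObs.pi fun i => (hQm i).prodMk fun s =>
      (measurable_pi_apply (i : ℕ)).comp hB (Set.toFinite s).measurableSet
  refine ⟨fun n => ∀ i : Fin n, Fin (k i) × Bool, fun n => inferInstance,
    fun n x i => (Q i x, B x i), fun n v i => v i.castSucc, hPm, fun n x => rfl, ?_, ?_, ?_, ?_⟩
  · simp
  · intro x x' hx
    refine hBinj (funext fun n => ?_)
    have := congrFun (hx (n + 1)) (Fin.last n)
    exact (Prod.ext_iff.1 this).2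
  · intro n
    rw [← ENNReal.ofReal_le_iff_le_toReal hfin]
    exact ofReal_entropyWrt_le_ksEntropy hT (hPm n)
  · intro n
    exact (hQ n).trans_le (entropyWrt_comp_le hT (hPm (n + 1)) fun v => (v (Fin.last n)).1)

end

section

variable {X : Type} [MeasurableSpace X] {μ : Measure X} {T : X ≃ᵐ X} {A : Type}
  {Y : Set (ℤ → A)} {g : ℕ → ℕ} {h : ℝ}

/-- An ergodic system of entropy less than `h` embeds into the subshift `Y`. -/
theorem SpecSubshift.exists_embedding [Finite A] [StandardBorelSpace X] [IsProbabilityMeasure μ]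
    [NullSingletonClass μ] (hT : Ergodic T μ) (hY : SpecSubshift Y g h)
    (hfin : ksEntropy μ T ≠ ⊤) (hlt : (ksEntropy μ T).toReal < h) :
    ∃ Ψ : X → ℤ → A, (∀ i, MeasObs fun x => Ψ x i) ∧ (∀ x, Ψ x ∈ Y) ∧
      ∃ X' : Set X, MeasurableSet X' ∧ μ X'ᶜ = 0 ∧ Set.InjOn Ψ X' ∧
        ∀ x ∈ X', Ψ (T x) = fun i => Ψ x (i + 1) := by
  have hTm : Measurable (T : X → X) := T.measurable
  have hT0 : 0 ≤ (ksEntropy μ T).toReal := ENNReal.toReal_nonneg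
  have hh := hY.rate_pos
  obtain ⟨Δ, hΔ0, hΔ⟩ : ∃ Δ : ℝ, 0 < Δ ∧ h = (ksEntropy μ T).toReal + Δ :=
    ⟨h - (ksEntropy μ T).toReal, by linarith, by ring⟩
  generalize hhT : (ksEntropy μ T).toReal = hT' at *
  let θ : ℕ → ℝ := fun n => n.casesOn (1 - Δ / (2 * h)) fun n => (1 / 2) ^ (n + 1)
  let hP : ℕ → ℝ := fun n => n.casesOn (Δ / 8) fun _ => hT' + Δ / 4
  let r : ℕ → ℝ := fun n => n.casesOn (hT' + Δ / 4) fun n => (1 / 2) ^ (n + 1) * (Δ / 4)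
  let c : ℕ → ℝ := fun n => n.casesOn (Δ / 8) fun n => (1 / 2) ^ (n + 1) * (Δ / 4)
  have hθ : 0 < Δ / (2 * h) ∧ Δ / (2 * h) < 1 := by
    constructor
    · positivity
    · rw [div_lt_one (by positivity)]
      linarith
  have hpow0 : ∀ n : ℕ, (0 : ℝ) < (1 / 2) ^ (n + 1) := fun n => by positivity
  have hpow1 : ∀ n : ℕ, (1 / 2 : ℝ) ^ (n + 1) < 1 := fun n =>
    pow_lt_one₀ (by norm_num) (by norm_num) (Nat.succ_ne_zero n)
  have hr : ∀ n, 0 < r n := by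
    rintro (_ | n)
    · change 0 < hT' + Δ / 4
      positivity
    · have := hpow0 n
      change 0 < (1 / 2 : ℝ) ^ (n + 1) * (Δ / 4)
      positivity
  have hθ0 : ∀ n, 0 < θ n := by
    rintro (_ | n)
    · exact sub_pos.2 hθ.2
    · exact hpow0 n
  obtain ⟨ρ, _, P, f, hPm, hf, hP0, hsep, hle, hge⟩ :=
    exists_partitions (μ := μ) hTm hfin (δ := fun n => r (n + 1) / 2) fun n => half_pos (hr (n + 1))
  rw [hhT] at hle hge
  have hfreq : ∀ n a, hT' < a → ∃ᶠ m : ℕ in atTop, infoEntropy μ (itinerary T (P n) m) < m * a :=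
    fun n a ha => frequently_infoEntropy_lt hTm (hPm n) ((hle n).trans_lt ha)
  have ⟨s, hs⟩ := exists_blockCode_sequence (ρ := ρ) (P := P) hT hY hPm f hf
    (fun x x' => (Fintype.card_le_one_iff_subsingleton.1 hP0.le).elim _ _) (hP := hP) (r := r)
    (c := c) (θ := θ) (ε := fun n => (1 / 2) ^ (n + 1)) ?_ ?_ ?_ hr ?_ hθ0 ?_ ?_ hpow0 hpow1
  · refine exists_embedding_of_blockCodes (s := s)
      (η := fun n => n.casesOn 1 fun n => (1 / 2) ^ (n + 1) + 2 * (θ n + (1 / 2) ^ (n + 1)))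
      hT.toMeasurePreserving hY ?_ (fun n => (hs n).2.1) (fun n => (hs n).2.2.2.2) ?_ hsep ?_ ?_
    · rintro (_ | _ | n)
      · omega
      · omega
      · have h1 := (hs (n + 1)).2.1
        have h2 := (hs n).1
        omega
    · intro n x x' h
      rw [hf n x, hf n x', h]
    · have hgeom : Summable fun n : ℕ => (1 / 2 : ℝ) ^ (n + 1) :=
        (summable_nat_add_iff 1).2 summable_geometric_two
      have hθs : Summable θ := (summable_nat_add_iff 1).1 hgeom
      exact (summable_nat_add_iff 1).1 (hgeom.add ((hθs.add hgeom).mul_left 2))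
    · rintro (_ | n)
      · exact (sub_self (1 : ℝ)).trans_le measureReal_nonneg
      · obtain ⟨-, -, h3, h4, -⟩ := hs n
        have h5 := (s (n + 1)).one_sub_le_measureReal_deep hT.toMeasurePreserving
          (add_pos (hθ0 n) (hpow0 n)).le h3 h4
        change 1 - ((1 / 2) ^ (n + 1) + 2 * (θ n + (1 / 2) ^ (n + 1))) ≤ _
        linarith
  · rintro (_ | n)
    · change 0 ≤ Δ / 8
      positivity
    · change 0 ≤ hT' + Δ / 4
      positivity
  · rintro (_ | n)
    · refine ⟨1, one_pos, (infoEntropy_itinerary_le hTm (hPm 0) 1).trans_lt ?_⟩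
      rw [hP0]
      change _ < _ * (Δ / 8)
      simp [hΔ0]
    · obtain ⟨m, hm, hm0⟩ := ((hfreq (n + 1) (hT' + Δ / 4) (by linarith)).and_eventually
        (eventually_gt_atTop 0)).exists
      exact ⟨m, hm0, hm⟩
  · rintro (_ | n)
    · obtain ⟨m, hm, hm0⟩ := ((hfreq 1 (hT' + Δ / 4) (by linarith)).and_eventually
        (eventually_gt_atTop 0)).exists
      exact ⟨m, hm0, (sub_le_self _ (infoEntropy_nonneg _)).trans_lt hm⟩
    · obtain ⟨m, hm, hm1, hm0⟩ := ((hfreq (n + 2) (hT' + r (n + 1) / 2)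
        (by linarith [hr (n + 1)])).and_eventually
        ((eventually_lt_infoEntropy (hge n)).and (eventually_gt_atTop 0))).exists
      refine ⟨m, hm0, ?_⟩
      linarith
  · rintro (_ | n)
    · change 0 < Δ / 8
      positivity
    · have := hpow0 n
      change 0 < (1 / 2 : ℝ) ^ (n + 1) * (Δ / 4)
      positivity
  · rintro (_ | n)
    · exact sub_lt_self _ hθ.1
    · exact hpow1 n
  · rintro (_ | n)
    · change (1 - Δ / (2 * h)) * (Δ / 8) + (hT' + Δ / 4) + Δ / 8 < (1 - Δ / (2 * h)) * h
      have h1 : Δ / (2 * h) * h = Δ / 2 := by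
        field_simp
      nlinarith [hθ.1]
    · change (1 / 2 : ℝ) ^ (n + 1) * (hT' + Δ / 4) + (1 / 2 : ℝ) ^ (n + 1) * (Δ / 4) +
        (1 / 2 : ℝ) ^ (n + 1) * (Δ / 4) < (1 / 2 : ℝ) ^ (n + 1) * h
      nlinarith [mul_pos (hpow0 n) hΔ0]

end

section

variable {A : Type*} [Finite A] {Y : Set (ℤ → A)}

lemma one_le_wordCount (hne : Y.Nonempty) (n : ℕ) : 1 ≤ wordCount Y n :=
  (Set.ncard_pos (Set.toFinite _)).2 (hne.image _)

lemma subadditive_log_wordCount (hne : Y.Nonempty)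
    (hY : ∀ y ∈ Y, ∀ j : ℤ, (fun i => y (i + j)) ∈ Y) :
    Subadditive fun n => Real.log (wordCount Y n) := by
  intro m n
  have h1 : wordCount Y (m + n) ≤ wordCount Y m * wordCount Y n := by
    refine wordCount_mul_le (S := Y) subset_rfl hY 0 m fun y _ z _ h1 h2 i hi => ?_
    rcases lt_or_ge i m with him | him
    · simpa using h1 i him
    · have := h2 (i - m) (by omega)
      rwa [show m + (i - m) = i by omega] at this
  have hpos : ∀ n, (0 : ℝ) < wordCount Y n := fun n => by
    exact_mod_cast one_le_wordCount hne n
  rw [← Real.log_mul (hpos m).ne' (hpos n).ne']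
  exact Real.log_le_log (hpos _) (by exact_mod_cast h1)

/-- The number of words of a shift-invariant set grows at an exponential rate. -/
lemma exists_wordCount_rate (hne : Y.Nonempty)
    (hY : ∀ y ∈ Y, ∀ j : ℤ, (fun i => y (i + j)) ∈ Y) :
    ∃ h : ℝ, (∀ n : ℕ, Real.exp (n * h) ≤ wordCount Y n) ∧
      ∀ η : ℝ, 0 < η → ∃ C : ℝ, 1 ≤ C ∧ ∀ n : ℕ, wordCount Y n ≤ C * Real.exp (n * (h + η)) := by
  have hsub := subadditive_log_wordCount hne hY
  have hpos : ∀ n, (0 : ℝ) < wordCount Y n := fun n => by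
    exact_mod_cast one_le_wordCount hne n
  have hbdd : BddBelow (Set.range fun n : ℕ => Real.log (wordCount Y n) / n) := by
    refine ⟨0, ?_⟩
    rintro _ ⟨n, rfl⟩
    exact div_nonneg (Real.log_natCast_nonneg _) (Nat.cast_nonneg _)
  have h0 : 0 ≤ hsub.lim := ge_of_tendsto' (hsub.tendsto_lim hbdd) fun n =>
    div_nonneg (Real.log_natCast_nonneg _) (Nat.cast_nonneg _)
  refine ⟨hsub.lim, fun n => ?_, fun η hη => ?_⟩
  · rw [← Real.le_log_iff_exp_le (hpos n)]
    rcases Nat.eq_zero_or_pos n with rfl | hn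
    · simpa using Real.log_natCast_nonneg _
    · have := hsub.lim_le_div hbdd hn.ne'
      rwa [le_div_iff₀ (by exact_mod_cast hn), mul_comm] at this
  · obtain ⟨N, hN⟩ := eventually_atTop.1
      ((hsub.tendsto_lim hbdd).eventually_lt_const (lt_add_of_pos_right hsub.lim hη))
    obtain ⟨C, hC⟩ := ((Set.finite_Iio (N + 1)).image fun n => (wordCount Y n : ℝ)).bddAbove
    refine ⟨max 1 C, le_max_left _ _, fun n => ?_⟩
    rcases lt_or_ge n (N + 1) with hn | hn
    · have h1 : (wordCount Y n : ℝ) ≤ C := hC ⟨n, hn, rfl⟩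
      have h2 : 1 ≤ Real.exp (n * (hsub.lim + η)) := Real.one_le_exp (by positivity)
      have h3 := le_max_right 1 C
      have h4 := le_max_left 1 C
      nlinarith
    · have h1 := hN n (by omega)
      rw [div_lt_iff₀ (by exact_mod_cast (by omega : 0 < n)), mul_comm,
        Real.log_lt_iff_lt_exp (hpos n)] at h1
      exact h1.le.trans (le_mul_of_one_le_left (Real.exp_pos _).le (le_max_left _ _))

end

section

variable {k : ℕ} {Y : Set (ℤ → Fin k)}

lemma shift_zpow_apply {σ : ↥Y ≃ ↥Y}
    (hσ : ∀ x : ↥Y, (σ x : ℤ → Fin k) = fullShift (x : ℤ → Fin k)) (j : ℤ) (x : ↥Y) (i : ℤ) :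
    ((σ ^ j) x : ℤ → Fin k) i = (x : ℤ → Fin k) (i + j) := by
  induction j generalizing i with
  | zero => simp
  | succ n ih =>
    rw [add_comm, zpow_add, zpow_one, Equiv.Perm.mul_apply, hσ, fullShift, ih]
    ring_nf
  | pred n ih =>
    have h1 : ((σ ^ (-(n : ℤ))) x : ℤ → Fin k) (i - 1) =
        ((σ ^ (-(n : ℤ) - 1)) x : ℤ → Fin k) i := by
      have h2 : (σ ^ (-(n : ℤ))) x = σ ((σ ^ (-(n : ℤ) - 1)) x) := by
        rw [← Equiv.Perm.mul_apply, ← zpow_one_add, add_sub_cancel]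
      rw [h2, hσ, fullShift, sub_add_cancel]
    rw [← h1, ih]
    ring_nf

lemma exists_agree_mem_uniformity {U : Set (↥Y × ↥Y)} (hU : U ∈ uniformity ↥Y) :
    ∃ r : ℕ, ∀ x y : ↥Y, (∀ i : ℤ, |i| ≤ r → (x : ℤ → Fin k) i = (y : ℤ → Fin k) i) →
      (x, y) ∈ U := by
  by_contra! hcon
  choose x y hxy hU' using hcon
  have h1 : Tendsto (fun r => (x r, y r)) atTop (uniformity ↥Y) := by
    rw [uniformity_subtype, tendsto_comap_iff, Pi.uniformity, tendsto_iInf]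
    intro i
    rw [tendsto_comap_iff]
    refine (tendsto_diag_uniformity (fun r => (x r : ℤ → Fin k) i) atTop).congr' ?_
    filter_upwards [eventually_ge_atTop i.natAbs] with r hr
    have := hxy r i (by rw [Int.abs_eq_natAbs]; omega)
    simp [this]
  obtain ⟨r, hr⟩ := (h1.eventually hU).exists
  exact hU' r hr

lemma topEntropy_le_of_wordCount_le (hne : Y.Nonempty) {σ : ↥Y ≃ ↥Y}
    (hσ : ∀ x : ↥Y, (σ x : ℤ → Fin k) = fullShift (x : ℤ → Fin k)) {a C : ℝ}
    (hC : ∀ n : ℕ, wordCount Y n ≤ C * Real.exp (n * a)) : topEntropy σ ≤ (a : EReal) := by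
  classical
  refine iSup₂_le fun U hU => ?_
  obtain ⟨r, hr⟩ := exists_agree_mem_uniformity hU
  have hcover : ∀ n, Dynamics.coverMincard σ Set.univ U n ≤ (wordCount Y (n + 2 * r + 1) : ℕ∞) := by
    intro n
    have : Nonempty ↥Y := hne.to_subtype
    let F : ↥Y → Fin (n + 2 * r + 1) → Fin k := fun x => firstLetters _ ((σ ^ (-(r : ℤ))) x).1
    let W := (firstLetters (n + 2 * r + 1) '' Y).toFinite.toFinset
    have hF : ∀ x, F x ∈ W := fun x => (Set.Finite.mem_toFinset _).2 ⟨_, Subtype.coe_prop _, rfl⟩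
    have hcov : Dynamics.IsDynCoverOf σ Set.univ U n (W.image (Function.invFun F) : Finset ↥Y) := by
      intro x _
      refine ⟨Function.invFun F (F x), ?_, ?_⟩
      · exact Finset.mem_coe.2 (Finset.mem_image_of_mem _ (hF x))
      · have hx : F (Function.invFun F (F x)) = F x := Function.invFun_eq ⟨x, rfl⟩
        rw [Dynamics.mem_dynEntourage]
        intro j hj
        refine hr _ _ fun i hi => ?_
        have hi' := abs_le.1 hi
        have := congrFun hx ⟨(i + j + r).toNat, by omega⟩
        simp only [F, firstLetters, shift_zpow_apply hσ] at this
        rw [Int.toNat_of_nonneg (by omega), add_neg_cancel_right] at this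
        have hpow : ∀ z, ((σ^[j] z : ↥Y) : ℤ → Fin k) i = (z : ℤ → Fin k) (i + j) := fun z => by
          rw [← shift_zpow_apply hσ, zpow_natCast, ← Equiv.Perm.iterate_eq_pow]
        rw [hpow, hpow, this]
    refine hcov.coverMincard_le_card.trans ?_
    rw [wordCount, Set.ncard_eq_toFinset_card _ (Set.toFinite _)]
    exact_mod_cast Finset.card_image_le
  rw [Dynamics.coverEntropyEntourage, ← ExpGrowth.expGrowthSup_exp (a := (a : EReal))]
  refine ExpGrowth.expGrowthSup_le_of_eventually_le
    (b := ENNReal.ofReal (C * Real.exp ((2 * r + 1) * a))) ENNReal.ofReal_ne_top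
    (Eventually.of_forall fun n => ?_)
  have h1 : (a : EReal) * (n : ℕ) = ((a * n : ℝ) : EReal) := by
    push_cast
    rfl
  have h2 : C * Real.exp ((n + 2 * r + 1 : ℕ) * a) =
      C * Real.exp ((2 * r + 1) * a) * Real.exp (a * n) := by
    rw [mul_assoc, ← Real.exp_add]
    push_cast
    ring_nf
  rw [h1, EReal.exp_coe, ← ENNReal.ofReal_mul' (Real.exp_pos _).le, ← h2]
  have h3 := ENNReal.ofReal_le_ofReal (hC (n + 2 * r + 1))
  rw [ENNReal.ofReal_natCast] at h3
  exact (ENat.toENNReal_mono (hcover n)).trans (by simpa using h3)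

end

section

variable {k : ℕ} {Y : Set (ℤ → Fin k)}

lemma apply_eq_of_dist_lt {x y : ℤ → Fin k} {i : ℤ}
    (h : dist x y < 2⁻¹ ^ Encodable.encode i) : x i = y i := by
  by_contra hne
  have h1 : 1 ≤ dist (x i) (y i) := by
    change (1 : ℝ) ≤ dist (((x i : ℕ) : ℝ)) (((y i : ℕ) : ℝ))
    rw [Nat.dist_cast_real, Nat.dist_eq]
    have h2 : ((x i : ℕ) : ℤ) - (y i : ℕ) ≠ 0 := fun h => hne (Fin.ext (by omega))
    exact_mod_cast Int.one_le_abs h2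
  have h2 := PiCountable.min_dist_le_dist_pi x y i
  rw [min_eq_left ((pow_le_one₀ (by norm_num) (by norm_num)).trans h1)] at h2
  exact absurd h (not_lt.2 h2)

lemma exists_spec_of_isGapFunction {σ : ↥Y ≃ ↥Y}
    (hσ : ∀ x : ↥Y, (σ x : ℤ → Fin k) = fullShift (x : ℤ → Fin k)) {L : ℕ → ℕ}
    (hL : IsGapFunction σ (2⁻¹ ^ (Encodable.encode (0 : ℤ) + 1)) L) (s : Finset ℤ) (l : ℤ → ℕ)
    (y : ℤ → ℤ → Fin k) (hl : ∀ i ∈ s, 0 < l i) (hy : ∀ i ∈ s, y i ∈ Y)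
    (hgap : ∀ i ∈ s, ∀ j ∈ s, i < j → i + l i + L (l j) ≤ j) :
    ∃ z ∈ Y, ∀ i ∈ s, ∀ t : ℕ, t < l i → z (i + t) = y i t := by
  obtain ⟨hmono, -, hspec⟩ := hL
  let e := s.orderEmbOfFin rfl
  have hes : ∀ i, e i ∈ s := fun i => s.orderEmbOfFin_mem rfl i
  obtain ⟨z, hz⟩ := hspec s.card (fun i => (σ ^ (-e i)) ⟨y (e i), hy _ (hes i)⟩) (fun i => e i)
    (fun i => e i + l (e i) - 1) (fun i => by have := hl _ (hes i); omega) fun i j hij => by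
      have h1 : e i < e j := e.strictMono (Fin.lt_def.2 (by omega))
      have h2 := hgap _ (hes i) _ (hes j) h1
      have h3 : L (e j + l (e j) - 1 - e j).toNat ≤ L (l (e j)) := hmono (by omega)
      have h4 := hl _ (hes i)
      omega
  refine ⟨z, z.2, fun i hi t ht => ?_⟩
  obtain ⟨m, rfl⟩ : ∃ m, e m = i := by
    have : i ∈ Set.range e := by
      rw [Finset.range_orderEmbOfFin]
      exact hi
    exact this
  have h1 := hz m (e m + t) (by omega) (by omega)
  have h2 : dist ((σ ^ (e m + t)) z : ℤ → Fin k)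
      ((σ ^ (e m + t)) ((σ ^ (-e m)) ⟨y (e m), hy _ (hes m)⟩) : ℤ → Fin k) <
      2⁻¹ ^ Encodable.encode (0 : ℤ) :=
    lt_of_le_of_lt h1 (pow_lt_pow_right_of_lt_one₀ (by norm_num) (by norm_num) (Nat.lt_succ_self _))
  have h3 := apply_eq_of_dist_lt h2
  rwa [shift_zpow_apply hσ, shift_zpow_apply hσ, shift_zpow_apply hσ, zero_add,
    add_neg_cancel_comm] at h3

lemma mem_of_agree (hcl : IsClosed Y) {z : ℤ → Fin k}
    (hz : ∀ r : ℕ, ∃ y ∈ Y, ∀ i : ℤ, |i| ≤ r → y i = z i) : z ∈ Y := by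
  choose y hyY hyz using hz
  have h1 : Tendsto y atTop (nhds z) := by
    rw [tendsto_pi_nhds]
    intro i
    refine tendsto_const_nhds.congr' ?_
    filter_upwards [eventually_ge_atTop i.natAbs] with r hr
    exact (hyz r i (by rw [Int.abs_eq_natAbs]; omega)).symm
  exact hcl.mem_of_tendsto h1 (Eventually.of_forall hyY)

lemma exists_specSubshift (hne : Y.Nonempty) (hcl : IsClosed Y) {σ : ↥Y ≃ ↥Y}
    (hσ : ∀ x : ↥Y, (σ x : ℤ → Fin k) = fullShift (x : ℤ → Fin k)) (hspec : AlmostWeakSpec σ)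
    {a : EReal} (ha0 : 0 ≤ a) (ha : a < topEntropy σ) :
    ∃ (g : ℕ → ℕ) (h : ℝ), SpecSubshift Y g h ∧ a < h := by
  have hshift : ∀ y ∈ Y, ∀ j : ℤ, (fun i => y (i + j)) ∈ Y := by
    intro y hy j
    have : ((σ ^ j) ⟨y, hy⟩ : ℤ → Fin k) = fun i => y (i + j) :=
      funext fun i => shift_zpow_apply hσ j _ i
    rw [← this]
    exact Subtype.coe_prop _
  obtain ⟨h, hle, hge⟩ := exists_wordCount_rate hne hshift
  obtain ⟨L, hL, hL0⟩ := hspec _ (by positivity : (0 : ℝ) < 2⁻¹ ^ (Encodable.encode (0 : ℤ) + 1))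
  obtain ⟨b, hab, hb⟩ := EReal.lt_iff_exists_real_btwn.1 ha
  have hbh : b ≤ h := by
    refine le_of_forall_pos_le_add fun η hη => ?_
    obtain ⟨C, -, hC⟩ := hge η hη
    exact_mod_cast hb.le.trans (topEntropy_le_of_wordCount_le hne hσ hC)
  have hah : a < h := hab.trans_le (by exact_mod_cast hbh)
  refine ⟨L, h, ⟨hshift, fun z hz => mem_of_agree hcl hz, exists_spec_of_isGapFunction hσ hL, hL0,
    by exact_mod_cast ha0.trans_lt hah, hle, hge⟩, hah⟩

lemma measurable_of_measObs {X : Type*} [MeasurableSpace X] {Ψ : X → ℤ → Fin k}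
    (hΨ : ∀ i, MeasObs fun x => Ψ x i) : Measurable Ψ := by
  have : BorelSpace (Fin k) := ⟨by
    refine le_antisymm (fun s _ => ?_) fun s _ => MeasurableSet.of_discrete
    exact MeasurableSpace.measurableSet_generateFrom (isOpen_discrete s)⟩
  have h1 : @Measurable _ _ _ MeasurableSpace.pi Ψ :=
    measurable_pi_lambda _ fun i s _ => hΨ i s
  have h2 : (MeasurableSpace.pi : MeasurableSpace (ℤ → Fin k)) = borel _ :=
    (inferInstance : @BorelSpace (ℤ → Fin k) _ MeasurableSpace.pi).measurable_eq
  rwa [h2] at h1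

end

/-- **A subshift containing almost-weak-specification subshifts of entropy arbitrarily close to
its own topological entropy is universal.** -/
theorem subshift_with_dense_awsSubshifts_universal (k : ℕ) (Xs : Set (ℤ → Fin k))
    (hne : Xs.Nonempty) (hcl : IsClosed Xs) (hinv : fullShift '' Xs = Xs)
    (σX : ↥Xs ≃ ↥Xs) (hσ : ∀ x : ↥Xs, (σX x : ℤ → Fin k) = fullShift (x : ℤ → Fin k))
    (happrox : ∀ ε : ℝ, 0 < ε → ∃ Xs' : Set (ℤ → Fin k), Xs' ⊆ Xs ∧ Xs'.Nonempty ∧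
      IsClosed Xs' ∧ fullShift '' Xs' = Xs' ∧
      ∃ σ' : ↥Xs' ≃ ↥Xs', (∀ x : ↥Xs', (σ' x : ℤ → Fin k) = fullShift (x : ℤ → Fin k)) ∧
        AlmostWeakSpec σ' ∧
        topEntropy (⇑σX) - (ε : EReal) < topEntropy (⇑σ')) :
    Universal (⇑σX) := by
  intro X _ μ T _ _ hμ hT hent
  have : NullSingletonClass μ := hμ
  obtain ⟨b, hb1, hb2⟩ := EReal.lt_iff_exists_real_btwn.1 hent
  obtain ⟨c, hc1, hc2⟩ := EReal.lt_iff_exists_real_btwn.1 hb2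
  obtain ⟨Y, hYX, hYne, hYcl, -, σ', hσ', hspec, hlt⟩ :=
    happrox (c - b) (sub_pos.2 (by exact_mod_cast hc1))
  have hbY : (b : EReal) < topEntropy σ' := by
    refine lt_of_le_of_lt ?_ hlt
    refine EReal.le_sub_iff_add_le (Or.inl (EReal.coe_ne_bot _)) (Or.inl (EReal.coe_ne_top _)) |>.2 ?_
    rw [← EReal.coe_add, add_sub_cancel]
    exact hc2.le
  obtain ⟨g, h, hY, hh⟩ := exists_specSubshift hYne hYcl hσ' hspec
    (by positivity : (0 : EReal) ≤ ksEntropy μ T) (hb1.trans hbY)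
  have hfin : ksEntropy μ T ≠ ⊤ := by
    intro htop
    rw [htop] at hh
    exact absurd hh (by simp)
  have hreal : (ksEntropy μ T).toReal < h := by
    rw [← EReal.coe_lt_coe_iff, EReal.coe_ennreal_toReal hfin]
    exact hh
  obtain ⟨Ψ, hΨm, hΨY, X', hX'm, hX', hinj, heq⟩ := hY.exists_embedding hT hfin hreal
  refine ⟨fun x => ⟨Ψ x, hYX (hΨY x)⟩, (measurable_of_measObs hΨm).subtype_mk, X', hX'm, hX',
    fun x hx x' hx' hxx' => hinj hx hx' (congrArg Subtype.val hxx'), fun x hx => ?_⟩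
  apply Subtype.ext
  rw [hσ]
  exact heq x hx
end

section
/- Let S be a self-homeomorphism of a compact metric space Y preserving an ergodic measure ν with 0 < h_ν(S) < ∞. Let α ∈ (0,1), and let η > 0 be such that the lower Brin–Katok local entropy satisfies h̲^BK_ν(4η) > 0 and the lower Downarowicz–Weiss return-time exponent satisfies h̲^DW_ν(4η) > 0. Then for all sufficiently large integers M there exists a point y_mark ∈ Y such that: (1) d_0^{2M}(S^i y_mark, S^{6M} y_mark) ≥ 4η for all i ∈ {0, …, 6M−1}; (2) ν(B_0^{2M}(y_mark, 4η)) < α/M; and (3) ν(B_0^{2M}(S^{6M} y_mark, 4η)) < α/M. -/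
open MeasureTheory Filter Set
open scoped ENNReal NNReal

/-- The dynamical (Bowen) distance `d_m^n(y, z) = max_{m ≤ j < n} d(S^j y, S^j z)`. -/
noncomputable def dynDist {Y : Type*} [MetricSpace Y] (S : Y ≃ Y) (m n : ℤ) (y z : Y) : ℝ≥0 :=
  (Finset.Ico m n).sup fun j => nndist ((S ^ j) y) ((S ^ j) z)

/-- The Bowen ball `B_m^n(y, δ) = {z : d_m^n(y, z) < δ}`. -/
def bowenBall {Y : Type*} [MetricSpace Y] (S : Y ≃ Y) (m n : ℤ) (y : Y) (δ : ℝ) : Set Y :=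
  {z | (dynDist S m n y z : ℝ) < δ}

/-- The lower Brin–Katok local entropy
`h̲^BK_ν(z, η) = liminf_n −(1/n) log ν(B_0^n(z, η))`. -/
noncomputable def lowerBKEntropy {Y : Type*} [MetricSpace Y] [MeasurableSpace Y] (S : Y ≃ Y)
    (ν : Measure Y) (z : Y) (η : ℝ) : ℝ :=
  Filter.atTop.liminf fun n : ℕ =>
    -Real.log ((ν (bowenBall S 0 (n : ℤ) z η)).toReal) / n

/-- The first return time `min {i > 0 : d_0^n(z, S^i z) < η}`. -/
noncomputable def firstReturn {Y : Type*} [MetricSpace Y] (S : Y ≃ Y) (n : ℕ) (z : Y)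
    (η : ℝ) : ℕ :=
  sInf {i : ℕ | 0 < i ∧ (dynDist S 0 (n : ℤ) z ((S ^ (i : ℤ)) z) : ℝ) < η}

/-- The lower Downarowicz–Weiss return-time exponent
`h̲^DW_ν(z, η) = liminf_n (1/n) log min{i > 0 : d_0^n(z, S^i z) < η}`. -/
noncomputable def lowerDWEntropy {Y : Type*} [MetricSpace Y] (S : Y ≃ Y) (z : Y) (η : ℝ) : ℝ :=
  Filter.atTop.liminf fun n : ℕ => Real.log (firstReturn S n z η) / n

/-- A positive real `liminf` forces the sequence to be eventually bounded below by a positive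
constant. -/
lemma exists_pos_eventually_le_of_liminf_pos {u : ℕ → ℝ} (h : 0 < atTop.liminf u) :
    ∃ a > 0, ∀ᶠ n in atTop, a ≤ u n := by
  rw [liminf_eq] at h
  by_contra! hc
  refine h.not_ge (Real.sSup_nonpos fun a ha => ?_)
  by_contra! hpos
  exact hc a hpos (ha.mono fun n hn => not_lt.2 hn)

/-- If almost every point is eventually outside of `A n`, then `μ (A n)` is eventually small. -/
lemma eventually_measure_lt_of_ae_eventually_notMem {X : Type*} [MeasurableSpace X]
    (μ : Measure X) [IsFiniteMeasure μ] {A : ℕ → Set X} (hA : ∀ n, MeasurableSet (A n))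
    (h : ∀ᵐ x ∂μ, ∀ᶠ n in atTop, x ∉ A n) {ε : ℝ≥0∞} (hε : 0 < ε) :
    ∀ᶠ n in atTop, μ (A n) < ε := by
  have ht : Tendsto (fun n => μ (A n)) atTop (nhds (μ ∅)) := by
    refine tendsto_measure_of_ae_tendsto_indicator_of_isFiniteMeasure atTop
      MeasurableSet.empty hA ?_
    filter_upwards [h] with x hx
    filter_upwards [hx] with n hn
    simp [hn]
  rw [measure_empty] at ht
  exact ht.eventually_lt_const hε

/-- Markov's inequality for the number of visits of an orbit segment to a set. -/
lemma mul_measure_le_card_visits_le {X : Type*} [MeasurableSpace X] {μ : Measure X} {T : X → X}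
    (hT : MeasurePreserving T μ μ) {B : Set X} (hB : MeasurableSet B) (N k : ℕ) :
    (k : ℝ≥0∞) * μ {x | (k : ℝ≥0∞) ≤ ∑ j ∈ Finset.range N, B.indicator 1 (T^[j] x)} ≤
      N * μ B := by
  have hmeas : ∀ j, Measurable fun x => B.indicator (1 : X → ℝ≥0∞) (T^[j] x) := fun j =>
    (measurable_one.indicator hB).comp (hT.measurable.iterate j)
  calc _ ≤ ∫⁻ x, ∑ j ∈ Finset.range N, B.indicator 1 (T^[j] x) ∂μ :=
        mul_meas_ge_le_lintegral (Finset.measurable_fun_sum _ fun j _ => hmeas j) _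
    _ = ∑ j ∈ Finset.range N, μ B := by
        rw [lintegral_finsetSum _ fun j _ => hmeas j]
        refine Finset.sum_congr rfl fun j _ => ?_
        rw [(hT.iterate j).lintegral_comp (measurable_one.indicator hB), lintegral_indicator_one hB]
    _ = _ := by simp

lemma Homeomorph.continuous_toEquiv_zpow {Y : Type*} [TopologicalSpace Y] (S : Y ≃ₜ Y) (j : ℤ) :
    Continuous ⇑(S.toEquiv ^ j : Equiv.Perm Y) := by
  have key : ∀ (R : Y ≃ₜ Y) (n : ℕ), Continuous ⇑(R.toEquiv ^ n : Equiv.Perm Y) := by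
    intro R n
    rw [Equiv.Perm.coe_pow]
    exact R.continuous.iterate n
  cases j with
  | ofNat n => simpa using key S n
  | negSucc n =>
    rw [zpow_negSucc, ← inv_pow]
    exact key S.symm (n + 1)

lemma continuous_dynDist {Y : Type*} [MetricSpace Y] (S : Y ≃ₜ Y) (m n : ℤ) :
    Continuous fun p : Y × Y => dynDist S.toEquiv m n p.1 p.2 := by
  unfold dynDist
  refine Continuous.finset_sup_apply fun j _ => ?_
  have := S.continuous_toEquiv_zpow j
  fun_prop

lemma dynDist_lt_iff {Y : Type*} [MetricSpace Y] (S : Y ≃ Y) (m n : ℤ) (y z : Y) {r : ℝ}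
    (hr : 0 < r) :
    (dynDist S m n y z : ℝ) < r ↔
      ∀ j, m ≤ j → j < n → dist ((S ^ j : Equiv.Perm Y) y) ((S ^ j : Equiv.Perm Y) z) < r := by
  lift r to ℝ≥0 using hr.le
  have hr' : ⊥ < r := by simpa using hr
  rw [NNReal.coe_lt_coe, dynDist, Finset.sup_lt_iff hr']
  simp only [Finset.mem_Ico, and_imp, ← NNReal.coe_lt_coe, coe_nndist]

/-- Closeness along a long time window is inherited by shifted shorter windows. -/
lemma dynDist_shift_lt {Y : Type*} [MetricSpace Y] (S : Y ≃ Y) {m n k : ℤ} {y z : Y} {r : ℝ}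
    (hr : 0 < r) (h : (dynDist S 0 n y z : ℝ) < r) (hk : 0 ≤ k) (hkm : k + m ≤ n) :
    (dynDist S 0 m ((S ^ k : Equiv.Perm Y) y) ((S ^ k : Equiv.Perm Y) z) : ℝ) < r := by
  rw [dynDist_lt_iff _ _ _ _ _ hr] at h ⊢
  intro j hj hjm
  have := h (j + k) (by omega) (by omega)
  rwa [zpow_add, Equiv.Perm.mul_apply, Equiv.Perm.mul_apply] at this

/-- Points whose `n`-orbit segment returns `r`-close within time `6 n`. -/
def shortReturnSet {Y : Type*} [MetricSpace Y] (S : Y ≃ Y) (r : ℝ) (n : ℕ) : Set Y :=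
  {z | ∃ i : ℕ, (0 < i ∧ i ≤ 6 * n) ∧
    (dynDist S 0 (n : ℤ) z ((S ^ (i : ℤ) : Equiv.Perm Y) z) : ℝ) < r}

lemma isOpen_shortReturnSet {Y : Type*} [MetricSpace Y] (S : Y ≃ₜ Y) (r : ℝ) (n : ℕ) :
    IsOpen (shortReturnSet S.toEquiv r n) := by
  have : shortReturnSet S.toEquiv r n = ⋃ i : ℕ, ⋃ _ : 0 < i ∧ i ≤ 6 * n,
      {z | (dynDist S.toEquiv 0 (n : ℤ) z
        ((S.toEquiv ^ (i : ℤ) : Equiv.Perm Y) z) : ℝ) < r} := by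
    ext z
    simp only [shortReturnSet, mem_ofPred_eq, mem_iUnion, exists_prop]
  rw [this]
  refine isOpen_iUnion fun i => isOpen_iUnion fun _ => isOpen_lt ?_ continuous_const
  have h := (continuous_dynDist S 0 (n : ℤ)).comp
    (continuous_id.prodMk (S.continuous_toEquiv_zpow (i : ℤ)))
  exact NNReal.continuous_coe.comp h

lemma eventually_natCast_mul_lt_exp {a : ℝ} (ha : 0 < a) (K : ℝ) :
    ∀ᶠ n : ℕ in atTop, K * (n : ℝ) < Real.exp (a * n) := by
  have h := (Real.tendsto_pow_mul_exp_neg_atTop_nhds_zero 1).comp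
    ((tendsto_natCast_atTop_atTop (R := ℝ)).const_mul_atTop ha)
  have h2 := h.const_mul (K / a)
  rw [mul_zero] at h2
  filter_upwards [h2.eventually_lt_const one_pos] with n hn
  simp only [Function.comp_apply, pow_one] at hn
  have he := Real.exp_pos (a * n)
  rw [Real.exp_neg, ← mul_assoc, ← div_eq_mul_inv, div_lt_one he] at hn
  calc K * (n : ℝ) = K / a * (a * n) := by field_simp
    _ < _ := hn

lemma eventually_notMem_shortReturnSet {Y : Type*} [MetricSpace Y] (S : Y ≃ Y) {r : ℝ} {z : Y}
    (h : 0 < lowerDWEntropy S z r) : ∀ᶠ n : ℕ in atTop, z ∉ shortReturnSet S r n := by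
  obtain ⟨a, ha, hev⟩ := exists_pos_eventually_le_of_liminf_pos h
  filter_upwards [hev, eventually_natCast_mul_lt_exp ha 6, eventually_gt_atTop 0]
    with n hn hexp hn0 ⟨i, hi, hd⟩
  have hn0' : (0 : ℝ) < n := by exact_mod_cast hn0
  rw [le_div_iff₀ hn0'] at hn
  have hle : firstReturn S n z r ≤ i := Nat.sInf_le ⟨hi.1, hd⟩
  have hlog : 0 < Real.log (firstReturn S n z r) := (mul_pos ha hn0').trans_le hn
  have hfr : (0 : ℝ) < firstReturn S n z r := by
    refine (Nat.cast_nonneg _).lt_of_ne' fun h0 => ?_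
    simp [h0] at hlog
  have h1 := (Real.le_log_iff_exp_le hfr).1 hn
  have h2 : (firstReturn S n z r : ℝ) ≤ 6 * n := by exact_mod_cast hle.trans hi.2
  linarith

lemma eventually_measure_bowenBall_lt {Y : Type*} [MetricSpace Y] [MeasurableSpace Y] (S : Y ≃ Y)
    (ν : Measure Y) [IsFiniteMeasure ν] {r : ℝ} {z : Y} (h : 0 < lowerBKEntropy S ν z r)
    {α : ℝ} (hα : 0 < α) :
    ∀ᶠ n : ℕ in atTop, ν (bowenBall S 0 (n : ℤ) z r) < ENNReal.ofReal (α / n) := by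
  obtain ⟨a, ha, hev⟩ := exists_pos_eventually_le_of_liminf_pos h
  filter_upwards [hev, eventually_natCast_mul_lt_exp ha α⁻¹, eventually_gt_atTop 0]
    with n hn hexp hn0
  have hn0' : (0 : ℝ) < n := by exact_mod_cast hn0
  rw [le_div_iff₀ hn0'] at hn
  rw [ENNReal.lt_ofReal_iff_toReal_lt (measure_ne_top _ _)]
  rcases (ENNReal.toReal_nonneg (a := ν (bowenBall S 0 (n : ℤ) z r))).eq_or_lt with h0 | h0
  · rw [← h0]; positivity
  have h1 : (ν (bowenBall S 0 (n : ℤ) z r)).toReal ≤ Real.exp (-(a * n)) :=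
    (Real.log_le_iff_le_exp h0).1 (by linarith)
  refine h1.trans_lt ?_
  rw [Real.exp_neg, inv_lt_comm₀ (Real.exp_pos _) (by positivity)]
  calc (α / n)⁻¹ = α⁻¹ * n := by field_simp
    _ < _ := hexp

lemma measurable_measure_bowenBall {Y : Type*} [MetricSpace Y] [CompactSpace Y]
    [MeasurableSpace Y] [BorelSpace Y] (S : Y ≃ₜ Y) (ν : Measure Y) [SFinite ν] (m n : ℤ)
    (r : ℝ) : Measurable fun z => ν (bowenBall S.toEquiv m n z r) := by
  have hopen : IsOpen {p : Y × Y | (dynDist S.toEquiv m n p.1 p.2 : ℝ) < r} :=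
    isOpen_lt (NNReal.continuous_coe.comp (continuous_dynDist S m n)) continuous_const
  exact measurable_measure_prodMk_left hopen.measurableSet

/-- If the orbit of `y` up to time `8 M` visits the short-return set fewer than `M` times, then
`S^{6M} y` is separated along `2 M` steps from the previous `6 M` points of the orbit. -/
lemma le_dynDist_of_card_visits_lt {Y : Type*} [MetricSpace Y] (S : Y ≃ Y) {r : ℝ} (hr : 0 < r)
    {M : ℕ} {y : Y}
    (h : ∑ j ∈ Finset.range (8 * M), (shortReturnSet S r M).indicator (1 : Y → ℝ≥0∞) (S^[j] y) <
      M) {i : ℕ} (hi : i < 6 * M) :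
    r ≤ (dynDist S 0 ((2 * M : ℕ) : ℤ) ((S ^ (i : ℤ) : Equiv.Perm Y) y)
      ((S ^ ((6 * M : ℕ) : ℤ) : Equiv.Perm Y) y) : ℝ) := by
  by_contra! hlt
  refine h.not_ge ?_
  have hmem : ∀ j ∈ Finset.Ico i (i + M), S^[j] y ∈ shortReturnSet S r M := by
    intro j hj
    rw [Finset.mem_Ico] at hj
    refine ⟨6 * M - i, ⟨by omega, by omega⟩, ?_⟩
    have hs := dynDist_shift_lt S (m := M) (k := (j : ℤ) - i) hr hlt (by omega)
      (by push_cast; omega)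
    rw [← Equiv.Perm.mul_apply, ← Equiv.Perm.mul_apply, ← zpow_add, ← zpow_add] at hs
    have hj' : S^[j] y = (S ^ (j : ℤ) : Equiv.Perm Y) y := by
      rw [zpow_natCast, Equiv.Perm.coe_pow]
    rw [hj', ← Equiv.Perm.mul_apply, ← zpow_add]
    convert hs using 5 <;> (try push_cast) <;> omega
  calc (M : ℝ≥0∞) = ∑ j ∈ Finset.Ico i (i + M), (1 : ℝ≥0∞) := by simp
    _ = ∑ j ∈ Finset.Ico i (i + M), (shortReturnSet S r M).indicator (1 : Y → ℝ≥0∞) (S^[j] y) :=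
        Finset.sum_congr rfl fun j hj => by simp [hmem j hj]
    _ ≤ _ := Finset.sum_le_sum_of_subset fun j hj => by
        rw [Finset.mem_Ico] at hj
        rw [Finset.mem_range]
        omega

/-- **Marker lemma.**  Let `S` be a self-homeomorphism of a compact metric space preserving
an ergodic measure `ν` with `0 < h_ν(S) < ∞`, let `α ∈ (0,1)`, and let `η > 0` be such that
the (a.e. constant) lower Brin–Katok local entropy and lower Downarowicz–Weiss return-time
exponent at scale `4η` are positive.  Then for all sufficiently large `M` there is a point
`y_mark` whose initial `(2M)`-orbit stays `4η`-away from that of `S^{6M} y_mark` along the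
first `6M` iterates, and whose Bowen balls `B_0^{2M}(y_mark, 4η)` and
`B_0^{2M}(S^{6M} y_mark, 4η)` both have `ν`-measure less than `α/M`. -/
theorem marker_lemma
    {Y : Type*} [MetricSpace Y] [CompactSpace Y] [MeasurableSpace Y] [BorelSpace Y]
    (S : Y ≃ₜ Y) (ν : Measure Y) [IsProbabilityMeasure ν] (herg : Ergodic (⇑S) ν)
    (hpos : 0 < ksEntropy ν (⇑S)) (hfin : ksEntropy ν (⇑S) < ⊤)
    (α : ℝ) (hα0 : 0 < α) (hα1 : α < 1)
    (η : ℝ) (hη : 0 < η)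
    (cBK : ℝ) (hcBK : 0 < cBK)
    (hBK : ∀ᵐ z ∂ν, lowerBKEntropy S.toEquiv ν z (4 * η) = cBK)
    (cDW : ℝ) (hcDW : 0 < cDW)
    (hDW : ∀ᵐ z ∂ν, lowerDWEntropy S.toEquiv z (4 * η) = cDW) :
    ∃ M₀ : ℕ, ∀ M : ℕ, M₀ ≤ M →
      ∃ ymark : Y,
        (∀ i : ℕ, i < 6 * M →
          4 * η ≤ (dynDist S.toEquiv 0 ((2 * M : ℕ) : ℤ)
            ((S.toEquiv ^ (i : ℤ)) ymark)
            ((S.toEquiv ^ ((6 * M : ℕ) : ℤ)) ymark) : ℝ)) ∧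
        ν (bowenBall S.toEquiv 0 ((2 * M : ℕ) : ℤ) ymark (4 * η)) <
          ENNReal.ofReal (α / M) ∧
        ν (bowenBall S.toEquiv 0 ((2 * M : ℕ) : ℤ)
            ((S.toEquiv ^ ((6 * M : ℕ) : ℤ)) ymark) (4 * η)) <
          ENNReal.ofReal (α / M) := by
  have hr : 0 < 4 * η := by positivity
  set C : ℕ → Set Y := fun M => {z | ENNReal.ofReal (α / M) ≤
    ν (bowenBall S.toEquiv 0 ((2 * M : ℕ) : ℤ) z (4 * η))} with hC
  have hCm : ∀ M, MeasurableSet (C M) := fun M =>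
    measurableSet_le measurable_const (measurable_measure_bowenBall S ν _ _ _)
  have hBm : ∀ M, MeasurableSet (shortReturnSet S.toEquiv (4 * η) M) := fun M =>
    (isOpen_shortReturnSet S _ M).measurableSet
  have hCae : ∀ᵐ z ∂ν, ∀ᶠ M in atTop, z ∉ C M := by
    filter_upwards [hBK] with z hz
    have h2 : Tendsto (fun M : ℕ => 2 * M) atTop atTop :=
      tendsto_id.const_mul_atTop' two_pos
    filter_upwards [h2.eventually (eventually_measure_bowenBall_lt S.toEquiv ν
      (hz.symm ▸ hcBK : 0 < lowerBKEntropy S.toEquiv ν z (4 * η))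
      (mul_pos two_pos hα0))] with M hM
    have he : 2 * α / ((2 * M : ℕ) : ℝ) = α / M := by
      push_cast
      exact mul_div_mul_left _ _ two_ne_zero
    rw [he] at hM
    exact not_le.2 hM
  have hBae : ∀ᵐ z ∂ν, ∀ᶠ M in atTop, z ∉ shortReturnSet S.toEquiv (4 * η) M := by
    filter_upwards [hDW] with z hz
    exact eventually_notMem_shortReturnSet S.toEquiv (hz.symm ▸ hcDW)
  obtain ⟨M₀, hM₀⟩ := eventually_atTop.1
    ((eventually_measure_lt_of_ae_eventually_notMem ν hCm hCae
      (ε := ENNReal.ofReal (1 / 4)) (by simp)).and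
    ((eventually_measure_lt_of_ae_eventually_notMem ν hBm hBae
      (ε := ENNReal.ofReal (1 / 32)) (by simp)).and (eventually_gt_atTop 0)))
  refine ⟨M₀, fun M hM => ?_⟩
  obtain ⟨hCs, hBs, hM0⟩ := hM₀ M hM
  set V : Set Y := {y | (M : ℝ≥0∞) ≤ ∑ j ∈ Finset.range (8 * M),
    (shortReturnSet S.toEquiv (4 * η) M).indicator 1 (S^[j] y)} with hV
  have hmp : MeasurePreserving (⇑S) ν ν := herg.toMeasurePreserving
  have hVs : ν V ≤ ENNReal.ofReal (1 / 4) := by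
    have hmar := mul_measure_le_card_visits_le hmp (hBm M) (8 * M) M
    have hMne : (M : ℝ≥0∞) ≠ 0 := by exact_mod_cast hM0.ne'
    rw [← ENNReal.mul_le_mul_iff_right hMne (ENNReal.natCast_ne_top M)]
    calc _ ≤ _ := hmar
      _ ≤ ((8 * M : ℕ) : ℝ≥0∞) * ENNReal.ofReal (1 / 32) := by gcongr
      _ = M * (ENNReal.ofReal 8 * ENNReal.ofReal (1 / 32)) := by
          push_cast
          rw [ENNReal.ofReal_ofNat]
          ring
      _ = M * ENNReal.ofReal (1 / 4) := by
          rw [← ENNReal.ofReal_mul (by norm_num)]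
          norm_num
  have hD : ν (S^[6 * M] ⁻¹' C M) = ν (C M) :=
    (hmp.iterate _).measure_preimage (hCm M).nullMeasurableSet
  have hlt : ν (V ∪ C M ∪ S^[6 * M] ⁻¹' C M) < 1 := by
    have h34 : ENNReal.ofReal (1 / 4) + ENNReal.ofReal (1 / 4) + ENNReal.ofReal (1 / 4) < 1 := by
      rw [← ENNReal.ofReal_add (by norm_num) (by norm_num),
        ← ENNReal.ofReal_add (by norm_num) (by norm_num), ENNReal.ofReal_lt_one]
      norm_num
    refine lt_of_le_of_lt ((measure_union_le _ _).trans ?_) h34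
    exact add_le_add ((measure_union_le _ _).trans (add_le_add hVs hCs.le)) (hD.trans_le hCs.le)
  obtain ⟨y, hy⟩ : ∃ y, y ∉ V ∪ C M ∪ S^[6 * M] ⁻¹' C M := by
    by_contra! hall
    rw [eq_univ_of_forall hall, measure_univ] at hlt
    exact lt_irrefl _ hlt
  simp only [mem_union, not_or] at hy
  obtain ⟨⟨hyV, hyC⟩, hyD⟩ := hy
  refine ⟨y, fun i hi => le_dynDist_of_card_visits_lt S.toEquiv hr (not_le.1 hyV) hi,
    not_le.1 hyC, ?_⟩
  rw [zpow_natCast, Equiv.Perm.coe_pow]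
  exact not_le.1 hyD
end
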